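/- Let G and H be finite metacyclic groups. If ℚG and ℚH are isomorphic as ℚ-algebras, then for every prime p dividing |G|, the Sylow p-subgroups of G and of H are isomorphic. -/

import Mathlib

open scoped Classical

noncomputable section

namespace ArXiv230800432

/-- The `σ`-part of a natural number: product of `p ^ vₚ(n)` over primes `p ∈ σ` dividing `n`. -/
def natPart (n : ℕ) (σ : Set ℕ) : ℕ :=
  ∏ p ∈ n.primeFactors, if p ∈ σ then p ^ (n.factorization p) else 1

/-- A metacyclic factorization `G = A·B` with `A` cyclic normal and `B` cyclic. -/
structure MetacyclicFact (G : Type*) [Group G] where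
  A : Subgroup G
  B : Subgroup G
  normalA : A.Normal
  cyclicA : IsCyclic A
  cyclicB : IsCyclic B
  mul_cover : ∀ g : G, ∃ x ∈ A, ∃ y ∈ B, g = x * y

/-- A group is metacyclic if it admits a metacyclic factorization. -/
def IsMetacyclic (G : Type*) [Group G] : Prop :=
  Nonempty (MetacyclicFact G)

variable {G : Type*} [Group G]

/-- `π_G`: primes `p` dividing `|G|` such that `G` has a normal Hall `p'`-subgroup. -/
def piSet (G : Type*) [Group G] : Set ℕ :=
  {p | p.Prime ∧ p ∣ Nat.card G ∧
    ∃ N : Subgroup G, N.Normal ∧ Nat.card N = ordCompl[p] (Nat.card G)}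

/-- `π'_G = π(G) \ π_G`. -/
def piSet' (G : Type*) [Group G] : Set ℕ :=
  {p | p.Prime ∧ p ∣ Nat.card G} \ piSet G

/-- The image mod `d` of `T_G(A)`: classes `[t]_d` such that some `g ∈ G` acts on `A` by
conjugation as `x ↦ x ^ t`.  For `d = |A|` this is exactly `T_G(A)`. -/
def TGmod (A : Subgroup G) (d : ℕ) : Subgroup (ZMod d)ˣ :=
  Subgroup.closure
    {u : (ZMod d)ˣ | ∃ g : G, ∃ t : ℕ, ((t : ZMod d) = (u : ZMod d)) ∧
      ∀ x ∈ A, g⁻¹ * x * g = x ^ t}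

/-- `T_G(A)` as subgroup of `(ℤ/|A|ℤ)ˣ`. -/
def TG (A : Subgroup G) : Subgroup (ZMod (Nat.card A))ˣ :=
  TGmod A (Nat.card A)

/-- The image of `T` under `Res_q : (ℤ/dℤ)ˣ → (ℤ/qℤ)ˣ` is trivial. -/
def resTriv (d q : ℕ) (T : Subgroup (ZMod d)ˣ) : Prop :=
  ∀ u ∈ T, ∀ t : ℕ, ((t : ZMod d) = (u : ZMod d)) → (t : ZMod q) = 1

/-- The image of `T` under `Res_q` is contained in `⟨-1⟩`. -/
def resInPMOne (d q : ℕ) (T : Subgroup (ZMod d)ˣ) : Prop :=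
  ∀ u ∈ T, ∀ t : ℕ, ((t : ZMod d) = (u : ZMod d)) →
    ((t : ZMod q) = 1 ∨ (t : ZMod q) = -1)

/-- The image of `T` under `Res_q` as a set of units mod `q`. -/
def resSet (d q : ℕ) (T : Subgroup (ZMod d)ˣ) : Set (ZMod q)ˣ :=
  {v | ∃ u ∈ T, ∃ t : ℕ, ((t : ZMod d) = (u : ZMod d)) ∧ ((t : ZMod q) = (v : ZMod q))}

/-- The set of natural numbers representing elements of `T ≤ (ℤ/dℤ)ˣ`. -/
def liftSet {d : ℕ} (T : Subgroup (ZMod d)ˣ) : Set ℕ :=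
  {t | ∃ u ∈ T, (t : ZMod d) = (u : ZMod d)}

/-- `r^G(A)`: the greatest divisor `r` of `|A|` such that `Res_{r_{2'}}(T_G(A)) = 1` and
`Res_{r_2}(T_G(A)) ⊆ ⟨-1⟩`. -/
def rOfA (A : Subgroup G) : ℕ :=
  sSup {r : ℕ | r ∣ Nat.card A ∧ resTriv (Nat.card A) (ordCompl[2] r) (TG A) ∧
    resInPMOne (Nat.card A) (ordProj[2] r) (TG A)}

/-- `ε^G(A)`: `-1` if `Res_{r_2}(T_G(A)) ≠ 1`, and `1` otherwise. -/
def epsOfA (A : Subgroup G) : ℤ :=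
  if resTriv (Nat.card A) (ordProj[2] (rOfA A)) (TG A) then 1 else -1

/-- `k^G(A)`: order of the image of `T_G(A)` in `(ℤ/m_ν ℤ)ˣ`, `ν` the primes dividing `|A|`
but not `r^G(A)`. -/
def kOfA (A : Subgroup G) : ℕ :=
  (resSet (Nat.card A) (natPart (Nat.card A) {p | ¬ p ∣ rOfA A}) (TG A)).ncard

/-- The triple `(|A|, r^G(A), [G:B])` attached to a metacyclic factorization. -/
def factTriple (f : MetacyclicFact G) : ℕ × ℕ × ℕ :=
  (Nat.card f.A, rOfA f.A, f.B.index)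

/-- Lexicographic order on triples. -/
def lex3 (x y : ℕ × ℕ × ℕ) : Prop :=
  x.1 < y.1 ∨ (x.1 = y.1 ∧ (x.2.1 < y.2.1 ∨ (x.2.1 = y.2.1 ∧ x.2.2 ≤ y.2.2)))

/-- A metacyclic factorization is minimal when its triple is lexicographically minimal. -/
def IsMinimalFact (f : MetacyclicFact G) : Prop :=
  ∀ f' : MetacyclicFact G, lex3 (factTriple f) (factTriple f')

def mOf (f : MetacyclicFact G) : ℕ := Nat.card f.A
def nOf (f : MetacyclicFact G) : ℕ := f.A.index
def sOf (f : MetacyclicFact G) : ℕ := f.B.index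
def rOf (f : MetacyclicFact G) : ℕ := rOfA f.A
def epsOf (f : MetacyclicFact G) : ℤ := epsOfA f.A
def kOf (f : MetacyclicFact G) : ℕ := kOfA f.A

/-- The `σ`-part of an element of a finite group. -/
def elemPart (σ : Set ℕ) (g : G) : G :=
  g ^ ((orderOf g / natPart (orderOf g) σ) *
    (((orderOf g / natPart (orderOf g) σ : ℕ) : ZMod (natPart (orderOf g) σ))⁻¹.val))

/-- The (unique, for `N` cyclic) Hall `σ`-subgroup of a subgroup `N`. -/
def hallOf (N : Subgroup G) (σ : Set ℕ) : Subgroup G :=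
  Subgroup.closure {x : G | x ∈ N ∧ orderOf x ∣ natPart (Nat.card N) σ}

/-- `R^G = T_G(G'_{π'})`, realized as a subgroup of `(ℤ/dℤ)ˣ`. -/
def ROf (G : Type*) [Group G] (d : ℕ) : Subgroup (ZMod d)ˣ :=
  TGmod (hallOf (commutator G) (piSet' G)) d

/-- A block of a ring: a primitive central idempotent. -/
def IsBlock {R : Type*} [Ring R] (e : R) : Prop :=
  e ≠ 0 ∧ e * e = e ∧ (∀ x, x * e = e * x) ∧
    ∀ z : R, (∀ x, x * z = z * x) → z * z = z → z * e = 0 ∨ z * e = e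

/-- A finite family of orthogonal idempotents with sum one and one-dimensional corners,
together with the relation of lying in the same block. -/
structure LinkedFamily (K : Type*) {R ι : Type*} [Field K] [Ring R] [Algebra K R] [Fintype ι]
    (f : ι → R) (s : Setoid ι) : Prop where
  ne_zero : ∀ i, f i ≠ 0
  idem : ∀ i, f i * f i = f i
  orth : ∀ i j, i ≠ j → f i * f j = 0
  sum_eq : ∑ i, f i = 1
  corner : ∀ i x, ∃ c : K, f i * x * f i = c • f i
  link : ∀ i j, s i j → ∃ x, f i * x * f j ≠ 0
  unlink : ∀ i j x, ¬ s i j → f i * x * f j = 0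

/-- The sum of an idempotent family over a class of an equivalence relation. -/
def classSum {R ι : Type*} [Ring R] [Fintype ι] (f : ι → R) (s : Setoid ι) (i : ι) : R :=
  ∑ j with s i j, f j

namespace LinkedFamily

variable {K R ι : Type*} [Field K] [Ring R] [Algebra K R] [Fintype ι] {f : ι → R} {s : Setoid ι}

theorem mul_classSum (h : LinkedFamily K f s) (i j : ι) :
    f j * classSum f s i = if s i j then f j else 0 := by
  rw [classSum, Finset.mul_sum]
  split_ifs with hij
  · rw [Finset.sum_eq_single j]
    · exact h.idem j
    · exact fun k _ hk => h.orth j k hk.symm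
    · intro hj; simp [hij] at hj
  · refine Finset.sum_eq_zero fun k hk => h.orth j k ?_
    rintro rfl
    simp [hij] at hk

theorem classSum_mul (h : LinkedFamily K f s) (i j : ι) :
    classSum f s i * f j = if s i j then f j else 0 := by
  rw [classSum, Finset.sum_mul]
  split_ifs with hij
  · rw [Finset.sum_eq_single j]
    · exact h.idem j
    · exact fun k _ hk => h.orth k j hk
    · intro hj; simp [hij] at hj
  · refine Finset.sum_eq_zero fun k hk => h.orth k j ?_
    rintro rfl
    simp [hij] at hk

theorem classSum_eq_iff (h : LinkedFamily K f s) (i j : ι) :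
    classSum f s i = classSum f s j ↔ s i j := by
  constructor
  · intro hE
    have := h.mul_classSum i j
    rw [hE, h.mul_classSum j j, if_pos (s.refl j)] at this
    by_contra hij
    rw [if_neg hij] at this
    exact h.ne_zero j this
  · intro hij
    unfold classSum
    congr 1
    ext k
    simp only [Finset.mem_filter, Finset.mem_univ, true_and]
    exact ⟨fun hk => s.trans (s.symm hij) hk, fun hk => s.trans hij hk⟩

theorem ext_of_mul (h : LinkedFamily K f s) {x y : R} (hxy : ∀ j, f j * x = f j * y) : x = y := by
  rw [← one_mul x, ← one_mul y, ← h.sum_eq, Finset.sum_mul, Finset.sum_mul]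
  exact Finset.sum_congr rfl fun j _ => hxy j

theorem ext_of_mul_right (h : LinkedFamily K f s) {x y : R} (hxy : ∀ j, x * f j = y * f j) :
    x = y := by
  rw [← mul_one x, ← mul_one y, ← h.sum_eq, Finset.mul_sum, Finset.mul_sum]
  exact Finset.sum_congr rfl fun j _ => hxy j

theorem classSum_central (h : LinkedFamily K f s) (i : ι) (x : R) :
    x * classSum f s i = classSum f s i * x := by
  refine h.ext_of_mul fun j => h.ext_of_mul_right fun k => ?_
  rw [← mul_assoc (f j), mul_assoc (f j * x), h.classSum_mul, ← mul_assoc (f j), h.mul_classSum]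
  by_cases hjk : s j k
  · by_cases hij : s i j
    · simp [hij, s.trans hij hjk]
    · have : ¬ s i k := fun hik => hij (s.trans hik (s.symm hjk))
      simp [hij, this]
  · split_ifs <;> simp [h.unlink j k x hjk]

theorem classSum_idem (h : LinkedFamily K f s) (i : ι) :
    classSum f s i * classSum f s i = classSum f s i := by
  refine h.ext_of_mul fun j => ?_
  rw [← mul_assoc, h.mul_classSum]
  split_ifs with hij
  · rw [h.mul_classSum, if_pos hij]
  · simp

theorem classSum_ne_zero (h : LinkedFamily K f s) (i : ι) : classSum f s i ≠ 0 := by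
  intro h0
  have := h.mul_classSum i i
  rw [h0, mul_zero, if_pos (s.refl i)] at this
  exact h.ne_zero i this.symm

/-- A central idempotent acts on each member of the family as a scalar `0` or `1`, constant on
classes. -/
theorem central_idem_mul (h : LinkedFamily K f s) {z : R} (hc : ∀ x, x * z = z * x)
    (hz : z * z = z) (i : ι) :
    (∀ j, s i j → z * f j = 0) ∨ (∀ j, s i j → z * f j = f j) := by
  have key : ∀ j, ∃ c : K, z * f j = c • f j := fun j => by
    obtain ⟨c, hc'⟩ := h.corner j z
    exact ⟨c, by rw [← hc', hc, mul_assoc, h.idem]⟩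
  choose c hc' using key
  have hconst : ∀ j, s i j → c i = c j := fun j hij => by
    obtain ⟨x, hx⟩ := h.link i j hij
    have h1 : z * (f i * x * f j) = c i • (f i * x * f j) := by
      rw [← mul_assoc, ← mul_assoc, hc', smul_mul_assoc, smul_mul_assoc]
    have h2 : z * (f i * x * f j) = c j • (f i * x * f j) := by
      rw [← hc, mul_assoc, hc, hc', mul_smul_comm]
    have h3 : (c i - c j) • (f i * x * f j) = 0 := by rw [sub_smul, ← h1, ← h2, sub_self]
    exact sub_eq_zero.1 ((smul_eq_zero.1 h3).resolve_right hx)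
  have hsq : c i * c i = c i := by
    have h1 : (c i * c i - c i) • f i = 0 := by
      rw [sub_smul, mul_smul, ← hc', ← mul_smul_comm, ← hc', ← mul_assoc, hz, sub_self]
    exact sub_eq_zero.1 ((smul_eq_zero.1 h1).resolve_right (h.ne_zero i))
  rcases eq_or_ne (c i) 0 with h0 | h0
  · left; intro j hij
    rw [hc', ← hconst j hij, h0, zero_smul]
  · right; intro j hij
    have h1 : c i = 1 := by
      have := mul_right_cancel₀ h0 (hsq.trans (one_mul _).symm)
      exact this
    rw [hc', ← hconst j hij, h1, one_smul]

theorem isBlock_iff (h : LinkedFamily K f s) (e : R) : IsBlock e ↔ ∃ i, classSum f s i = e := by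
  constructor
  · rintro ⟨hne, hidem, hcent, hmin⟩
    obtain ⟨i, hi⟩ : ∃ i, e * f i ≠ 0 := by
      by_contra! hcon
      exact hne (h.ext_of_mul_right fun j => by rw [hcon, zero_mul])
    refine ⟨i, ?_⟩
    have h1 : e * classSum f s i = classSum f s i := by
      rcases h.central_idem_mul hcent hidem i with h0 | h0
      · exact absurd (h0 i (s.refl i)) hi
      · rw [classSum, Finset.mul_sum]
        exact Finset.sum_congr rfl fun j hj => h0 j (by simpa using hj)
    rcases hmin _ (h.classSum_central i) (h.classSum_idem i) with h2 | h2
    · rw [hcent, h1] at h2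
      exact absurd h2 (h.classSum_ne_zero i)
    · rw [hcent, h1] at h2
      exact h2
  · rintro ⟨i, rfl⟩
    refine ⟨h.classSum_ne_zero i, h.classSum_idem i, h.classSum_central i, fun z hc hz => ?_⟩
    rcases h.central_idem_mul hc hz i with h0 | h0
    · left
      rw [classSum, Finset.mul_sum]
      exact Finset.sum_eq_zero fun j hj => h0 j (by simpa using hj)
    · right
      rw [classSum, Finset.mul_sum]
      exact Finset.sum_congr rfl fun j hj => h0 j (by simpa using hj)

theorem finsum_block (h : LinkedFamily K f s) (P : R → Prop) (tr : R →ₗ[K] K) :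
    ∑ᶠ e ∈ {e : R | IsBlock e ∧ P e}, tr e =
      ∑ i, if P (classSum f s i) then tr (f i) else 0 := by
  have hset : {e : R | IsBlock e ∧ P e} =
      ((Finset.univ.filter fun i => P (classSum f s i)).image (classSum f s) : Finset R) := by
    ext e
    simp only [Set.mem_ofPred_eq, Finset.coe_image, Finset.coe_filter, Finset.mem_univ, true_and,
      Set.mem_image, h.isBlock_iff]
    constructor
    · rintro ⟨⟨i, rfl⟩, hP⟩; exact ⟨i, hP, rfl⟩
    · rintro ⟨i, hP, rfl⟩; exact ⟨⟨i, rfl⟩, hP⟩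
  rw [hset, finsum_mem_coe_finset, ← Finset.sum_filter,
    ← Finset.sum_fiberwise_of_maps_to (g := classSum f s)
      (t := (Finset.univ.filter fun i => P (classSum f s i)).image (classSum f s))
      (fun i hi => Finset.mem_image_of_mem _ hi)]
  refine Finset.sum_congr rfl fun e he => ?_
  obtain ⟨i, hi, rfl⟩ := Finset.mem_image.1 he
  have htr : tr (classSum f s i) = ∑ j with s i j, tr (f j) := map_sum _ _ _
  rw [htr]
  refine Finset.sum_congr ?_ fun _ _ => rfl
  ext j
  simp only [Finset.mem_filter, Finset.mem_univ, true_and] at hi ⊢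
  rw [h.classSum_eq_iff]
  constructor
  · intro hij
    refine ⟨?_, s.symm hij⟩
    rw [← (h.classSum_eq_iff i j).2 hij]; exact hi
  · exact fun hj => s.symm hj.2

end LinkedFamily

section RootProj

variable {K R : Type*} [Field K] [Ring R] [Algebra K R]

/-- The projection onto the `w`-eigenspace of `γ` inside the range of the idempotent `e`, when
`γ ^ M` acts there as the scalar `w ^ M`. -/
def rootProj (γ e : R) (M : ℕ) (w : K) : R :=
  (M : K)⁻¹ • ∑ j ∈ Finset.range M, (w⁻¹) ^ j • (γ ^ j * e)

theorem rootProj_mul_idem {γ e : R} {M : ℕ} {w : K} (he : e * e = e) :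
    rootProj γ e M w * e = rootProj γ e M w := by
  simp only [rootProj, smul_mul_assoc, Finset.sum_mul, mul_assoc, he]

theorem idem_mul_rootProj {γ e : R} {M : ℕ} {w : K} (he : e * e = e) (hc : Commute γ e) :
    e * rootProj γ e M w = rootProj γ e M w := by
  simp only [rootProj, mul_smul_comm, Finset.mul_sum]
  congr 1
  refine Finset.sum_congr rfl fun j _ => ?_
  rw [← mul_assoc, ← (hc.pow_left j).eq, mul_assoc, he]

theorem commute_rootProj {γ e x : R} {M : ℕ} {w : K} (h1 : Commute x γ) (h2 : Commute x e) :
    Commute x (rootProj γ e M w) := by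
  refine Commute.smul_right (Commute.sum_right _ _ _ fun j _ => ?_) _
  exact ((h1.pow_right j).mul_right h2).smul_right _

theorem mul_rootProj {γ e : R} {M : ℕ} {w : K} (hw : w ≠ 0) (hM : γ ^ M * e = w ^ M • e) :
    γ * rootProj γ e M w = w • rootProj γ e M w := by
  simp only [rootProj, mul_smul_comm, Finset.mul_sum, Finset.smul_sum]
  rw [← Finset.smul_sum, ← Finset.smul_sum, ← Finset.smul_sum, smul_comm w]
  congr 1
  rw [Finset.smul_sum]
  have h1 : ∀ j, w⁻¹ ^ j • (γ * (γ ^ j * e)) = w • (w⁻¹ ^ (j + 1) • (γ ^ (j + 1) * e)) := by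
    intro j
    rw [smul_smul, pow_succ' w⁻¹, ← mul_assoc w, mul_inv_cancel₀ hw, one_mul, pow_succ' γ,
      mul_assoc]
  simp only [h1]
  have h2 : w • (w⁻¹ ^ M • (γ ^ M * e)) = w • (w⁻¹ ^ 0 • (γ ^ 0 * e)) := by
    rw [hM, smul_smul (w⁻¹ ^ M), inv_pow, inv_mul_cancel₀ (pow_ne_zero _ hw)]
    simp
  have h3 := Finset.sum_range_succ (fun j => w • (w⁻¹ ^ j • (γ ^ j * e))) M
  have h4 := Finset.sum_range_succ' (fun j => w • (w⁻¹ ^ j • (γ ^ j * e))) M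
  rw [h3, h2] at h4
  exact (add_right_cancel h4).symm

theorem pow_mul_rootProj {γ e : R} {M : ℕ} {w : K} (hw : w ≠ 0) (hM : γ ^ M * e = w ^ M • e)
    (k : ℕ) : γ ^ k * rootProj γ e M w = w ^ k • rootProj γ e M w := by
  induction k with
  | zero => simp
  | succ k ih => rw [pow_succ, mul_assoc, mul_rootProj hw hM, mul_smul_comm, ih, smul_smul,
      pow_succ']

theorem rootProj_mul_rootProj {γ e : R} {M : ℕ} {w w' : K} (hc : Commute γ e) (hw : w ≠ 0)
    (hw' : w' ≠ 0) (hM : γ ^ M * e = w ^ M • e) (hM' : γ ^ M * e = w' ^ M • e) (hne : w ≠ w') :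
    rootProj γ e M w * rootProj γ e M w' = 0 := by
  have h1 : γ * (rootProj γ e M w * rootProj γ e M w') =
      w • (rootProj γ e M w * rootProj γ e M w') := by
    rw [← mul_assoc, mul_rootProj hw hM, smul_mul_assoc]
  have h2 : γ * (rootProj γ e M w * rootProj γ e M w') =
      w' • (rootProj γ e M w * rootProj γ e M w') := by
    rw [← mul_assoc, (commute_rootProj (Commute.refl γ) hc).eq, mul_assoc, mul_rootProj hw' hM',
      mul_smul_comm]
  have h3 : (w - w') • (rootProj γ e M w * rootProj γ e M w') = 0 := by
    rw [sub_smul, ← h1, ← h2, sub_self]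
  exact (smul_eq_zero.1 h3).resolve_left (sub_ne_zero.2 hne)

theorem rootProj_idem {γ e : R} {M : ℕ} {w : K} (he : e * e = e) (hc : Commute γ e) (hw : w ≠ 0)
    (hM : γ ^ M * e = w ^ M • e) (hMK : (M : K) ≠ 0) :
    rootProj γ e M w * rootProj γ e M w = rootProj γ e M w := by
  conv_lhs => enter [1]; rw [rootProj]
  rw [smul_mul_assoc, Finset.sum_mul]
  have : ∀ j ∈ Finset.range M, (w⁻¹ ^ j • (γ ^ j * e)) * rootProj γ e M w = rootProj γ e M w := by
    intro j _
    rw [smul_mul_assoc, mul_assoc, idem_mul_rootProj he hc, pow_mul_rootProj hw hM, smul_smul,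
      ← mul_pow, inv_mul_cancel₀ hw, one_pow, one_smul]
  rw [Finset.sum_congr rfl this, Finset.sum_const, Finset.card_range, ← Nat.cast_smul_eq_nsmul K,
    smul_smul, inv_mul_cancel₀ hMK, one_smul]

theorem sum_nthRootsFinset_inv_pow {M : ℕ} {Y w₀ η : K} (hM : 0 < M) (hw₀ : w₀ ^ M = Y)
    (hY : Y ≠ 0) (hη : IsPrimitiveRoot η M) {j : ℕ} (hj : j < M) :
    ∑ w ∈ Polynomial.nthRootsFinset M Y, w⁻¹ ^ j = if j = 0 then (M : K) else 0 := by
  have hη0 : η ≠ 0 := hη.ne_zero hM.ne'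
  split_ifs with h0
  · subst h0
    have hw0 : w₀ ≠ 0 := by rintro rfl; rw [zero_pow hM.ne'] at hw₀; exact hY hw₀.symm
    have hcard : (Polynomial.nthRootsFinset M Y).card = M := by
      have hnd : (Polynomial.nthRoots M Y).Nodup := hη.nthRoots_nodup hY
      rw [Polynomial.nthRootsFinset_def, Multiset.toFinset_card_of_nodup hnd, hη.card_nthRoots,
        if_pos ⟨w₀, hw₀⟩]
    simp [hcard]
  · set S := ∑ w ∈ Polynomial.nthRootsFinset M Y, w⁻¹ ^ j with hS
    have hS' : S = (η⁻¹) ^ j * S := by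
      rw [hS, Finset.mul_sum]
      refine Finset.sum_bij' (fun w _ => η⁻¹ * w) (fun w _ => η * w) ?_ ?_ ?_ ?_ ?_
      · intro w hw
        rw [Polynomial.mem_nthRootsFinset hM] at hw ⊢
        rw [mul_pow, inv_pow, hη.pow_eq_one, inv_one, one_mul, hw]
      · intro w hw
        rw [Polynomial.mem_nthRootsFinset hM] at hw ⊢
        rw [mul_pow, hη.pow_eq_one, one_mul, hw]
      · intro w _; field_simp
      · intro w _; field_simp
      · intro w _
        rw [← mul_pow]
        congr 1
        rw [mul_inv, inv_inv, ← mul_assoc, inv_mul_cancel₀ hη0, one_mul]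
    have h1 : (η⁻¹) ^ j ≠ 1 := by
      rw [inv_pow, Ne, inv_eq_one]
      exact hη.pow_ne_one_of_pos_of_lt h0 hj
    have h2 : (1 - (η⁻¹) ^ j) * S = 0 := by rw [sub_mul, one_mul, ← hS', sub_self]
    exact (mul_eq_zero.1 h2).resolve_left (sub_ne_zero.2 h1.symm)

theorem sum_rootProj {γ e : R} {M : ℕ} {Y w₀ η : K} (hM : 0 < M) (hw₀ : w₀ ^ M = Y)
    (hY : Y ≠ 0) (hη : IsPrimitiveRoot η M) (hMK : (M : K) ≠ 0) :
    ∑ w ∈ Polynomial.nthRootsFinset M Y, rootProj γ e M w = e := by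
  simp only [rootProj]
  rw [← Finset.smul_sum, Finset.sum_comm]
  simp only [← Finset.sum_smul]
  rw [Finset.sum_eq_single_of_mem 0 (Finset.mem_range.2 hM)]
  · rw [sum_nthRootsFinset_inv_pow hM hw₀ hY hη hM, if_pos rfl, smul_smul, inv_mul_cancel₀ hMK]
    simp
  · intro j hj hj0
    rw [sum_nthRootsFinset_inv_pow hM hw₀ hY hη (Finset.mem_range.1 hj), if_neg hj0, zero_smul]

end RootProj

/-- The period of a root of unity `y` under `y ↦ y ^ r`. -/
def per {K : Type*} [Monoid K] (r : ℕ) (y : K) : ℕ := Function.minimalPeriod (fun x : K => x ^ r) y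

theorem per_dvd_iff {K : Type*} [Monoid K] {r d : ℕ} {y : K} :
    per r y ∣ d ↔ y ^ r ^ d = y := by
  rw [per, ← Function.isPeriodicPt_iff_minimalPeriod_dvd, Function.IsPeriodicPt,
    Function.IsFixedPt, pow_iterate]

theorem pow_map_iterate {K : Type*} [Monoid K] (r k : ℕ) (y : K) :
    (fun x : K => x ^ r)^[k] y = y ^ r ^ k := by
  rw [pow_iterate]

open Polynomial in
/-- The pairs `(y, w)` with `y ^ m = 1` and `w ^ (n / per r y) = y ^ z`. -/
def pairSet (K : Type*) [Field K] (m n r z : ℕ) : Finset (Σ _ : K, K) :=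
  (nthRootsFinset m (1 : K)).sigma fun y => nthRootsFinset (n / per r y) (y ^ z)

/-- Two pairs are linked when the second entries agree and the first ones lie on the same orbit of
`y ↦ y ^ r`. -/
def pairSetoid (K : Type*) [Field K] (m n r z : ℕ) : Setoid (pairSet K m n r z) where
  r q q' := (∃ k l : ℕ, q.1.1 ^ r ^ k = q'.1.1 ^ r ^ l) ∧ q.1.2 = q'.1.2
  iseqv :=
    { refl := fun q => ⟨⟨0, 0, rfl⟩, rfl⟩
      symm := fun ⟨⟨k, l, h⟩, h'⟩ => ⟨⟨l, k, h.symm⟩, h'.symm⟩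
      trans := fun {x y w} ⟨⟨k, l, h⟩, h'⟩ ⟨⟨i, j, h1⟩, h1'⟩ => by
        refine ⟨⟨k + i, j + l, ?_⟩, h'.trans h1'⟩
        rw [pow_add r k, pow_mul, h, ← pow_mul, mul_comm, pow_mul, h1, ← pow_mul, ← pow_add] }

/-- Arithmetic conditions on the parameters of a metacyclic presentation. -/
structure MetaNum (m n r z : ℕ) : Prop where
  m_pos : 0 < m
  n_pos : 0 < n
  r_pow : r ^ n ≡ 1 [MOD m]
  z_mul : z * r ≡ z [MOD m]

namespace MetaNum

variable {K : Type*} [Field K] {m n r z : ℕ}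

theorem pow_eq_of_modEq {y : K} {a b : ℕ} (hy : y ^ m = 1) (hab : a ≡ b [MOD m]) :
    y ^ a = y ^ b := by
  rw [← Nat.mod_add_div a m, ← Nat.mod_add_div b m, pow_add, pow_add, pow_mul y m, pow_mul y m, hy,
    one_pow, one_pow, mul_one, mul_one, hab]

theorem pow_r_pow_n (h : MetaNum m n r z) {y : K} (hy : y ^ m = 1) : y ^ r ^ n = y := by
  rw [pow_eq_of_modEq hy h.r_pow, pow_one]

theorem per_dvd (h : MetaNum m n r z) {y : K} (hy : y ^ m = 1) : per r y ∣ n :=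
  per_dvd_iff.2 (h.pow_r_pow_n hy)

theorem per_pos (h : MetaNum m n r z) {y : K} (hy : y ^ m = 1) : 0 < per r y :=
  Nat.pos_of_dvd_of_pos (h.per_dvd hy) h.n_pos

theorem div_per_pos (h : MetaNum m n r z) {y : K} (hy : y ^ m = 1) : 0 < n / per r y :=
  Nat.div_pos (Nat.le_of_dvd h.n_pos (h.per_dvd hy)) (h.per_pos hy)

theorem pow_r_injective (h : MetaNum m n r z) {y y' : K} (hy : y ^ m = 1) (hy' : y' ^ m = 1)
    {k : ℕ} (he : y ^ r ^ k = y' ^ r ^ k) : y = y' := by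
  have key : ∀ x : K, x ^ m = 1 → (x ^ r ^ k) ^ r ^ ((n - 1) * k) = x := by
    intro x hx
    rw [← pow_mul, ← pow_add]
    have : k + (n - 1) * k = n * k := by
      obtain ⟨n', rfl⟩ : ∃ n', n = n' + 1 := ⟨n - 1, by have := h.n_pos; omega⟩
      simp; ring
    rw [this]
    have h2 : r ^ (n * k) ≡ 1 [MOD m] := by
      rw [pow_mul]; simpa using h.r_pow.pow k
    rw [pow_eq_of_modEq hx h2, pow_one]
  rw [← key y hy, ← key y' hy', he]

theorem per_pow_r (h : MetaNum m n r z) {y : K} (hy : y ^ m = 1) (k : ℕ) :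
    per r (y ^ r ^ k) = per r y := by
  have hyk : (y ^ r ^ k) ^ m = 1 := by rw [← pow_mul, mul_comm, pow_mul, hy, one_pow]
  refine Nat.dvd_antisymm (per_dvd_iff.2 ?_) (per_dvd_iff.2 ?_)
  · rw [← pow_mul, mul_comm, pow_mul, per_dvd_iff.1 dvd_rfl]
  · have h1 := per_dvd_iff.1 (dvd_refl (per r (y ^ r ^ k)))
    rw [← pow_mul, mul_comm, pow_mul] at h1
    exact h.pow_r_injective (by rw [← pow_mul, mul_comm, pow_mul, hy, one_pow]) hy h1

theorem pow_r_pow_z (h : MetaNum m n r z) {y : K} (hy : y ^ m = 1) (k : ℕ) :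
    (y ^ r ^ k) ^ z = y ^ z := by
  rw [← pow_mul]
  refine pow_eq_of_modEq hy ?_
  induction k with
  | zero => simp [Nat.ModEq.rfl]
  | succ k ih =>
    calc r ^ (k + 1) * z = r ^ k * (z * r) := by ring
      _ ≡ r ^ k * z [MOD m] := h.z_mul.mul_left _
      _ ≡ z [MOD m] := ih

theorem mem_pairSet (h : MetaNum m n r z) (q : Σ _ : K, K) :
    q ∈ pairSet K m n r z ↔ q.1 ^ m = 1 ∧ q.2 ^ (n / per r q.1) = q.1 ^ z := by
  rw [pairSet, Finset.mem_sigma, Polynomial.mem_nthRootsFinset h.m_pos]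
  constructor
  · rintro ⟨h1, h2⟩
    exact ⟨h1, (Polynomial.mem_nthRootsFinset (h.div_per_pos h1) _).1 h2⟩
  · rintro ⟨h1, h2⟩
    exact ⟨h1, (Polynomial.mem_nthRootsFinset (h.div_per_pos h1) _).2 h2⟩

theorem pairSetoid_iff (h : MetaNum m n r z) (q q' : pairSet K m n r z) :
    pairSetoid K m n r z q q' ↔ (∃ k, q'.1.1 = q.1.1 ^ r ^ k) ∧ q.1.2 = q'.1.2 := by
  refine and_congr_left fun _ => ⟨?_, fun ⟨k, hk⟩ => ⟨k, 0, by simp [hk]⟩⟩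
  rintro ⟨k, l, hkl⟩
  have hq := ((h.mem_pairSet q.1).1 q.2).1
  have hq' := ((h.mem_pairSet q'.1).1 q'.2).1
  refine ⟨k + (n - 1) * l, h.pow_r_injective (k := l) hq' ?_ ?_⟩
  · rw [← pow_mul, mul_comm, pow_mul, hq, one_pow]
  · rw [← hkl, ← pow_mul, ← pow_add]
    have : k + (n - 1) * l + l = n * l + k := by
      obtain ⟨n', rfl⟩ : ∃ n', n = n' + 1 := ⟨n - 1, by have := h.n_pos; omega⟩
      simp; ring
    rw [this]
    refine pow_eq_of_modEq hq ?_
    have h2 : r ^ (n * l) ≡ 1 [MOD m] := by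
      rw [pow_mul]; simpa using h.r_pow.pow l
    rw [pow_add]
    simpa using (h2.mul_right (r ^ k)).symm

theorem card_class (h : MetaNum m n r z) (q : pairSet K m n r z) :
    (Finset.univ.filter fun q' => pairSetoid K m n r z q q').card = per r q.1.1 := by
  have hq := (h.mem_pairSet q.1).1 q.2
  have hmem : ∀ k, (⟨q.1.1 ^ r ^ k, q.1.2⟩ : Σ _ : K, K) ∈ pairSet K m n r z := fun k => by
    rw [h.mem_pairSet]
    refine ⟨by simp only; rw [← pow_mul, mul_comm, pow_mul, hq.1, one_pow], ?_⟩
    simp only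
    rw [h.per_pow_r hq.1, h.pow_r_pow_z hq.1, hq.2]
  have : (Finset.univ.filter fun q' => pairSetoid K m n r z q q') =
      (Finset.range (per r q.1.1)).image fun k => ⟨⟨q.1.1 ^ r ^ k, q.1.2⟩, hmem k⟩ := by
    ext q'
    simp only [Finset.mem_filter, Finset.mem_univ, true_and, Finset.mem_image, Finset.mem_range,
      h.pairSetoid_iff]
    constructor
    · rintro ⟨⟨k, hk⟩, hw⟩
      refine ⟨k % per r q.1.1, Nat.mod_lt _ (h.per_pos hq.1), ?_⟩
      apply Subtype.ext
      refine Sigma.ext ?_ (heq_of_eq hw)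
      simp only
      rw [hk, ← pow_map_iterate r k, ← pow_map_iterate]
      exact Function.iterate_mod_minimalPeriod_eq
    · rintro ⟨k, _, rfl⟩
      exact ⟨⟨k, rfl⟩, rfl⟩
  rw [this, Finset.card_image_of_injOn, Finset.card_range]
  intro i hi j hj hij
  have h1 : q.1.1 ^ r ^ i = q.1.1 ^ r ^ j := congrArg (fun x => x.1.1) hij
  rw [← pow_map_iterate, ← pow_map_iterate] at h1
  have h2 := (Function.iterate_eq_iterate_iff_of_lt_minimalPeriod (f := fun x : K => x ^ r)
    (x := q.1.1) (m := i) (n := j) (by simpa [per] using hi) (by simpa [per] using hj)).1 h1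
  exact h2

end MetaNum

/-- An algebra with metacyclic generators `α`, `β` and the trace form of a group algebra. -/
structure MetaAlg {K R : Type*} [Field K] [Ring R] [Algebra K R] (m n r z : ℕ) (α β : R)
    (tr : R →ₗ[K] K) : Prop where
  num : MetaNum m n r z
  α_pow : α ^ m = 1
  mul_comm' : β * α = α ^ r * β
  β_pow : β ^ n = α ^ z
  span : ∀ x : R, x ∈ Submodule.span K (Set.range fun q : ℕ × ℕ => α ^ q.1 * β ^ q.2)
  tr_eq : ∀ i < m, ∀ j < n, tr (α ^ i * β ^ j) = if i = 0 ∧ j = 0 then (m * n : K) else 0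

namespace MetaAlg

variable {K R : Type*} [Field K] [CharZero K] [Ring R] [Algebra K R] {m n r z : ℕ} {α β : R}
  {tr : R →ₗ[K] K}

/-- The projection onto the `y`-eigenspace of `α`. -/
def projA (α : R) (m : ℕ) (y : K) : R := rootProj α 1 m y

/-- The idempotent attached to a pair. -/
def pairIdem (α β : R) (m n r : ℕ) (q : Σ _ : K, K) : R :=
  rootProj (β ^ per r q.1) (projA α m q.1) (n / per r q.1) q.2

theorem ne_zero_of_pow {y : K} {m : ℕ} (hm : 0 < m) (hy : y ^ m = 1) : y ≠ 0 := by
  rintro rfl; rw [zero_pow hm.ne'] at hy; exact zero_ne_one hy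

omit [CharZero K] in
theorem commute_projA (y : K) : Commute α (projA α m y) :=
  commute_rootProj (Commute.refl α) (Commute.one_right α)

variable (h : MetaAlg m n r z α β tr)
include h

omit [CharZero K] in
theorem α_scalar {y : K} (hy : y ^ m = 1) : α ^ m * (1 : R) = y ^ m • (1 : R) := by
  rw [h.α_pow, hy, one_smul, mul_one]

theorem α_mul_projA {y : K} (hy : y ^ m = 1) : α * projA α m y = y • projA α m y :=
  mul_rootProj (ne_zero_of_pow h.num.m_pos hy) (h.α_scalar hy)

theorem α_pow_mul_projA {y : K} (hy : y ^ m = 1) (k : ℕ) :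
    α ^ k * projA α m y = y ^ k • projA α m y :=
  pow_mul_rootProj (ne_zero_of_pow h.num.m_pos hy) (h.α_scalar hy) k

theorem projA_orth {y y' : K} (hy : y ^ m = 1) (hy' : y' ^ m = 1) (hne : y ≠ y') :
    projA α m y * projA α m y' = 0 :=
  rootProj_mul_rootProj (Commute.one_right α) (ne_zero_of_pow h.num.m_pos hy)
    (ne_zero_of_pow h.num.m_pos hy') (h.α_scalar hy) (h.α_scalar hy') hne

theorem projA_idem {y : K} (hy : y ^ m = 1) : projA α m y * projA α m y = projA α m y :=
  rootProj_idem (mul_one 1) (Commute.one_right α) (ne_zero_of_pow h.num.m_pos hy)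
    (h.α_scalar hy) (Nat.cast_ne_zero.2 h.num.m_pos.ne')

theorem sum_projA {ζ : K} (hζ : IsPrimitiveRoot ζ m) :
    ∑ y ∈ Polynomial.nthRootsFinset m (1 : K), projA α m y = 1 :=
  sum_rootProj h.num.m_pos (one_pow m) one_ne_zero hζ (Nat.cast_ne_zero.2 h.num.m_pos.ne')

theorem projA_mul_β_mul_projA {y y' : K} (hy : y ^ m = 1) (hy' : y' ^ m = 1) (hne : y ^ r ≠ y') :
    projA α m y * β * projA α m y' = 0 := by
  have h1 : projA α m y * α ^ r * β * projA α m y' =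
      y ^ r • (projA α m y * β * projA α m y') := by
    rw [← ((commute_projA y).pow_left r).eq, h.α_pow_mul_projA hy]
    simp only [smul_mul_assoc]
  have h2 : projA α m y * α ^ r * β * projA α m y' =
      y' • (projA α m y * β * projA α m y') := by
    rw [mul_assoc (projA α m y), ← h.mul_comm', mul_assoc, mul_assoc, h.α_mul_projA hy']
    simp only [mul_smul_comm, mul_assoc]
  have h3 : (y ^ r - y') • (projA α m y * β * projA α m y') = 0 := by
    rw [sub_smul, ← h1, ← h2, sub_self]
  exact (smul_eq_zero.1 h3).resolve_left (sub_ne_zero.2 hne)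

theorem projA_mul_β {ζ : K} (hζ : IsPrimitiveRoot ζ m) {y : K} (hy : y ^ m = 1) :
    projA α m y * β = β * projA α m (y ^ r) := by
  have hyr : (y ^ r) ^ m = 1 := by rw [← pow_mul, mul_comm, pow_mul, hy, one_pow]
  have h1 : projA α m y * β = projA α m y * β * projA α m (y ^ r) := by
    conv_lhs => rw [← mul_one (projA α m y * β), ← h.sum_projA hζ, Finset.mul_sum]
    rw [Finset.sum_eq_single (y ^ r)]
    · intro y' hy' hne
      exact h.projA_mul_β_mul_projA hy ((Polynomial.mem_nthRootsFinset h.num.m_pos _).1 hy') hne.symm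
    · intro hn
      exact absurd ((Polynomial.mem_nthRootsFinset h.num.m_pos _).2 hyr) hn
  have h2 : β * projA α m (y ^ r) = projA α m y * β * projA α m (y ^ r) := by
    conv_lhs => rw [← one_mul (β * projA α m (y ^ r)), ← h.sum_projA hζ, Finset.sum_mul]
    rw [Finset.sum_eq_single y]
    · rw [mul_assoc]
    · intro y' hy' hne
      rw [← mul_assoc]
      have hy'' := (Polynomial.mem_nthRootsFinset h.num.m_pos _).1 hy'
      refine h.projA_mul_β_mul_projA hy'' hyr fun he => hne ?_
      exact h.num.pow_r_injective (k := 1) hy'' hy (by simpa using he)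
    · intro hn
      exact absurd ((Polynomial.mem_nthRootsFinset h.num.m_pos _).2 hy) hn
  rw [h1, h2]

theorem projA_mul_β_pow {ζ : K} (hζ : IsPrimitiveRoot ζ m) {y : K} (hy : y ^ m = 1) (k : ℕ) :
    projA α m y * β ^ k = β ^ k * projA α m (y ^ r ^ k) := by
  induction k with
  | zero => simp
  | succ k ih =>
    have hyk : (y ^ r ^ k) ^ m = 1 := by rw [← pow_mul, mul_comm, pow_mul, hy, one_pow]
    rw [pow_succ, ← mul_assoc, ih, mul_assoc, h.projA_mul_β hζ hyk, ← pow_mul, ← pow_succ,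
      mul_assoc]

theorem commute_β_per {ζ : K} (hζ : IsPrimitiveRoot ζ m) {y : K} (hy : y ^ m = 1) :
    Commute (β ^ per r y) (projA α m y) := by
  have := h.projA_mul_β_pow hζ hy (per r y)
  rw [per_dvd_iff.1 dvd_rfl] at this
  exact this.symm

theorem β_scalar {q : Σ _ : K, K} (hq : q ∈ pairSet K m n r z) :
    (β ^ per r q.1) ^ (n / per r q.1) * projA α m q.1 =
      q.2 ^ (n / per r q.1) • projA α m q.1 := by
  have hq' := (h.num.mem_pairSet q).1 hq
  rw [← pow_mul, Nat.mul_div_cancel' (h.num.per_dvd hq'.1), h.β_pow, h.α_pow_mul_projA hq'.1, hq'.2]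

theorem snd_ne_zero {q : Σ _ : K, K} (hq : q ∈ pairSet K m n r z) : q.2 ≠ 0 := by
  have hq' := (h.num.mem_pairSet q).1 hq
  intro h0
  have h1 := hq'.2
  rw [h0, zero_pow (h.num.div_per_pos hq'.1).ne'] at h1
  exact pow_ne_zero _ (ne_zero_of_pow h.num.m_pos hq'.1) h1.symm

theorem pairIdem_idem {ζ : K} (hζ : IsPrimitiveRoot ζ m) {q : Σ _ : K, K}
    (hq : q ∈ pairSet K m n r z) :
    pairIdem α β m n r q * pairIdem α β m n r q = pairIdem α β m n r q := by
  have hq' := (h.num.mem_pairSet q).1 hq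
  exact rootProj_idem (h.projA_idem hq'.1) (h.commute_β_per hζ hq'.1) (h.snd_ne_zero hq)
    (h.β_scalar hq) (Nat.cast_ne_zero.2 (h.num.div_per_pos hq'.1).ne')

theorem projA_mul_pairIdem {ζ : K} (hζ : IsPrimitiveRoot ζ m) {q : Σ _ : K, K}
    (hq : q ∈ pairSet K m n r z) :
    projA α m q.1 * pairIdem α β m n r q = pairIdem α β m n r q :=
  have hq' := (h.num.mem_pairSet q).1 hq
  idem_mul_rootProj (h.projA_idem hq'.1) (h.commute_β_per hζ hq'.1)

theorem pairIdem_mul_projA {q : Σ _ : K, K} (hq : q ∈ pairSet K m n r z) :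
    pairIdem α β m n r q * projA α m q.1 = pairIdem α β m n r q :=
  have hq' := (h.num.mem_pairSet q).1 hq
  rootProj_mul_idem (h.projA_idem hq'.1)

theorem pairIdem_orth {ζ : K} (hζ : IsPrimitiveRoot ζ m) {q q' : Σ _ : K, K}
    (hq : q ∈ pairSet K m n r z) (hq' : q' ∈ pairSet K m n r z) (hne : q ≠ q') :
    pairIdem α β m n r q * pairIdem α β m n r q' = 0 := by
  have hm := (h.num.mem_pairSet q).1 hq
  have hm' := (h.num.mem_pairSet q').1 hq'
  obtain ⟨y, w⟩ := q
  obtain ⟨y', w'⟩ := q'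
  by_cases hy : y = y'
  · subst hy
    refine rootProj_mul_rootProj (h.commute_β_per hζ hm.1) (h.snd_ne_zero hq) (h.snd_ne_zero hq')
      (h.β_scalar hq) (h.β_scalar hq') ?_
    rintro rfl
    exact hne rfl
  · rw [← h.pairIdem_mul_projA hq, ← h.projA_mul_pairIdem hζ hq', mul_assoc,
      ← mul_assoc (projA α m y), h.projA_orth hm.1 hm'.1 hy]
    simp

theorem sum_pairIdem {ζ : K} (hζ : IsPrimitiveRoot ζ (m * n)) :
    ∑ q ∈ pairSet K m n r z, pairIdem α β m n r q = 1 := by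
  have hmn : 0 < m * n := Nat.mul_pos h.num.m_pos h.num.n_pos
  have hζm : IsPrimitiveRoot (ζ ^ n) m := hζ.pow hmn (mul_comm m n)
  rw [pairSet, Finset.sum_sigma, ← h.sum_projA hζm]
  refine Finset.sum_congr rfl fun y hy => ?_
  have hy1 := (Polynomial.mem_nthRootsFinset h.num.m_pos _).1 hy
  obtain ⟨D', hD⟩ := h.num.per_dvd hy1
  have hDpos := h.num.per_pos hy1
  have hdiv : n / per r y = D' := by
    conv_lhs => rw [hD]
    exact Nat.mul_div_cancel_left _ hDpos
  have : NeZero m := ⟨h.num.m_pos.ne'⟩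
  obtain ⟨k, -, hk⟩ := hζm.eq_pow_of_pow_eq_one hy1
  have hη : IsPrimitiveRoot (ζ ^ (m * per r y)) (n / per r y) := by
    refine hζ.pow hmn ?_
    rw [hdiv, mul_assoc, ← hD]
  have hw₀ : (ζ ^ (per r y * k * z)) ^ (n / per r y) = y ^ z := by
    have hyk : ζ ^ (n * k) = y := by rw [pow_mul, hk]
    rw [← hyk, ← pow_mul, ← pow_mul, hyk, hdiv]
    congr 1
    calc per r y * k * z * D' = per r y * D' * k * z := by ring
      _ = n * k * z := by rw [← hD]
  exact sum_rootProj (γ := β ^ per r y) (e := projA α m y) (h.num.div_per_pos hy1) hw₀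
    (pow_ne_zero z (ne_zero_of_pow h.num.m_pos hy1)) hη
    (Nat.cast_ne_zero.2 (h.num.div_per_pos hy1).ne')

theorem tr_pairIdem {ζ : K} (hζ : IsPrimitiveRoot ζ m) {q : Σ _ : K, K}
    (hq : q ∈ pairSet K m n r z) : tr (pairIdem α β m n r q) = per r q.1 := by
  have hm := (h.num.mem_pairSet q).1 hq
  have hM := h.num.div_per_pos hm.1
  have hdvd := h.num.per_dvd hm.1
  have hmK : (m : K) ≠ 0 := Nat.cast_ne_zero.2 h.num.m_pos.ne'
  have hterm : ∀ j < n / per r q.1, tr ((β ^ per r q.1) ^ j * projA α m q.1) =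
      if j = 0 then (n : K) else 0 := by
    intro j hj
    have hlt : per r q.1 * j < n := by
      calc per r q.1 * j < per r q.1 * (n / per r q.1) :=
            Nat.mul_lt_mul_of_pos_left hj (h.num.per_pos hm.1)
        _ = n := Nat.mul_div_cancel' hdvd
    rw [((h.commute_β_per hζ hm.1).pow_left j).eq, projA, rootProj, smul_mul_assoc, map_smul,
      Finset.sum_mul, map_sum]
    have hi : ∀ i ∈ Finset.range m, tr (q.1⁻¹ ^ i • (α ^ i * 1) * (β ^ per r q.1) ^ j) =
        if i = 0 then (if j = 0 then (m * n : K) else 0) else 0 := by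
      intro i hi
      rw [mul_one, smul_mul_assoc, map_smul, ← pow_mul, h.tr_eq i (Finset.mem_range.1 hi) _ hlt]
      have := h.num.per_pos hm.1
      by_cases h0 : i = 0 <;> by_cases h1 : j = 0 <;> simp [h0, h1, this.ne']
    rw [Finset.sum_congr rfl hi, Finset.sum_ite_eq' (Finset.range m) 0,
      if_pos (Finset.mem_range.2 h.num.m_pos)]
    split_ifs
    · simp only [smul_eq_mul]; field_simp
    · simp
  rw [pairIdem, rootProj, map_smul, map_sum]
  have hj : ∀ j ∈ Finset.range (n / per r q.1),
      tr (q.2⁻¹ ^ j • ((β ^ per r q.1) ^ j * projA α m q.1)) = if j = 0 then (n : K) else 0 := by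
    intro j hj
    rw [map_smul, hterm j (Finset.mem_range.1 hj)]
    split_ifs with h0 <;> simp [h0]
  rw [Finset.sum_congr rfl hj, Finset.sum_ite_eq', if_pos (Finset.mem_range.2 hM), smul_eq_mul,
    Nat.cast_div_charZero hdvd]
  have : (per r q.1 : K) ≠ 0 := Nat.cast_ne_zero.2 (h.num.per_pos hm.1).ne'
  have : (n : K) ≠ 0 := Nat.cast_ne_zero.2 h.num.n_pos.ne'
  field_simp

theorem pairIdem_ne_zero {ζ : K} (hζ : IsPrimitiveRoot ζ m) {q : Σ _ : K, K}
    (hq : q ∈ pairSet K m n r z) : pairIdem α β m n r q ≠ 0 := by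
  intro h0
  have h1 := h.tr_pairIdem hζ hq
  rw [h0, map_zero] at h1
  exact Nat.cast_ne_zero.2 (h.num.per_pos ((h.num.mem_pairSet q).1 hq).1).ne' h1.symm

theorem pairIdem_mul_α {q : Σ _ : K, K} (hq : q ∈ pairSet K m n r z) (i : ℕ) :
    pairIdem α β m n r q * α ^ i = q.1 ^ i • pairIdem α β m n r q := by
  have hm := (h.num.mem_pairSet q).1 hq
  rw [← h.pairIdem_mul_projA hq, mul_assoc, ← ((commute_projA q.1).pow_left i).eq,
    h.α_pow_mul_projA hm.1, mul_smul_comm]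

omit [CharZero K] in
theorem shift_mem {q : Σ _ : K, K} (hq : q ∈ pairSet K m n r z) (k : ℕ) :
    (⟨q.1 ^ r ^ k, q.2⟩ : Σ _ : K, K) ∈ pairSet K m n r z := by
  have hm := (h.num.mem_pairSet q).1 hq
  rw [h.num.mem_pairSet]
  refine ⟨by simp only; rw [← pow_mul, mul_comm, pow_mul, hm.1, one_pow], ?_⟩
  simp only
  rw [h.num.per_pow_r hm.1, h.num.pow_r_pow_z hm.1, hm.2]

theorem pairIdem_mul_β_pow {ζ : K} (hζ : IsPrimitiveRoot ζ m) {q : Σ _ : K, K}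
    (hq : q ∈ pairSet K m n r z) (k : ℕ) :
    pairIdem α β m n r q * β ^ k = β ^ k * pairIdem α β m n r ⟨q.1 ^ r ^ k, q.2⟩ := by
  have hm := (h.num.mem_pairSet q).1 hq
  simp only [pairIdem, rootProj, h.num.per_pow_r hm.1, smul_mul_assoc, Finset.sum_mul,
    mul_smul_comm, Finset.mul_sum]
  congr 1
  refine Finset.sum_congr rfl fun j _ => ?_
  rw [mul_assoc, h.projA_mul_β_pow hζ hm.1, ← mul_assoc, ← mul_assoc]
  congr 2
  rw [← pow_mul, ← pow_add, ← pow_add, add_comm]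

theorem β_pow_mul_pairIdem {q : Σ _ : K, K}
    (hq : q ∈ pairSet K m n r z) (k : ℕ) :
    (β ^ per r q.1) ^ k * pairIdem α β m n r q = q.2 ^ k • pairIdem α β m n r q :=
  pow_mul_rootProj (h.snd_ne_zero hq) (h.β_scalar hq) k

omit [CharZero K] in
theorem β_pow_mul_ne_zero {x : R} (hx : x ≠ 0) (k : ℕ) : β ^ k * x ≠ 0 := by
  intro h0
  apply hx
  have h1 : α ^ (z * k * (m - 1)) * (β ^ (n * k - k) * (β ^ k * x)) = x := by
    rw [← mul_assoc (β ^ (n * k - k)), ← pow_add,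
      Nat.sub_add_cancel (Nat.le_mul_of_pos_left k h.num.n_pos), pow_mul β n k, h.β_pow, ← pow_mul,
      ← mul_assoc, ← pow_add]
    have : z * k * (m - 1) + z * k = m * (z * k) := by
      obtain ⟨m', rfl⟩ : ∃ m', m = m' + 1 := ⟨m - 1, by have := h.num.m_pos; omega⟩
      simp; ring
    rw [this, pow_mul, h.α_pow, one_pow, one_mul]
  rw [← h1, h0]; simp

theorem linkedFamily {ζ : K} (hζ' : IsPrimitiveRoot ζ (m * n)) :
    LinkedFamily K (fun q : pairSet K m n r z => pairIdem α β m n r q.1)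
      (pairSetoid K m n r z) := by
  have hmn : 0 < m * n := Nat.mul_pos h.num.m_pos h.num.n_pos
  have hζ : IsPrimitiveRoot (ζ ^ n) m := hζ'.pow hmn (mul_comm m n)
  have hmon : ∀ (q q' : pairSet K m n r z) (i j : ℕ),
      pairIdem α β m n r q.1 * (α ^ i * β ^ j) * pairIdem α β m n r q'.1 =
        q.1.1 ^ i • (β ^ j * (pairIdem α β m n r ⟨q.1.1 ^ r ^ j, q.1.2⟩ *
          pairIdem α β m n r q'.1)) := by
    intro q q' i j
    rw [← mul_assoc, h.pairIdem_mul_α q.2, smul_mul_assoc, smul_mul_assoc,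
      h.pairIdem_mul_β_pow hζ q.2, mul_assoc]
  refine ⟨fun q => h.pairIdem_ne_zero hζ q.2, fun q => h.pairIdem_idem hζ q.2,
    fun q q' hne => h.pairIdem_orth hζ q.2 q'.2 fun he => hne (Subtype.ext he), ?_, ?_, ?_, ?_⟩
  · exact (Finset.sum_coe_sort (pairSet K m n r z) fun q => pairIdem α β m n r q).trans
      (h.sum_pairIdem hζ')
  · intro q x
    induction h.span x using Submodule.span_induction with
    | mem x hx =>
      obtain ⟨⟨i, j⟩, rfl⟩ := hx
      simp only [hmon]
      by_cases hj : q.1.1 ^ r ^ j = q.1.1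
      · obtain ⟨c, rfl⟩ := per_dvd_iff.2 hj
        refine ⟨q.1.1 ^ i * q.1.2 ^ c, ?_⟩
        rw [hj]
        change _ • (_ * (pairIdem α β m n r q.1 * _)) = _
        rw [h.pairIdem_idem hζ q.2, pow_mul, h.β_pow_mul_pairIdem q.2, smul_smul]
      · refine ⟨0, ?_⟩
        rw [h.pairIdem_orth hζ (h.shift_mem q.2 j) q.2
          (fun he => hj (congrArg Sigma.fst he))]
        simp
    | zero => exact ⟨0, by simp⟩
    | add x y _ _ hx hy =>
      obtain ⟨c, hc⟩ := hx
      obtain ⟨d, hd⟩ := hy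
      exact ⟨c + d, by rw [mul_add, add_mul, hc, hd, add_smul]⟩
    | smul a x _ hx =>
      obtain ⟨c, hc⟩ := hx
      exact ⟨a * c, by rw [mul_smul_comm, smul_mul_assoc, hc, smul_smul]⟩
  · intro q q' hqq
    obtain ⟨⟨k, hk⟩, hw⟩ := (h.num.pairSetoid_iff q q').1 hqq
    refine ⟨α ^ 0 * β ^ k, ?_⟩
    simp only [hmon]
    have : (⟨q.1.1 ^ r ^ k, q.1.2⟩ : Σ _ : K, K) = q'.1 := Sigma.ext hk.symm (heq_of_eq hw)
    rw [this, h.pairIdem_idem hζ q'.2, pow_zero, one_smul]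
    exact h.β_pow_mul_ne_zero (h.pairIdem_ne_zero hζ q'.2) k
  · intro q q' x hqq
    induction h.span x using Submodule.span_induction with
    | mem x hx =>
      obtain ⟨⟨i, j⟩, rfl⟩ := hx
      simp only [hmon]
      rw [h.pairIdem_orth hζ (h.shift_mem q.2 j) q'.2]
      · simp
      · intro he
        exact hqq ((h.num.pairSetoid_iff q q').2
          ⟨⟨j, (congrArg Sigma.fst he).symm⟩, by rw [← he]⟩)
    | zero => simp
    | add x y _ _ hx hy => rw [mul_add, add_mul, hx, hy, add_zero]
    | smul a x _ hx => rw [mul_smul_comm, smul_mul_assoc, hx, smul_zero]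

theorem tr_classSum {ζ : K} (hζ' : IsPrimitiveRoot ζ (m * n)) (q : pairSet K m n r z) :
    tr (classSum (fun q : pairSet K m n r z => pairIdem α β m n r q.1)
      (pairSetoid K m n r z) q) = (per r q.1.1 : K) ^ 2 := by
  have hmn : 0 < m * n := Nat.mul_pos h.num.m_pos h.num.n_pos
  have hζ : IsPrimitiveRoot (ζ ^ n) m := hζ'.pow hmn (mul_comm m n)
  rw [classSum, map_sum, Finset.sum_congr rfl (g := fun _ => (per r q.1.1 : K)),
    Finset.sum_const, h.num.card_class, nsmul_eq_mul, sq]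
  intro q' hq'
  obtain ⟨⟨k, hk⟩, -⟩ := (h.num.pairSetoid_iff q q').1 (by simpa using hq')
  rw [h.tr_pairIdem hζ q'.2, hk, h.num.per_pow_r ((h.num.mem_pairSet q.1).1 q.2).1]

/-- The sum of the traces of the blocks fixed by `σ` whose degree divides `d`. -/
def _root_.ArXiv230800432.blockSum {K R : Type*} [Field K] [Ring R] [Algebra K R]
    (tr : R →ₗ[K] K) (σ : R → R) (d : ℕ) : K :=
  ∑ᶠ e ∈ {e : R | IsBlock e ∧ (σ e = e ∧ ∃ k : ℕ, tr e = k ∧ k ∣ d ^ 2)}, tr e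

omit [CharZero K] h in
theorem map_pairIdem {τ : K →+* K} {σ : R →+* R} (hσ : ∀ (c : K) x, σ (c • x) = τ c • σ x)
    (hα : σ α = α) (hβ : σ β = β) (q : Σ _ : K, K) :
    σ (pairIdem α β m n r q) = pairIdem α β m n r ⟨τ q.1, τ q.2⟩ := by
  have hper : per r (τ q.1) = per r q.1 := by
    refine Nat.dvd_antisymm (per_dvd_iff.2 ?_) (per_dvd_iff.2 ?_)
    · rw [← map_pow, per_dvd_iff.1 dvd_rfl]
    · have := per_dvd_iff.1 (dvd_refl (per r (τ q.1)))
      rw [← map_pow] at this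
      exact τ.injective this
  simp only [pairIdem, projA, rootProj, hper, hσ, map_sum, map_mul, map_pow, hα, hβ, map_inv₀,
    map_natCast, map_one]

theorem blockSum_eq {ζ : K} (hζ' : IsPrimitiveRoot ζ (m * n)) {t : ℕ} {τ : K →+* K}
    (hτ : τ ζ = ζ ^ t) {σ : R →+* R} (hσ : ∀ (c : K) x, σ (c • x) = τ c • σ x)
    (hα : σ α = α) (hβ : σ β = β) (d : ℕ) :
    blockSum tr σ d = ((∑ q ∈ pairSet K m n r z,
      if (∃ k, q.1 ^ t = q.1 ^ r ^ k) ∧ q.2 ^ t = q.2 ∧ per r q.1 ∣ d then per r q.1 else 0 : ℕ)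
        : K) := by
  have hmn : 0 < m * n := Nat.mul_pos h.num.m_pos h.num.n_pos
  have hζ : IsPrimitiveRoot (ζ ^ n) m := hζ'.pow hmn (mul_comm m n)
  have hL := h.linkedFamily hζ'
  have : NeZero (m * n) := ⟨hmn.ne'⟩
  have hroot : ∀ y : K, y ^ (m * n) = 1 → τ y = y ^ t := by
    intro y hy
    obtain ⟨k, -, rfl⟩ := hζ'.eq_pow_of_pow_eq_one hy
    rw [map_pow, hτ, ← pow_mul, ← pow_mul, mul_comm]
  have hτ1 : ∀ q ∈ pairSet K m n r z, τ q.1 = q.1 ^ t := fun q hq =>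
    hroot _ (by rw [pow_mul, ((h.num.mem_pairSet q).1 hq).1, one_pow])
  have hτ2 : ∀ q ∈ pairSet K m n r z, τ q.2 = q.2 ^ t := fun q hq => by
    have hm := (h.num.mem_pairSet q).1 hq
    refine hroot _ ?_
    obtain ⟨c, hc⟩ := h.num.per_dvd hm.1
    have h1 : q.2 ^ n = (q.1 ^ z) ^ per r q.1 := by
      rw [← hm.2, ← pow_mul, Nat.div_mul_cancel ⟨c, hc⟩]
    rw [mul_comm, pow_mul, h1, ← pow_mul, ← pow_mul,
      show z * (per r q.1 * m) = m * (z * per r q.1) by ring, pow_mul, hm.1, one_pow]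
  have hmem : ∀ q ∈ pairSet K m n r z, (⟨τ q.1, τ q.2⟩ : Σ _ : K, K) ∈ pairSet K m n r z := by
    intro q hq
    have hm := (h.num.mem_pairSet q).1 hq
    rw [h.num.mem_pairSet]
    have hper : per r (τ q.1) = per r q.1 := by
      refine Nat.dvd_antisymm (per_dvd_iff.2 ?_) (per_dvd_iff.2 ?_)
      · rw [← map_pow, per_dvd_iff.1 dvd_rfl]
      · have := per_dvd_iff.1 (dvd_refl (per r (τ q.1)))
        rw [← map_pow] at this
        exact τ.injective this
    refine ⟨by simp only; rw [← map_pow, hm.1, map_one], ?_⟩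
    simp only
    rw [hper, ← map_pow, ← map_pow, hm.2]
  let T : pairSet K m n r z → pairSet K m n r z := fun q => ⟨⟨τ q.1.1, τ q.1.2⟩, hmem q.1 q.2⟩
  have hTinj : Function.Injective T := by
    intro q q' hqq
    apply Subtype.ext
    have h1 : τ q.1.1 = τ q'.1.1 := congrArg (fun x => x.1.1) hqq
    have h2 : τ q.1.2 = τ q'.1.2 := congrArg (fun x => x.1.2) hqq
    exact Sigma.ext (τ.injective h1) (heq_of_eq (τ.injective h2))
  have hTrel : ∀ q q', pairSetoid K m n r z q q' → pairSetoid K m n r z (T q) (T q') := by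
    rintro q q' ⟨⟨k, l, hkl⟩, hw⟩
    exact ⟨⟨k, l, by simp only [T]; rw [← map_pow, hkl, map_pow]⟩, by simp only [T]; rw [hw]⟩
  have hσf : ∀ q : pairSet K m n r z, σ (pairIdem α β m n r q.1) = pairIdem α β m n r (T q).1 :=
    fun q => map_pairIdem hσ hα hβ q.1
  set f := fun q : pairSet K m n r z => pairIdem α β m n r q.1 with hf
  have hσE : ∀ q, σ (classSum f (pairSetoid K m n r z) q) = classSum f (pairSetoid K m n r z) q ↔
      pairSetoid K m n r z q (T q) := by
    intro q
    constructor
    · intro hE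
      have h1 := hL.mul_classSum q q
      rw [if_pos ((pairSetoid K m n r z).refl q)] at h1
      have h2 := congrArg σ h1
      rw [map_mul, hE] at h2
      rw [show σ (f q) = f (T q) from hσf q] at h2
      have h3 := hL.mul_classSum q (T q)
      by_contra hcon
      rw [if_neg hcon] at h3
      exact hL.ne_zero (T q) (h2.symm.trans h3)
    · intro hq
      rw [classSum, map_sum]
      rw [Finset.sum_congr rfl fun x _ => hσf x]
      rw [← Finset.sum_image (f := fun q => pairIdem α β m n r q.1) (g := T)
        (fun a _ b _ hab => hTinj hab)]
      refine Finset.sum_congr ?_ fun _ _ => rfl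
      refine Finset.eq_of_subset_of_card_le ?_ (Finset.card_image_of_injective _ hTinj).ge
      intro q' hq'
      obtain ⟨q'', hq'', rfl⟩ := Finset.mem_image.1 hq'
      simp only [Finset.mem_filter, Finset.mem_univ, true_and] at hq'' ⊢
      exact (pairSetoid K m n r z).trans hq (hTrel _ _ hq'')
  rw [blockSum, hL.finsum_block _ tr, Nat.cast_sum]
  refine Eq.trans ?_ (Finset.sum_coe_sort (pairSet K m n r z) _)
  refine Finset.sum_congr rfl fun q _ => ?_
  have hm := (h.num.mem_pairSet q.1).1 q.2
  have hiff : (σ (classSum f (pairSetoid K m n r z) q) = classSum f (pairSetoid K m n r z) q ∧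
      ∃ k : ℕ, tr (classSum f (pairSetoid K m n r z) q) = k ∧ k ∣ d ^ 2) ↔
      ((∃ k, q.1.1 ^ t = q.1.1 ^ r ^ k) ∧ q.1.2 ^ t = q.1.2 ∧ per r q.1.1 ∣ d) := by
    rw [hσE, h.num.pairSetoid_iff, h.tr_classSum hζ']
    simp only [T, hτ1 q.1 q.2, hτ2 q.1 q.2]
    rw [and_assoc]
    refine and_congr_right fun _ => and_congr eq_comm ?_
    constructor
    · rintro ⟨k, hk, hkd⟩
      have : per r q.1.1 ^ 2 = k := by exact_mod_cast hk
      rw [← this] at hkd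
      exact (Nat.pow_dvd_pow_iff two_ne_zero).1 hkd
    · intro hd
      exact ⟨per r q.1.1 ^ 2, by push_cast; rfl, pow_dvd_pow_of_dvd hd 2⟩
  have htr : tr (f q) = per r q.1.1 := h.tr_pairIdem hζ q.2
  by_cases hc : (∃ k, q.1.1 ^ t = q.1.1 ^ r ^ k) ∧ q.1.2 ^ t = q.1.2 ∧ per r q.1.1 ∣ d
  · rw [if_pos (hiff.2 hc), if_pos hc, htr]
  · rw [if_neg (fun hh => hc (hiff.1 hh)), if_neg hc, Nat.cast_zero]

end MetaAlg

/-- Generators of a metacyclic group with their relations. -/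
structure MetaData (G : Type*) [Group G] (m n r z : ℕ) where
  a : G
  b : G
  orderOf_a : orderOf a = m
  n_pos : 0 < n
  conj : b * a * b⁻¹ = a ^ r
  b_pow : b ^ n = a ^ z
  cover : ∀ g : G, ∃ i j : ℕ, g = a ^ i * b ^ j
  dvd : ∀ j : ℕ, b ^ j ∈ Subgroup.zpowers a → n ∣ j

namespace MetaData

variable {G : Type*} [Group G] {m n r z : ℕ} (D : MetaData G m n r z)
include D

theorem a_pow_eq_iff {i j : ℕ} : D.a ^ i = D.a ^ j ↔ i ≡ j [MOD m] := by
  rw [pow_eq_pow_iff_modEq, D.orderOf_a]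

theorem a_pow_m : D.a ^ m = 1 := by
  have := pow_orderOf_eq_one D.a
  rwa [D.orderOf_a] at this

theorem conj_pow (i j : ℕ) : D.b ^ j * D.a ^ i * (D.b ^ j)⁻¹ = D.a ^ (i * r ^ j) := by
  induction j generalizing i with
  | zero => simp
  | succ j ih =>
    have h1 : D.b * D.a ^ i * D.b⁻¹ = D.a ^ (i * r) := by
      rw [← _root_.conj_pow, D.conj, ← pow_mul, mul_comm]
    rw [pow_succ, mul_inv_rev, ← mul_assoc, mul_assoc (D.b ^ j), mul_assoc (D.b ^ j), h1, ih,
      pow_succ, mul_assoc, mul_comm r]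

theorem metaNum (hm : 0 < m) : MetaNum m n r z where
  m_pos := hm
  n_pos := D.n_pos
  r_pow := by
    have h := D.conj_pow 1 n
    rw [D.b_pow, ← pow_add, add_comm, pow_add, mul_inv_cancel_right, one_mul,
      D.a_pow_eq_iff] at h
    exact h.symm
  z_mul := by
    have h := D.conj_pow z 1
    rw [← D.b_pow, pow_one, ← pow_succ', pow_succ, mul_inv_cancel_right, D.b_pow, pow_one,
      D.a_pow_eq_iff] at h
    exact h.symm

theorem pow_mul_pow_eq_one {i j : ℕ} (hi : i < m) (hj : j < n) :
    D.a ^ i * D.b ^ j = 1 ↔ i = 0 ∧ j = 0 := by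
  refine ⟨fun h => ?_, by rintro ⟨rfl, rfl⟩; simp⟩
  have hb : D.b ^ j ∈ Subgroup.zpowers D.a := by
    rw [eq_inv_of_mul_eq_one_right h]
    exact inv_mem (Subgroup.npow_mem_zpowers _ _)
  have hj0 := Nat.eq_zero_of_dvd_of_lt (D.dvd j hb) hj
  subst hj0
  rw [pow_zero, mul_one, ← pow_zero D.a, D.a_pow_eq_iff] at h
  exact ⟨Nat.eq_zero_of_dvd_of_lt (Nat.modEq_zero_iff_dvd.1 h) hi, rfl⟩

end MetaData

open scoped TensorProduct

/-- The trace of left multiplication. -/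
def regTrace (K R : Type*) [Field K] [Ring R] [Algebra K R] : R →ₗ[K] K :=
  LinearMap.trace K R ∘ₗ (Algebra.lmul K R).toLinearMap

theorem regTrace_algEquiv {K R S : Type*} [Field K] [Ring R] [Algebra K R] [Ring S] [Algebra K S]
    (e : R ≃ₐ[K] S) (x : R) : regTrace K S (e x) = regTrace K R x := by
  have : Algebra.lmul K S (e x) = e.toLinearEquiv.conj (Algebra.lmul K R x) := by
    ext y
    simp [LinearEquiv.conj_apply]
  change LinearMap.trace K S (Algebra.lmul K S (e x)) = LinearMap.trace K R (Algebra.lmul K R x)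
  rw [this, LinearMap.trace_conj']

theorem regTrace_basis {K R G : Type*} [Field K] [Ring R] [Algebra K R] [Group G] [Finite G]
    (B : Module.Basis G K R) (hB : ∀ g h, B g * B h = B (g * h)) (g : G) :
    regTrace K R (B g) = if g = 1 then (Nat.card G : K) else 0 := by
  have := Fintype.ofFinite G
  change LinearMap.trace K _ (Algebra.lmul K _ (B g)) = _
  rw [LinearMap.trace_eq_matrix_trace K B, Matrix.trace]
  have h : ∀ i, Matrix.diag (LinearMap.toMatrix B B (Algebra.lmul K _ (B g))) i =
      if g = 1 then 1 else 0 := by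
    intro i
    rw [Matrix.diag_apply, LinearMap.toMatrix_apply, Algebra.coe_lmul_eq_mul,
      LinearMap.mul_apply', hB, Module.Basis.repr_self, Finsupp.single_apply]
    simp
  rw [Finset.sum_congr rfl fun i _ => h i]
  split_ifs <;> simp [Nat.card_eq_fintype_card]

section GroupAlg

variable (K : Type*) [Field K] [CharZero K] (G : Type*) [Group G] [Finite G]

/-- The scalar extension of a rational group algebra. -/
abbrev scalExt := K ⊗[ℚ] MonoidAlgebra ℚ G

/-- The standard basis of `scalExt K G`. -/
def scalExtBasis : Module.Basis G K (scalExt K G) :=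
  Algebra.TensorProduct.basis K (MonoidAlgebra.basis G ℚ)

omit [Finite G] in
theorem scalExtBasis_apply (g : G) :
    scalExtBasis K G g = (1 : K) ⊗ₜ[ℚ] MonoidAlgebra.of ℚ G g := by
  simp [scalExtBasis]

omit [Finite G] in
theorem scalExtBasis_mul (g h : G) :
    scalExtBasis K G g * scalExtBasis K G h = scalExtBasis K G (g * h) := by
  simp only [scalExtBasis_apply, Algebra.TensorProduct.tmul_mul_tmul, map_mul, one_mul]

omit [Finite G] in
theorem scalExtBasis_one : scalExtBasis K G 1 = 1 := by
  rw [scalExtBasis_apply, map_one, Algebra.TensorProduct.one_def]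

omit [Finite G] in
theorem scalExtBasis_pow (g : G) (k : ℕ) :
    scalExtBasis K G g ^ k = scalExtBasis K G (g ^ k) := by
  induction k with
  | zero => rw [pow_zero, pow_zero, scalExtBasis_one]
  | succ k ih => rw [pow_succ, pow_succ, ih, scalExtBasis_mul]

theorem trace_scalExt (g : G) : regTrace K (scalExt K G) (scalExtBasis K G g) =
    if g = 1 then (Nat.card G : K) else 0 :=
  regTrace_basis (scalExtBasis K G) (scalExtBasis_mul K G) g

end GroupAlg

section Invariance

variable {K : Type*} [Field K] [CharZero K]

/-- Extension of a field automorphism to `scalExt K G`. -/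
def galMap (τ : K →ₐ[ℚ] K) (A : Type*) [Ring A] [Algebra ℚ A] : K ⊗[ℚ] A →ₐ[ℚ] K ⊗[ℚ] A :=
  Algebra.TensorProduct.map τ (AlgHom.id ℚ A)

theorem galMap_smul (τ : K →ₐ[ℚ] K) (A : Type*) [Ring A] [Algebra ℚ A] (c : K)
    (x : K ⊗[ℚ] A) : galMap τ A (c • x) = τ c • galMap τ A x := by
  induction x using TensorProduct.induction_on with
  | zero => simp
  | tmul y a => simp [galMap, TensorProduct.smul_tmul']
  | add x y hx hy => rw [smul_add, map_add, hx, hy, map_add, smul_add]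

theorem galMap_basis {G : Type*} [Group G] (τ : K →ₐ[ℚ] K) (g : G) :
    galMap τ (MonoidAlgebra ℚ G) (scalExtBasis K G g) = scalExtBasis K G g := by
  simp [scalExtBasis_apply, galMap]

theorem isBlock_map {R S : Type*} [Ring R] [Ring S] (e : R ≃+* S) {x : R} (hx : IsBlock x) :
    IsBlock (e x) := by
  obtain ⟨h0, h1, h2, h3⟩ := hx
  refine ⟨by simpa using h0, by rw [← map_mul, h1], fun y => ?_, fun z hz hzz => ?_⟩
  · obtain ⟨y, rfl⟩ := e.surjective y
    rw [← map_mul, h2, map_mul]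
  · obtain ⟨z, rfl⟩ := e.surjective z
    have := h3 z (fun w => e.injective (by rw [map_mul, map_mul, hz]))
      (e.injective (by rw [map_mul, hzz]))
    rw [← map_mul]
    rcases this with h | h
    · left; rw [h, map_zero]
    · right; rw [h]

omit [CharZero K] in
theorem blockSum_algEquiv {R S : Type*} [Ring R] [Algebra K R] [Ring S] [Algebra K S]
    (e : R ≃ₐ[K] S) {σ : R → R} {σ' : S → S} (hσ : ∀ x, e (σ x) = σ' (e x)) (d : ℕ) :
    blockSum (regTrace K R) σ d = blockSum (regTrace K S) σ' d := by
  rw [blockSum, blockSum]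
  refine finsum_mem_eq_of_bijOn e ⟨?_, e.injective.injOn, ?_⟩ fun x _ =>
    (regTrace_algEquiv e x).symm
  · rintro x ⟨hx, hf, k, hk, hkd⟩
    exact ⟨isBlock_map e.toRingEquiv hx, by rw [← hσ, hf], k, by rw [regTrace_algEquiv, hk], hkd⟩
  · rintro y ⟨hy, hf, k, hk, hkd⟩
    refine ⟨e.symm y, ⟨isBlock_map e.symm.toRingEquiv hy, ?_, k, ?_, hkd⟩, e.apply_symm_apply y⟩
    · apply e.injective
      rw [hσ, e.apply_symm_apply, hf]
    · rw [← regTrace_algEquiv e, e.apply_symm_apply, hk]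

theorem blockSum_scalExt {A B : Type*} [Ring A] [Algebra ℚ A] [Ring B] [Algebra ℚ B]
    (φ : A ≃ₐ[ℚ] B) (τ : K →ₐ[ℚ] K) (d : ℕ) :
    blockSum (regTrace K (K ⊗[ℚ] A)) (galMap τ A) d =
      blockSum (regTrace K (K ⊗[ℚ] B)) (galMap τ B) d := by
  refine blockSum_algEquiv (Algebra.TensorProduct.congr AlgEquiv.refl φ) (fun x => ?_) d
  induction x using TensorProduct.induction_on with
  | zero => simp
  | tmul y a => simp [galMap]
  | add x y hx hy => simp only [map_add, hx, hy]

end Invariance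

namespace MetaData

variable {G : Type*} [Group G] {m n r z : ℕ}

theorem exists_lt_cover (D : MetaData G m n r z) (hm : 0 < m) (g : G) :
    ∃ i < m, ∃ j < n, g = D.a ^ i * D.b ^ j := by
  obtain ⟨i, j, rfl⟩ := D.cover g
  refine ⟨(i + z * (j / n)) % m, Nat.mod_lt _ hm, j % n, Nat.mod_lt _ D.n_pos, ?_⟩
  conv_lhs => rw [← Nat.div_add_mod j n, pow_add, pow_mul, D.b_pow, ← pow_mul, ← mul_assoc,
    ← pow_add]
  rw [D.a_pow_eq_iff.2 (Nat.mod_modEq _ _)]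

theorem injective_param (D : MetaData G m n r z) {i j i' j' : ℕ} (hi : i < m) (hj : j < n)
    (hi' : i' < m) (hj' : j' < n) (h : D.a ^ i * D.b ^ j = D.a ^ i' * D.b ^ j') :
    i = i' ∧ j = j' := by
  wlog hle : j' ≤ j generalizing i j i' j'
  · have := this hi' hj' hi hj h.symm (by omega)
    exact ⟨this.1.symm, this.2.symm⟩
  have hb : D.b ^ (j - j') ∈ Subgroup.zpowers D.a := by
    have h1 : D.b ^ (j - j') = (D.a ^ i)⁻¹ * D.a ^ i' := by
      rw [eq_inv_mul_iff_mul_eq, ← mul_right_cancel_iff (a := D.b ^ j'), mul_assoc, ← pow_add,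
        Nat.sub_add_cancel hle, h]
    rw [h1]
    exact mul_mem (inv_mem (Subgroup.npow_mem_zpowers _ _)) (Subgroup.npow_mem_zpowers _ _)
  have h0 := Nat.eq_zero_of_dvd_of_lt (D.dvd _ hb) (by omega)
  have hjj : j = j' := by omega
  subst hjj
  rw [mul_left_inj, D.a_pow_eq_iff] at h
  exact ⟨Nat.ModEq.eq_of_lt_of_lt h hi hi', rfl⟩

/-- Elements of the group are parametrised by pairs of exponents. -/
def paramEquiv (D : MetaData G m n r z) (hm : 0 < m) : Fin m × Fin n ≃ G :=
  Equiv.ofBijective (fun q => D.a ^ (q.1 : ℕ) * D.b ^ (q.2 : ℕ))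
    ⟨fun q q' h => by
      have := D.injective_param q.1.2 q.2.2 q'.1.2 q'.2.2 h
      exact Prod.ext (Fin.ext this.1) (Fin.ext this.2),
    fun g => by
      obtain ⟨i, hi, j, hj, rfl⟩ := D.exists_lt_cover hm g
      exact ⟨(⟨i, hi⟩, ⟨j, hj⟩), rfl⟩⟩

theorem card_eq (D : MetaData G m n r z) (hm : 0 < m) : Nat.card G = m * n := by
  rw [← Nat.card_congr (D.paramEquiv hm)]; simp

theorem metaAlg (K : Type*) [Field K] [CharZero K] [Finite G] (D : MetaData G m n r z)
    (hm : 0 < m) :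
    MetaAlg m n r z (scalExtBasis K G D.a) (scalExtBasis K G D.b)
      (regTrace K (scalExt K G)) where
  num := D.metaNum hm
  α_pow := by rw [scalExtBasis_pow, D.a_pow_m, scalExtBasis_one]
  mul_comm' := by
    rw [scalExtBasis_pow, scalExtBasis_mul, scalExtBasis_mul, ← D.conj, inv_mul_cancel_right]
  β_pow := by rw [scalExtBasis_pow, scalExtBasis_pow, D.b_pow]
  span x := by
    have hx := (scalExtBasis K G).mem_span x
    refine Submodule.span_mono ?_ hx
    rintro _ ⟨g, rfl⟩
    obtain ⟨i, j, rfl⟩ := D.cover g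
    exact ⟨(i, j), by simp only [scalExtBasis_pow, scalExtBasis_mul]⟩
  tr_eq i hi j hj := by
    rw [scalExtBasis_pow, scalExtBasis_pow, scalExtBasis_mul, trace_scalExt,
      if_congr (D.pow_mul_pow_eq_one hi hj) rfl rfl, D.card_eq hm, Nat.cast_mul]

end MetaData

/-- A weighted count of the blocks of the group algebra of a metacyclic group which are fixed by a
Galois automorphism and have degree dividing `d`. -/
def pairCount (K : Type*) [Field K] (m n r z t d : ℕ) : ℕ :=
  ∑ q ∈ pairSet K m n r z,
    if (∃ k, q.1 ^ t = q.1 ^ r ^ k) ∧ q.2 ^ t = q.2 ∧ per r q.1 ∣ d then per r q.1 else 0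

theorem pairCount_eq_of_algEquiv {G H : Type*} [Group G] [Group H] [Finite G] [Finite H]
    (φ : MonoidAlgebra ℚ G ≃ₐ[ℚ] MonoidAlgebra ℚ H) {K : Type*} [Field K] [CharZero K]
    {m n r z m' n' r' z' : ℕ} (D : MetaData G m n r z) (D' : MetaData H m' n' r' z') (hm : 0 < m)
    (hm' : 0 < m') (hN : m * n = m' * n') {ζ : K} (hζ : IsPrimitiveRoot ζ (m * n))
    {τ : K →ₐ[ℚ] K} {t : ℕ} (hτ : τ ζ = ζ ^ t) (d : ℕ) :
    pairCount K m n r z t d = pairCount K m' n' r' z' t d := by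
  have h1 := (D.metaAlg K hm).blockSum_eq hζ (τ := (τ : K →+* K)) hτ
    (σ := (galMap τ (MonoidAlgebra ℚ G) : scalExt K G →+* scalExt K G))
    (fun c x => galMap_smul τ _ c x) (galMap_basis _ _) (galMap_basis _ _) d
  have h2 := (D'.metaAlg K hm').blockSum_eq (hN ▸ hζ) (τ := (τ : K →+* K)) hτ
    (σ := (galMap τ (MonoidAlgebra ℚ H) : scalExt K H →+* scalExt K H))
    (fun c x => galMap_smul τ _ c x) (galMap_basis _ _) (galMap_basis _ _) d
  have h3 := blockSum_scalExt (K := K) φ τ d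
  have h4 := h1.symm.trans (h3.trans h2)
  exact_mod_cast h4

open Polynomial in
theorem card_nthRootsFinset_filter {K : Type*} [Field K] {ζ : K} {M s e : ℕ} {Y : K}
    (hM : 0 < M) (he : Y ^ e = 1) (hζ : IsPrimitiveRoot ζ (e * M)) (he0 : 0 < e) :
    ((nthRootsFinset M Y).filter fun w => w ^ (s + 1) = w).card =
      if Y ^ (s / M.gcd s) = 1 then M.gcd s else 0 := by
  have hY0 : Y ≠ 0 := by rintro rfl; simp [he0.ne'] at he
  set g := M.gcd s with hg
  have hg0 : 0 < g := Nat.gcd_pos_of_pos_left _ hM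
  obtain ⟨M', hM'⟩ : g ∣ M := Nat.gcd_dvd_left _ _
  obtain ⟨s', hs'⟩ : g ∣ s := Nat.gcd_dvd_right _ _
  have hsg : s / g = s' := by rw [hs', Nat.mul_div_cancel_left _ hg0]
  rw [hsg]
  have hmem : ∀ w : K, w ∈ (nthRootsFinset M Y).filter (fun w => w ^ (s + 1) = w) ↔
      w ^ M = Y ∧ w ^ s = 1 := by
    intro w
    rw [Finset.mem_filter, mem_nthRootsFinset hM]
    refine and_congr_right fun hw => ?_
    have hw0 : w ≠ 0 := by rintro rfl; rw [zero_pow hM.ne'] at hw; exact hY0 hw.symm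
    rw [pow_succ, mul_eq_right₀ hw0]
  split_ifs with hYs
  · have : NeZero e := ⟨he0.ne'⟩
    obtain ⟨ω, hω⟩ : ∃ ω : K, ω ^ M = Y := by
      obtain ⟨i, _, hi⟩ := (hζ.pow (Nat.mul_pos he0 hM) (mul_comm e M)).eq_pow_of_pow_eq_one he
      exact ⟨ζ ^ i, by rw [← hi, ← pow_mul, ← pow_mul, mul_comm]⟩
    have hω0 : ω ≠ 0 := by rintro rfl; rw [zero_pow hM.ne'] at hω; exact hY0 hω.symm
    set α : ℤ := M.gcdA s
    set β : ℤ := M.gcdB s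
    have hbez : (g : ℤ) = M * α + s * β := Nat.gcd_eq_gcd_ab M s
    have hprim : IsPrimitiveRoot (ζ ^ (e * M')) g :=
      hζ.pow (Nat.mul_pos he0 hM) (by rw [hM']; ring)
    have hset : (nthRootsFinset M Y).filter (fun w => w ^ (s + 1) = w) =
        nthRootsFinset g ((ω ^ ((M' : ℤ) * α)) ^ g) := by
      ext w
      rw [hmem, mem_nthRootsFinset hg0]
      have hpow : (ω ^ ((M' : ℤ) * α)) ^ g = Y ^ α := by
        rw [← zpow_natCast, ← zpow_mul, ← hω, ← zpow_natCast ω M, ← zpow_mul]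
        congr 1; rw [hM']; push_cast; ring
      rw [hpow]
      constructor
      · rintro ⟨h1, h2⟩
        have hw0 : w ≠ 0 := by rintro rfl; rw [zero_pow hM.ne'] at h1; exact hY0 h1.symm
        rw [← zpow_natCast, hbez, zpow_add₀ hw0, zpow_mul, zpow_mul, zpow_natCast, zpow_natCast,
          h1, h2, one_zpow, mul_one]
      · intro h1
        have hgα : (M' : ℤ) * α + s' * β = 1 := by
          have : (g : ℤ) * (M' * α + s' * β) = g * 1 := by
            rw [mul_one]; conv_rhs => rw [hbez]
            rw [show (M : ℤ) = g * M' by exact_mod_cast hM', show (s : ℤ) = g * s' by exact_mod_cast hs']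
            ring
          exact mul_left_cancel₀ (by exact_mod_cast hg0.ne') this
        constructor
        · rw [hM', pow_mul, h1, ← zpow_natCast, ← zpow_mul, show α * (M' : ℤ) = 1 - s' * β by
            linear_combination hgα, zpow_sub₀ hY0, zpow_one, zpow_mul, zpow_natCast, hYs, one_zpow,
            div_one]
        · rw [hs', pow_mul, h1, ← zpow_natCast, ← zpow_mul, mul_comm, zpow_mul, zpow_natCast, hYs,
            one_zpow]
    rw [hset, nthRootsFinset, Multiset.toFinset_card_of_nodup, hprim.card_nthRoots, if_pos ⟨_, rfl⟩]
    exact hprim.nthRoots_nodup (pow_ne_zero _ (zpow_ne_zero _ hω0))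
  · rw [Finset.card_eq_zero, Finset.eq_empty_iff_forall_notMem]
    intro w hw
    obtain ⟨h1, h2⟩ := (hmem w).1 hw
    apply hYs
    rw [← h1, ← pow_mul, hM', show g * M' * s' = s * M' by rw [hs']; ring, pow_mul, h2, one_pow]

open Polynomial in
theorem MetaNum.pairCount_succ {K : Type*} [Field K] {m n r z : ℕ} (h : MetaNum m n r z) {ζ : K}
    (hζ : IsPrimitiveRoot ζ (m * n)) (s d : ℕ) :
    pairCount K m n r z (s + 1) d = ∑ y ∈ nthRootsFinset m (1 : K),
      if (∃ k, y ^ (s + 1) = y ^ r ^ k) ∧ per r y ∣ d ∧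
          y ^ (z * (s / (n / per r y).gcd s)) = 1 then
        per r y * (n / per r y).gcd s else 0 := by
  rw [pairCount, pairSet, Finset.sum_sigma]
  refine Finset.sum_congr rfl fun y hy => ?_
  have hy1 : y ^ m = 1 := (mem_nthRootsFinset h.m_pos _).1 hy
  have hc := card_nthRootsFinset_filter (K := K) (s := s) (Y := y ^ z) (e := m) (h.div_per_pos hy1)
    (by rw [← pow_mul, mul_comm, pow_mul, hy1, one_pow])
    (hζ.pow (Nat.mul_pos h.m_pos h.n_pos) (a := per r y) (by
      obtain ⟨c, hc⟩ := h.per_dvd hy1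
      conv_lhs => rw [hc]
      rw [hc, Nat.mul_div_cancel_left _ (h.per_pos hy1)]; ring)) h.m_pos
  rw [← pow_mul] at hc
  by_cases h1 : ∃ k, y ^ (s + 1) = y ^ r ^ k
  · by_cases h2 : per r y ∣ d
    · simp only [h1, h2, true_and, and_true]
      rw [← Finset.sum_filter, Finset.sum_const, hc]
      split_ifs <;> simp [mul_comm]
    · simp [h2]
  · simp [h1]

section CoprimeRoots

variable {K : Type*} [Field K] {P Q : ℕ}

theorem exists_crt_exponent (h : P.Coprime Q) :
    ∃ e : ℕ, ∀ u v : K, u ^ P = 1 → v ^ Q = 1 → u ^ e = u ∧ v ^ e = 1 := by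
  obtain ⟨e, he1, he2⟩ := Nat.chineseRemainder h 1 0
  refine ⟨e, fun u v hu hv => ⟨?_, ?_⟩⟩
  · rw [MetaNum.pow_eq_of_modEq hu he1, pow_one]
  · rw [MetaNum.pow_eq_of_modEq hv he2, pow_zero]

theorem mul_pow_eq_mul_pow_iff (h : P.Coprime Q) {u v : K} (hu : u ^ P = 1) (hv : v ^ Q = 1)
    (a b : ℕ) : (u * v) ^ a = (u * v) ^ b ↔ u ^ a = u ^ b ∧ v ^ a = v ^ b := by
  refine ⟨fun H => ?_, fun H => by rw [mul_pow, mul_pow, H.1, H.2]⟩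
  obtain ⟨e, he⟩ := exists_crt_exponent (K := K) h
  obtain ⟨e', he'⟩ := exists_crt_exponent (K := K) h.symm
  constructor
  · have := congrArg (· ^ e) H
    simp only [← pow_mul, mul_comm _ e] at this
    simpa only [pow_mul, mul_pow, (he u v hu hv).1, (he u v hu hv).2, one_pow, mul_one] using this
  · have := congrArg (· ^ e') H
    simp only [← pow_mul, mul_comm _ e'] at this
    simpa only [pow_mul, mul_pow, (he' v u hv hu).1, (he' v u hv hu).2, one_pow, one_mul] using this

theorem per_mul (h : P.Coprime Q) {u v : K} (hu : u ^ P = 1) (hv : v ^ Q = 1) (r : ℕ) :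
    per r (u * v) = (per r u).lcm (per r v) := by
  have key : ∀ d, per r (u * v) ∣ d ↔ (per r u).lcm (per r v) ∣ d := by
    intro d
    rw [Nat.lcm_dvd_iff, per_dvd_iff, per_dvd_iff, per_dvd_iff]
    simpa only [pow_one] using mul_pow_eq_mul_pow_iff h hu hv (r ^ d) 1
  exact Nat.dvd_antisymm ((key _).2 dvd_rfl) ((key _).1 dvd_rfl)

open Polynomial in
theorem sum_nthRootsFinset_mul (h : P.Coprime Q) (hP : 0 < P) (hQ : 0 < Q) {M : Type*}
    [AddCommMonoid M] (f : K → M) :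
    ∑ y ∈ nthRootsFinset (P * Q) (1 : K), f y =
      ∑ v ∈ nthRootsFinset Q (1 : K), ∑ u ∈ nthRootsFinset P (1 : K), f (u * v) := by
  rw [← Finset.sum_product']
  obtain ⟨e, he⟩ := exists_crt_exponent (K := K) h
  obtain ⟨e', he'⟩ := exists_crt_exponent (K := K) h.symm
  symm
  refine Finset.sum_nbij (fun q => q.2 * q.1) ?_ ?_ ?_ (fun _ _ => rfl)
  · rintro ⟨v, u⟩ hq
    simp only [Finset.mem_product, mem_nthRootsFinset hP, mem_nthRootsFinset hQ] at hq
    rw [mem_nthRootsFinset (Nat.mul_pos hP hQ), mul_pow, pow_mul, hq.2, mul_comm P, pow_mul v, hq.1]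
    simp
  · rintro ⟨v, u⟩ hq ⟨v', u'⟩ hq' H
    simp only [Finset.coe_product, Set.mem_prod, Finset.mem_coe, mem_nthRootsFinset hP,
      mem_nthRootsFinset hQ] at hq hq' H
    have h1 := congrArg (· ^ e) H
    have h2 := congrArg (· ^ e') H
    simp only [mul_pow, (he u v hq.2 hq.1).1, (he u v hq.2 hq.1).2, (he u' v' hq'.2 hq'.1).1,
      (he u' v' hq'.2 hq'.1).2, (he' v u hq.1 hq.2).1, (he' v u hq.1 hq.2).2,
      (he' v' u' hq'.1 hq'.2).1, (he' v' u' hq'.1 hq'.2).2, mul_one, one_mul] at h1 h2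
    rw [h1, h2]
  · intro y hy
    rw [Finset.mem_coe, mem_nthRootsFinset (Nat.mul_pos hP hQ)] at hy
    obtain ⟨i, hi1, hi2⟩ := Nat.chineseRemainder h 1 0
    obtain ⟨j, hj1, hj2⟩ := Nat.chineseRemainder h 0 1
    have hij : j + i ≡ 1 [MOD P * Q] :=
      (Nat.modEq_and_modEq_iff_modEq_mul h).1 ⟨by simpa using hj1.add hi1, by simpa using hj2.add hi2⟩
    obtain ⟨i', hi'⟩ := (Nat.modEq_zero_iff_dvd).1 hi2
    obtain ⟨j', hj'⟩ := (Nat.modEq_zero_iff_dvd).1 hj1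
    refine ⟨(y ^ j, y ^ i), ?_, ?_⟩
    · simp only [Finset.coe_product, Set.mem_prod, Finset.mem_coe, mem_nthRootsFinset hP,
        mem_nthRootsFinset hQ]
      constructor
      · rw [hj', ← pow_mul, show P * j' * Q = P * Q * j' by ring, pow_mul, hy, one_pow]
      · rw [hi', ← pow_mul, show Q * i' * P = P * Q * i' by ring, pow_mul, hy, one_pow]
    · simp only
      rw [← pow_add, add_comm, MetaNum.pow_eq_of_modEq hy hij, pow_one]

end CoprimeRoots

open Polynomial in
theorem card_nthRootsFinset_filter_one {K : Type*} [Field K] {ζ : K} {M : ℕ} (hM : 0 < M)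
    (hζ : IsPrimitiveRoot ζ M) (s : ℕ) :
    ((nthRootsFinset M (1 : K)).filter fun w => w ^ s = 1).card = M.gcd s := by
  have h := card_nthRootsFinset_filter (K := K) (s := s) (Y := 1) (e := 1) (ζ := ζ) hM (by simp)
    (by simpa using hζ) one_pos
  rw [if_pos (one_pow _)] at h
  rw [← h]
  congr 1
  refine Finset.filter_congr fun w hw => ?_
  have hw0 : w ≠ 0 := by
    rintro rfl
    rw [mem_nthRootsFinset hM, zero_pow hM.ne'] at hw
    exact zero_ne_one hw
  rw [pow_succ, mul_eq_right₀ hw0]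

theorem per_dvd_iff_pow_sub {K : Type*} [Field K] {r d : ℕ} (hr : 0 < r) {y : K} (hy : y ≠ 0) :
    per r y ∣ d ↔ y ^ (r ^ d - 1) = 1 := by
  rw [per_dvd_iff]
  conv_lhs => rw [show r ^ d = (r ^ d - 1) + 1 by have := pow_pos hr d; omega]
  rw [pow_succ, mul_eq_right₀ hy]

theorem pow_eq_one_and_iff {K : Type*} [Field K] {y : K} (a b : ℕ) :
    y ^ a = 1 ∧ y ^ b = 1 ↔ y ^ a.gcd b = 1 := by
  simp only [← orderOf_dvd_iff_pow_eq_one, Nat.dvd_gcd_iff]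

open Polynomial in
theorem MetaNum.pairCount_one {K : Type*} [Field K] {m n r z : ℕ} (h : MetaNum m n r z)
    (hr : 0 < r) {ζ : K} (hζ : IsPrimitiveRoot ζ (m * n)) (d : ℕ) :
    pairCount K m n r z 1 d = n * m.gcd (r ^ d - 1) := by
  rw [← zero_add 1, h.pairCount_succ hζ, ← card_nthRootsFinset_filter_one h.m_pos
    (hζ.pow (Nat.mul_pos h.m_pos h.n_pos) (mul_comm m n)), Finset.card_filter, Finset.mul_sum]
  refine Finset.sum_congr rfl fun y hy => ?_
  rw [mem_nthRootsFinset h.m_pos] at hy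
  have hy0 : y ≠ 0 := by rintro rfl; rw [zero_pow h.m_pos.ne'] at hy; exact zero_ne_one hy
  have hk : ∃ k, y ^ (0 + 1) = y ^ r ^ k := ⟨0, by simp⟩
  simp only [hk, true_and, per_dvd_iff_pow_sub hr hy0, Nat.gcd_zero_right, Nat.zero_div, mul_zero,
    pow_zero, and_true, Nat.mul_div_cancel' (h.per_dvd hy), mul_ite, mul_one]

open Polynomial in
theorem MetaNum.pairCount_succ_one {K : Type*} [Field K] {m n r z : ℕ} (h : MetaNum m n r z)
    (hr : 0 < r) {ζ : K} (hζ : IsPrimitiveRoot ζ (m * n)) (s : ℕ) :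
    pairCount K m n r z (s + 1) 1 =
      n.gcd s * m.gcd ((r - 1).gcd (s.gcd (z * (s / n.gcd s)))) := by
  rw [h.pairCount_succ hζ, ← card_nthRootsFinset_filter_one h.m_pos
    (hζ.pow (Nat.mul_pos h.m_pos h.n_pos) (mul_comm m n)), Finset.card_filter, Finset.mul_sum]
  refine Finset.sum_congr rfl fun y hy => ?_
  rw [mem_nthRootsFinset h.m_pos] at hy
  have hy0 : y ≠ 0 := by rintro rfl; rw [zero_pow h.m_pos.ne'] at hy; exact zero_ne_one hy
  by_cases h1 : per r y = 1
  · have h2 : y ^ r = y := by simpa using per_dvd_iff.1 (h1.dvd)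
    have h3 : ∀ k, y ^ r ^ k = y := fun k => by
      rw [← per_dvd_iff, h1]; exact one_dvd _
    have h4 : y ^ (r - 1) = 1 := by
      simpa using (per_dvd_iff_pow_sub hr hy0 (d := 1)).1 (by rw [h1])
    simp only [h1, h3, ← pow_eq_one_and_iff, h4, true_and, Nat.div_one, one_mul, exists_const,
      mul_ite, mul_one, mul_zero, dvd_refl]
    rw [pow_succ, mul_eq_right₀ hy0]
  · rw [if_neg (by simp [h1]), ← pow_eq_one_and_iff, if_neg, mul_zero]
    rintro ⟨h2, -⟩
    apply h1
    rw [← Nat.dvd_one, per_dvd_iff_pow_sub hr hy0, pow_one, h2]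

/-- The contribution of a `p`-power root of unity to `pairCount`. -/
def pTerm {K : Type*} [Field K] (p P Q r z t x c : ℕ) (u : K) : ℕ :=
  if u ^ P = 1 ∧ (∃ j, u ^ t = u ^ r ^ (p ^ c * j)) ∧
      u ^ (z * (p ^ x / (Q / (per r u).lcm (p ^ c)).gcd (p ^ x))) = 1 then
    (per r u).lcm (p ^ c) * (Q / (per r u).lcm (p ^ c)).gcd (p ^ x) else 0

open Polynomial in
/-- The sum of `pTerm` over all `L`-th roots of unity. -/
def pSum (K : Type*) [Field K] (L p P Q r z t x c : ℕ) : ℕ :=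
  ∑ u ∈ nthRootsFinset L (1 : K), pTerm p P Q r z t x c u

open Polynomial in
/-- The weight with which `pSum` enters `pairCount`. -/
def wt (K : Type*) [Field K] (p m n r c : ℕ) : ℕ :=
  n * ((nthRootsFinset m (1 : K)).filter fun v => (per r v).factorization p = c).card

theorem gcd_mul_of_dvd {a b q s : ℕ} (ha : a.Coprime s) (hbs : b ∣ s) :
    (a * b).gcd (q * s) = a.gcd q * b := by
  obtain ⟨s', rfl⟩ := hbs
  rw [show q * (b * s') = q * s' * b by ring, Nat.gcd_mul_right,
    Nat.Coprime.gcd_mul_right_cancel_right _ ha.coprime_mul_left_right.symm]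

theorem pow_pow_eq_of_modEq_per {K : Type*} [Monoid K] {r : ℕ} {u : K} {i j : ℕ}
    (hij : i ≡ j [MOD per r u]) : u ^ r ^ i = u ^ r ^ j := by
  rw [← pow_map_iterate, ← pow_map_iterate, ← Function.iterate_mod_minimalPeriod_eq (n := i),
    ← Function.iterate_mod_minimalPeriod_eq (n := j)]
  exact congrArg (fun k => (fun x : K => x ^ r)^[k] u) hij

/-- `MetaNum` together with a factorisation into `p`-part and prime-to-`p`-part such that the
`p`-part of `m` is acted on by a `p`-group. -/
structure SplitNum (p P Q m n r z : ℕ) : Prop where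
  prime : p.Prime
  num : MetaNum (P * m) (Q * n) r z
  pnum : MetaNum P Q r z
  P_pow : ∃ i, P = p ^ i
  Q_pow : ∃ i, Q = p ^ i
  m_cop : p.Coprime m
  n_cop : p.Coprime n

namespace SplitNum

variable {K : Type*} [Field K] {p P Q m n r z : ℕ}

theorem cop_P (h : SplitNum p P Q m n r z) : P.Coprime m := by
  obtain ⟨i, rfl⟩ := h.P_pow; exact h.m_cop.pow_left _

theorem m_pos (h : SplitNum p P Q m n r z) : 0 < m :=
  Nat.pos_of_mul_pos_left h.num.m_pos

theorem n_pos (h : SplitNum p P Q m n r z) : 0 < n :=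
  Nat.pos_of_mul_pos_left h.num.n_pos

/-- The summand of `pairCount` at `y = u * v`. -/
theorem summand_eq (h : SplitNum p P Q m n r z) {x s' : ℕ} (hs : n * m ∣ s')
    (hps : p.Coprime s') {u v : K} (hu : u ^ P = 1) (hv : v ^ m = 1) :
    (if (∃ k, (u * v) ^ (p ^ x * s' + 1) = (u * v) ^ r ^ k) ∧ per r (u * v) ∣ 0 ∧
          (u * v) ^ (z * (p ^ x * s' / (Q * n / per r (u * v)).gcd (p ^ x * s'))) = 1 then
        per r (u * v) * (Q * n / per r (u * v)).gcd (p ^ x * s') else 0) =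
      n * pTerm p P Q r z (p ^ x * s' + 1) x ((per r v).factorization p) u := by
  have hp := h.prime
  have hvm : v ^ (P * m) = 1 := by rw [mul_comm, pow_mul, hv, one_pow]
  obtain ⟨ν, hν⟩ := h.Q_pow
  obtain ⟨δ, hδν, hδ⟩ := (Nat.dvd_prime_pow hp).1 (hν ▸ h.pnum.per_dvd hu)
  set c := (per r v).factorization p with hc
  set D' := per r v / p ^ c with hD'
  have hDv : per r v = p ^ c * D' := (Nat.ordProj_mul_ordCompl_eq_self _ _).symm
  have hDv0 : per r v ≠ 0 := (h.num.per_pos hvm).ne'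
  have hD'p : p.Coprime D' := Nat.coprime_ordCompl hp hDv0
  have hdvd : p ^ c * D' ∣ Q * n := hDv ▸ h.num.per_dvd hvm
  have hcQ : p ^ c ∣ Q :=
    (h.n_cop.pow_left c).dvd_of_dvd_mul_right ((Dvd.intro _ rfl).trans hdvd)
  have hD'n : D' ∣ n := by
    refine (Nat.Coprime.dvd_of_dvd_mul_left ?_ ((Dvd.intro_left _ rfl).trans hdvd))
    rw [hν]; exact (hD'p.pow_left _).symm
  set E := (per r u).lcm (p ^ c) with hE
  have hEQ : E ∣ Q := Nat.lcm_dvd (h.pnum.per_dvd hu) hcQ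
  have hD'0 : 0 < D' := Nat.pos_of_dvd_of_pos hD'n h.n_pos
  have hper : per r (u * v) = E * D' := by
    rw [per_mul h.cop_P hu hv, hDv, hE, hδ]
    refine Nat.dvd_antisymm (Nat.lcm_dvd ((Nat.dvd_lcm_left _ _).mul_right _)
      (mul_dvd_mul_right (Nat.dvd_lcm_right _ _) _)) ?_
    refine Nat.Coprime.mul_dvd_of_dvd_of_dvd ?_ (Nat.lcm_dvd (Nat.dvd_lcm_left _ _) ?_) ?_
    · exact Nat.Coprime.coprime_dvd_left (Nat.lcm_dvd_mul _ _)
        (Nat.Coprime.mul_left (hD'p.pow_left _) (hD'p.pow_left _))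
    · exact (Dvd.intro _ rfl).trans (Nat.dvd_lcm_right _ _)
    · exact (Dvd.intro_left _ rfl).trans (Nat.dvd_lcm_right _ _)
  obtain ⟨q, hq⟩ := hEQ
  obtain ⟨n', hn'⟩ := hD'n
  have hE0 : 0 < E := Nat.pos_of_dvd_of_pos (Dvd.intro _ hq.symm) h.pnum.n_pos
  have hQE : Q / E = q := by rw [hq, Nat.mul_div_cancel_left _ hE0]
  have hqp : q.Coprime s' := by
    have : q ∣ p ^ ν := hν ▸ Dvd.intro_left _ hq.symm
    exact Nat.Coprime.coprime_dvd_left this (hps.pow_left _)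
  have hM : Q * n / per r (u * v) = q * n' := by
    rw [hper, hq, hn', show E * q * (D' * n') = E * D' * (q * n') by ring,
      Nat.mul_div_cancel_left _ (Nat.mul_pos hE0 hD'0)]
  have hn's : n' ∣ s' := (Dvd.intro_left _ hn'.symm).trans ((Dvd.intro _ rfl).trans hs)
  have hn'0 : 0 < n' := Nat.pos_of_mul_pos_left (hn' ▸ h.n_pos)
  set g := q.gcd (p ^ x) with hg
  have hg0 : 0 < g := Nat.gcd_pos_of_pos_right _ (pow_pos hp.pos _)
  have hgcd : (Q * n / per r (u * v)).gcd (p ^ x * s') = g * n' := by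
    rw [hM, gcd_mul_of_dvd hqp hn's]
  obtain ⟨s'', hs''⟩ := hs
  have hs's : s' / n' = D' * m * s'' := by
    rw [hs'', hn', show D' * n' * m * s'' = n' * (D' * m * s'') by ring,
      Nat.mul_div_cancel_left _ hn'0]
  have hquot : p ^ x * s' / (g * n') = p ^ x / g * (D' * m * s'') := by
    rw [← hs's, Nat.mul_div_mul_comm (Nat.gcd_dvd_right _ _) hn's]
  have h1 : (∃ k, (u * v) ^ (p ^ x * s' + 1) = (u * v) ^ r ^ k) ↔
      ∃ j, u ^ (p ^ x * s' + 1) = u ^ r ^ (p ^ c * j) := by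
    have hvt : v ^ (p ^ x * s' + 1) = v := by
      rw [hs'', show p ^ x * (n * m * s'') + 1 = m * (p ^ x * n * s'') + 1 by ring, pow_succ,
        pow_mul, hv, one_pow, one_mul]
    simp only [mul_pow_eq_mul_pow_iff h.cop_P hu hv, hvt]
    constructor
    · rintro ⟨k, h2, h3⟩
      obtain ⟨j, hj⟩ := (hDv ▸ per_dvd_iff.2 h3.symm : p ^ c * D' ∣ k)
      exact ⟨D' * j, by rw [h2, hj, mul_assoc]⟩
    · rintro ⟨j, hj⟩
      have hcop : (p ^ δ).Coprime D' := hD'p.pow_left _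
      obtain ⟨l, hl1, hl2⟩ := Nat.chineseRemainder hcop j 0
      obtain ⟨l', rfl⟩ := (Nat.modEq_zero_iff_dvd).1 hl2
      refine ⟨p ^ c * (D' * l'), ?_, ?_⟩
      · rw [hj]
        exact pow_pow_eq_of_modEq_per (hδ ▸ (hl1.symm.mul_left _))
      · rw [eq_comm, ← per_dvd_iff, hDv]
        exact ⟨l', by ring⟩
  have h2 : (u * v) ^ (z * (p ^ x * s' / (g * n'))) = 1 ↔ u ^ (z * (p ^ x / g)) = 1 := by
    rw [hquot, mul_pow]
    have hv1 : v ^ (z * (p ^ x / g * (D' * m * s''))) = 1 := by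
      rw [show z * (p ^ x / g * (D' * m * s'')) = m * (z * (p ^ x / g) * D' * s'') by ring, pow_mul,
        hv, one_pow]
    rw [hv1, mul_one, ← mul_assoc, pow_mul]
    have hcop : P.Coprime (D' * m * s'') := by
      rw [← hs's]
      obtain ⟨i, rfl⟩ := h.P_pow
      exact Nat.Coprime.coprime_dvd_right (Nat.div_dvd_of_dvd hn's) (hps.pow_left _)
    refine ⟨fun H => ?_, fun H => by rw [H, one_pow]⟩
    have h3 : (u ^ (z * (p ^ x / g))) ^ P = 1 := by rw [← pow_mul, mul_comm, pow_mul, hu, one_pow]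
    have := (pow_eq_one_and_iff _ _).1 ⟨h3, H⟩
    rwa [hcop, pow_one] at this
  rw [hgcd, h1, h2, pTerm, ← hE, hQE, ← hg, hper]
  simp only [hu, dvd_zero, true_and, mul_ite, mul_zero]
  refine if_congr Iff.rfl ?_ rfl
  rw [hn']; ring

open Polynomial in
theorem pairCount_eq (h : SplitNum p P Q m n r z) {ζ : K}
    (hζ : IsPrimitiveRoot ζ (P * m * (Q * n))) {x s' : ℕ} (hs : n * m ∣ s')
    (hps : p.Coprime s') {L k : ℕ} (hL : P ∣ L) (hL0 : 0 < L) (hk : Q * n < p ^ k) :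
    pairCount K (P * m) (Q * n) r z (p ^ x * s' + 1) 0 =
      ∑ c ∈ Finset.range k, wt K p m n r c * pSum K L p P Q r z (p ^ x * s' + 1) x c := by
  rw [h.num.pairCount_succ hζ, sum_nthRootsFinset_mul h.cop_P h.pnum.m_pos h.m_pos]
  have h1 : ∀ v ∈ nthRootsFinset m (1 : K), ∑ u ∈ nthRootsFinset P (1 : K),
      (if (∃ k, (u * v) ^ (p ^ x * s' + 1) = (u * v) ^ r ^ k) ∧ per r (u * v) ∣ 0 ∧
          (u * v) ^ (z * (p ^ x * s' / (Q * n / per r (u * v)).gcd (p ^ x * s'))) = 1 then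
        per r (u * v) * (Q * n / per r (u * v)).gcd (p ^ x * s') else 0) =
      n * pSum K L p P Q r z (p ^ x * s' + 1) x ((per r v).factorization p) := by
    intro v hv
    rw [mem_nthRootsFinset h.m_pos] at hv
    rw [pSum, Finset.mul_sum]
    have hsub : nthRootsFinset P (1 : K) ⊆ nthRootsFinset L (1 : K) := by
      intro u hu
      rw [mem_nthRootsFinset h.pnum.m_pos] at hu
      obtain ⟨l, rfl⟩ := hL
      rw [mem_nthRootsFinset hL0, pow_mul, hu, one_pow]
    rw [← Finset.sum_subset hsub]
    · refine Finset.sum_congr rfl fun u hu => ?_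
      rw [mem_nthRootsFinset h.pnum.m_pos] at hu
      exact h.summand_eq hs hps hu hv
    · intro u _ hu
      rw [mem_nthRootsFinset h.pnum.m_pos] at hu
      rw [pTerm, if_neg (fun H => hu H.1), mul_zero]
  rw [Finset.sum_congr rfl h1]
  have hmaps : ∀ v ∈ nthRootsFinset m (1 : K), (per r v).factorization p ∈ Finset.range k := by
    intro v hv
    rw [mem_nthRootsFinset h.m_pos] at hv
    have hv' : v ^ (P * m) = 1 := by rw [mul_comm, pow_mul, hv, one_pow]
    rw [Finset.mem_range]
    by_contra hcon
    have h2 : p ^ k ∣ Q * n := ((pow_dvd_pow p (not_lt.1 hcon)).trans (Nat.ordProj_dvd _ _)).trans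
      (h.num.per_dvd hv')
    exact absurd (Nat.le_of_dvd h.num.n_pos h2) (not_le.2 hk)
  rw [← Finset.sum_fiberwise_of_maps_to hmaps]
  refine Finset.sum_congr rfl fun c _ => ?_
  rw [Finset.sum_congr rfl (g := fun _ => n * pSum K L p P Q r z (p ^ x * s' + 1) x c)
    (fun v hv => by rw [(Finset.mem_filter.1 hv).2]), Finset.sum_const, wt, smul_eq_mul]
  ring

end SplitNum

theorem eq_and_eq_of_mul_eq_mul {p k a b a' b' : ℕ} (ha : a ∣ p ^ k) (ha' : a' ∣ p ^ k)
    (hp : 0 < p) (hb : p.Coprime b) (hb' : p.Coprime b') (h : a * b = a' * b') :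
    a = a' ∧ b = b' := by
  have h1 : a = a' := Nat.dvd_antisymm
    ((Nat.Coprime.coprime_dvd_left ha (hb'.pow_left k)).dvd_of_dvd_mul_right
      (h ▸ Dvd.intro _ rfl))
    ((Nat.Coprime.coprime_dvd_left ha' (hb.pow_left k)).dvd_of_dvd_mul_right
      (h ▸ Dvd.intro _ rfl))
  subst h1
  exact ⟨rfl, Nat.eq_of_mul_eq_mul_left (Nat.pos_of_dvd_of_pos ha (pow_pos hp k)) h⟩

theorem eq_of_forall_dvd_iff {a b : ℕ} (h : ∀ e, e ∣ a ↔ e ∣ b) : a = b :=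
  Nat.dvd_antisymm ((h a).1 dvd_rfl) ((h b).2 dvd_rfl)

/-- The `p`-part of `pairCount` for degree one. -/
def vNum (p P Q r z x : ℕ) : ℕ :=
  Q.gcd (p ^ x) * P.gcd ((r - 1).gcd ((p ^ x).gcd (z * (p ^ x / Q.gcd (p ^ x)))))

theorem pTerm_congr {K : Type*} [Field K] {p P Q r z t t' x c : ℕ} (ht : t ≡ t' [MOD P]) (u : K) :
    pTerm p P Q r z t x c u = pTerm p P Q r z t' x c u := by
  rw [pTerm, pTerm]
  by_cases hu : u ^ P = 1
  · rw [MetaNum.pow_eq_of_modEq hu ht]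
  · rw [if_neg (fun H => hu H.1), if_neg (fun H => hu H.1)]

open Polynomial in
theorem sum_wt {K : Type*} [Field K] {p m n r k : ℕ} (hp : p.Prime) (hm : 0 < m) (hr : 0 < r)
    (hn : p.Coprime n) (hpm : p.Coprime m)
    {ζ : K} (hζ : IsPrimitiveRoot ζ m) (hper : ∀ v : K, v ^ m = 1 → per r v ∣ p ^ k * n) (j : ℕ) :
    ∑ c ∈ Finset.range (j + 1), wt K p m n r c = n * m.gcd (r ^ (p ^ j * (n * m)) - 1) := by
  rw [← card_nthRootsFinset_filter_one hm hζ]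
  simp only [wt]
  rw [← Finset.mul_sum]
  congr 1
  rw [Finset.card_eq_sum_card_fiberwise (f := fun v : K => (per r v).factorization p)
    (t := Finset.range (j + 1))]
  · refine Finset.sum_congr rfl fun c hc => ?_
    rw [Finset.filter_filter]
    congr 1
    refine Finset.filter_congr fun v hv => ?_
    rw [mem_nthRootsFinset hm] at hv
    have hv0 : v ≠ 0 := by rintro rfl; rw [zero_pow hm.ne'] at hv; exact zero_ne_one hv
    rw [iff_and_self, ← per_dvd_iff_pow_sub hr hv0]
    rintro rfl
    rw [← Nat.ordProj_mul_ordCompl_eq_self (per r v) p]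
    refine mul_dvd_mul (pow_dvd_pow _ (Nat.lt_succ_iff.1 (Finset.mem_range.1 hc))) ?_
    refine Dvd.dvd.mul_right ?_ _
    have h0 : per r v ≠ 0 := by
      rintro h0
      have := hper v hv
      rw [h0, zero_dvd_iff] at this
      have hn0 : n ≠ 0 := by rintro rfl; exact hp.one_lt.ne' (by simpa using hn)
      exact mul_ne_zero (pow_ne_zero _ hp.pos.ne') hn0 this
    refine ((Nat.coprime_ordCompl hp h0).symm.pow_right k).dvd_of_dvd_mul_left ?_
    exact (Nat.ordCompl_dvd _ _).trans (hper v hv)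
  · intro v hv
    rw [Finset.mem_coe, Finset.mem_filter, mem_nthRootsFinset hm] at hv
    have hv0 : v ≠ 0 := by rintro rfl; rw [zero_pow hm.ne'] at hv; exact zero_ne_one hv.1
    rw [← per_dvd_iff_pow_sub hr hv0] at hv
    simp only [Finset.coe_range, Set.mem_Iio]
    have hn0 : n ≠ 0 := by rintro rfl; exact hp.one_lt.ne' (by simpa using hn)
    have h1 := (Nat.factorization_le_iff_dvd (fun h0 => by
      have := hv.2; rw [h0, zero_dvd_iff] at this
      exact mul_ne_zero (pow_ne_zero _ hp.pos.ne') (mul_ne_zero hn0 hm.ne') this)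
      (mul_ne_zero (pow_ne_zero _ hp.pos.ne') (mul_ne_zero hn0 hm.ne'))).2 hv.2 p
    rw [Nat.factorization_mul (pow_ne_zero _ hp.pos.ne') (mul_ne_zero hn0 hm.ne'),
      Finsupp.add_apply, hp.factorization_pow, Finsupp.single_eq_same,
      Nat.factorization_eq_zero_of_not_dvd (n := n * m)] at h1
    · omega
    · exact (Nat.Prime.coprime_iff_not_dvd hp).1 (Nat.Coprime.mul_right hn hpm)

theorem MetaNum.gcd_eq {K : Type*} [Field K] {p k P Q m n r z P' Q' m' n' r' z' : ℕ}
    (hp : p.Prime)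
    (h : MetaNum (P * m) (Q * n) r z) (h' : MetaNum (P' * m') (Q' * n') r' z')
    (hr : 0 < r) (hr' : 0 < r') (hPQ : Q * P ∣ p ^ k) (hPQ' : Q' * P' ∣ p ^ k)
    (hm : p.Coprime m) (hn : p.Coprime n) (hm' : p.Coprime m') (hn' : p.Coprime n')
    {ζ : K} (hζ : IsPrimitiveRoot ζ (P * m * (Q * n)))
    (hN : P * m * (Q * n) = P' * m' * (Q' * n')) (d : ℕ)
    (hc : pairCount K (P * m) (Q * n) r z 1 d = pairCount K (P' * m') (Q' * n') r' z' 1 d) :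
    Q * P.gcd (r ^ d - 1) = Q' * P'.gcd (r' ^ d - 1) ∧
      n * m.gcd (r ^ d - 1) = n' * m'.gcd (r' ^ d - 1) := by
  rw [h.pairCount_one hr hζ, h'.pairCount_one hr' (hN ▸ hζ)] at hc
  have hco : P.Coprime m := Nat.Coprime.coprime_dvd_left ((Dvd.intro_left _ rfl).trans hPQ)
    (hm.pow_left k)
  have hco' : P'.Coprime m' := Nat.Coprime.coprime_dvd_left ((Dvd.intro_left _ rfl).trans hPQ')
    (hm'.pow_left k)
  rw [hco.mul_gcd, hco'.mul_gcd] at hc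
  refine eq_and_eq_of_mul_eq_mul (k := k) ((mul_dvd_mul_left _ (Nat.gcd_dvd_left _ _)).trans hPQ)
    ((mul_dvd_mul_left _ (Nat.gcd_dvd_left _ _)).trans hPQ') hp.pos
    (hn.mul_right (hm.coprime_dvd_right (Nat.gcd_dvd_left _ _)))
    (hn'.mul_right (hm'.coprime_dvd_right (Nat.gcd_dvd_left _ _))) ?_
  linarith

theorem SplitNum.pairCount_succ_one {K : Type*} [Field K] {p P Q m n r z : ℕ}
    (h : SplitNum p P Q m n r z) (hr : 0 < r) {ζ : K}
    (hζ : IsPrimitiveRoot ζ (P * m * (Q * n))) {x s' : ℕ} (hs : n * m ∣ s')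
    (hps : p.Coprime s') :
    ∃ b, p.Coprime b ∧
      pairCount K (P * m) (Q * n) r z (p ^ x * s' + 1) 1 = vNum p P Q r z x * b := by
  rw [h.num.pairCount_succ_one hr hζ]
  have hcP : P.Coprime s' := by
    obtain ⟨i, rfl⟩ := h.P_pow; exact hps.pow_left _
  have hcQ : Q.Coprime s' := by
    obtain ⟨i, rfl⟩ := h.Q_pow; exact hps.pow_left _
  have hns : n ∣ s' := (Dvd.intro _ rfl).trans hs
  rw [gcd_mul_of_dvd hcQ hns, Nat.mul_div_mul_comm (Nat.gcd_dvd_right _ _) hns, h.cop_P.mul_gcd]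
  set A := p ^ x / Q.gcd (p ^ x)
  set Y := (r - 1).gcd ((p ^ x * s').gcd (z * (A * (s' / n))))
  refine ⟨n * m.gcd Y, h.n_cop.mul_right (h.m_cop.coprime_dvd_right (Nat.gcd_dvd_left _ _)), ?_⟩
  have : P.gcd Y = P.gcd ((r - 1).gcd ((p ^ x).gcd (z * A))) := by
    refine eq_of_forall_dvd_iff fun e => ?_
    simp only [Y, Nat.dvd_gcd_iff]
    refine and_congr_right fun he => and_congr_right fun _ => ?_
    have h1 : e.Coprime s' := hcP.coprime_dvd_left he
    have h2 : e.Coprime (s' / n) := h1.coprime_dvd_right (Nat.div_dvd_of_dvd hns)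
    rw [h1.dvd_mul_right, ← mul_assoc z, h2.dvd_mul_right]
  rw [this, vNum]
  ring

open Polynomial in
theorem SplitNum.dvd_of_wt_ne_zero {K : Type*} [Field K] {p P Q m n r z c : ℕ}
    (h : SplitNum p P Q m n r z) (hc : wt K p m n r c ≠ 0) : p ^ c ∣ Q := by
  obtain ⟨v, hv⟩ := Finset.card_ne_zero.1 (right_ne_zero_of_mul hc)
  rw [Finset.mem_filter, mem_nthRootsFinset h.m_pos] at hv
  have h1 : v ^ (P * m) = 1 := by rw [mul_comm, pow_mul, hv.1, one_pow]
  refine (h.n_cop.pow_left c).dvd_of_dvd_mul_right ?_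
  rw [← hv.2]
  exact (Nat.ordProj_dvd _ _).trans (h.num.per_dvd h1)

/-- Numerical relations between the Sylow data of two metacyclic groups with isomorphic rational
group algebras. -/
structure PairInv (K : Type*) [Field K] (p P Q r z P' Q' r' z' : ℕ) : Prop where
  prime : p.Prime
  num : MetaNum P Q r z
  num' : MetaNum P' Q' r' z'
  P_pow : ∃ i, P = p ^ i
  Q_pow : ∃ i, Q = p ^ i
  P'_pow : ∃ i, P' = p ^ i
  Q'_pow : ∃ i, Q' = p ^ i
  r_pos : 0 < r
  r'_pos : 0 < r'
  root : ∃ ζ : K, IsPrimitiveRoot ζ (P * P')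
  card : P * Q = P' * Q'
  gcd_eq : ∀ d, Q * P.gcd (r ^ d - 1) = Q' * P'.gcd (r' ^ d - 1)
  vNum_eq : ∀ x, 1 ≤ x → vNum p P Q r z x = vNum p P' Q' r' z' x
  sum_eq : ∃ (k : ℕ) (w : ℕ → ℕ), 0 < k ∧ 0 < w 0 ∧
    (∀ c, w c ≠ 0 → p ^ c ∣ Q ∧ p ^ c ∣ Q') ∧ ∀ t x, 1 ≤ x → p.Coprime t →
    ∑ c ∈ Finset.range k, w c * pSum K (P * P') p P Q r z (p ^ x * t + 1) x c =
      ∑ c ∈ Finset.range k, w c * pSum K (P * P') p P' Q' r' z' (p ^ x * t + 1) x c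

theorem PairInv.symm {K : Type*} [Field K] {p P Q r z P' Q' r' z' : ℕ}
    (h : PairInv K p P Q r z P' Q' r' z') : PairInv K p P' Q' r' z' P Q r z where
  prime := h.prime
  num := h.num'
  num' := h.num
  P_pow := h.P'_pow
  Q_pow := h.Q'_pow
  P'_pow := h.P_pow
  Q'_pow := h.Q_pow
  r_pos := h.r'_pos
  r'_pos := h.r_pos
  root := mul_comm P P' ▸ h.root
  card := h.card.symm
  gcd_eq d := (h.gcd_eq d).symm
  vNum_eq x hx := (h.vNum_eq x hx).symm
  sum_eq := by
    obtain ⟨k, w, h1, h2, h0, h3⟩ := h.sum_eq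
    exact ⟨k, w, h1, h2, fun c hc => (h0 c hc).symm, fun t x hx ht => by rw [mul_comm P' P]; exact (h3 t x hx ht).symm⟩

theorem SplitNum.pairInv {K : Type*} [Field K] {p P Q m n r z P' Q' m' n' r' z' : ℕ}
    (h : SplitNum p P Q m n r z) (h' : SplitNum p P' Q' m' n' r' z') (hr : 0 < r) (hr' : 0 < r')
    (hPQ : P * Q = P' * Q') (hmn : m * n = m' * n')
    {ξ : K} (hξ : IsPrimitiveRoot ξ (P * P')) {ζ : K} (hζ : IsPrimitiveRoot ζ (P * m * (Q * n)))
    (hc : ∀ t d, t.Coprime (P * m * (Q * n)) →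
      pairCount K (P * m) (Q * n) r z t d = pairCount K (P' * m') (Q' * n') r' z' t d) :
    PairInv K p P Q r z P' Q' r' z' := by
  have hN : P * m * (Q * n) = P' * m' * (Q' * n') := by
    calc _ = P * Q * (m * n) := by ring
      _ = _ := by rw [hPQ, hmn]; ring
  obtain ⟨μ, hμ⟩ := h.P_pow
  obtain ⟨ν, hν⟩ := h.Q_pow
  obtain ⟨μ', hμ'⟩ := h'.P_pow
  obtain ⟨ν', hν'⟩ := h'.Q_pow
  have hp := h.prime
  have hQP : Q * P ∣ p ^ (ν + μ) := by rw [hμ, hν, pow_add]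
  have hQP' : Q' * P' ∣ p ^ (ν + μ) := by rw [mul_comm, ← hPQ, mul_comm]; exact hQP
  have hg := fun d => MetaNum.gcd_eq hp h.num h'.num hr hr' hQP hQP' h.m_cop h.n_cop h'.m_cop
    h'.n_cop hζ hN d (hc 1 d (Nat.coprime_one_left _))
  have hex : ∀ t x B, 1 ≤ x → p.Coprime t → ∃ s', s' ≡ t [MOD p ^ B] ∧ n * m ∣ s' ∧ n' * m' ∣ s' ∧
      (1 ≤ B → p.Coprime s') ∧ (p ^ x * s' + 1).Coprime (P * m * (Q * n)) := by
    intro t x B hx ht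
    have hco : (p ^ B).Coprime (m * n) := (h.m_cop.mul_right h.n_cop).pow_left _
    obtain ⟨s', h1, h2⟩ := Nat.chineseRemainder hco t 0
    have h3 := Nat.modEq_zero_iff_dvd.1 h2
    refine ⟨s', h1, mul_comm m n ▸ h3, mul_comm m' n' ▸ hmn ▸ h3, fun hB => ?_, ?_⟩
    · have h4 : s' ≡ t [MOD p] := h1.of_dvd (dvd_pow_self p (by omega))
      rw [Nat.Coprime, Nat.gcd_comm, h4.gcd_eq, Nat.gcd_comm]
      exact ht
    · have h5 : (p ^ x * s' + 1).Coprime (p ^ x * s') := by simp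
      have h6 : (p ^ x * s' + 1).Coprime p :=
        h5.coprime_dvd_right ((dvd_pow_self p (by omega)).mul_right _)
      have h7 : (p ^ x * s' + 1).Coprime (m * n) := h5.coprime_dvd_right (h3.mul_left _)
      rw [show P * m * (Q * n) = P * Q * (m * n) by ring, hμ, hν]
      exact Nat.Coprime.mul_right (Nat.Coprime.mul_right (h6.pow_right _) (h6.pow_right _)) h7
  refine ⟨hp, h.pnum, h'.pnum, h.P_pow, h.Q_pow, h'.P_pow, h'.Q_pow, hr, hr', ⟨ξ, hξ⟩, hPQ,
    fun d => (hg d).1, fun x hx => ?_, ?_⟩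
  · obtain ⟨s', -, h2, h3, h4, h5⟩ := hex 1 x 1 hx (Nat.coprime_one_right p)
    obtain ⟨b, hb, hb1⟩ := h.pairCount_succ_one hr hζ h2 (h4 le_rfl) (x := x)
    obtain ⟨b', hb', hb1'⟩ := h'.pairCount_succ_one hr' (hN ▸ hζ) h3 (h4 le_rfl) (x := x)
    have h6 := hc _ 1 h5
    rw [hb1, hb1'] at h6
    refine (eq_and_eq_of_mul_eq_mul (k := ν + μ) ?_ ?_ hp.pos hb hb' h6).1
    · exact (mul_dvd_mul (Nat.gcd_dvd_left _ _) (Nat.gcd_dvd_left _ _)).trans hQP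
    · exact (mul_dvd_mul (Nat.gcd_dvd_left _ _) (Nat.gcd_dvd_left _ _)).trans hQP'
  · have hper : ∀ v : K, v ^ m = 1 → per r v ∣ p ^ ν * n := fun v hv =>
      hν ▸ h.num.per_dvd (by rw [mul_comm, pow_mul, hv, one_pow])
    have hper' : ∀ v : K, v ^ m' = 1 → per r' v ∣ p ^ ν' * n' := fun v hv =>
      hν' ▸ h'.num.per_dvd (by rw [mul_comm, pow_mul, hv, one_pow])
    have hS := sum_wt hp h.m_pos hr h.n_cop h.m_cop (hζ.pow (Nat.mul_pos h.num.m_pos h.num.n_pos)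
      (a := P * (Q * n)) (by ring)) hper
    have hS' := sum_wt hp h'.m_pos hr' h'.n_cop h'.m_cop ((hN ▸ hζ).pow
      (Nat.mul_pos h'.num.m_pos h'.num.n_pos) (a := P' * (Q' * n')) (by ring)) hper'
    have hcum : ∀ j, ∑ c ∈ Finset.range (j + 1), wt K p m n r c =
        ∑ c ∈ Finset.range (j + 1), wt K p m' n' r' c := fun j => by
      rw [hS, hS', mul_comm n m, hmn, mul_comm n' m', (hg _).2]
    have hwt : ∀ c, wt K p m n r c = wt K p m' n' r' c := by
      intro c
      cases c with
      | zero => simpa using hcum 0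
      | succ c =>
        have h1 := hcum (c + 1)
        rw [Finset.sum_range_succ, Finset.sum_range_succ _ (c + 1), hcum c] at h1
        omega
    have hw0 : 0 < wt K p m n r 0 := by
      have h1 := hS 0
      rw [Finset.sum_range_one] at h1
      rw [h1]
      exact Nat.mul_pos h.n_pos (Nat.gcd_pos_of_pos_left _ h.m_pos)
    set k := Q * n + Q' * n' with hk
    have hkp : k < p ^ k := Nat.lt_pow_self hp.one_lt
    have hk0 := h.num.n_pos
    refine ⟨k, wt K p m n r, by omega, hw0,
      fun c hc => ⟨h.dvd_of_wt_ne_zero hc, h'.dvd_of_wt_ne_zero (hwt c ▸ hc)⟩, fun t x hx ht => ?_⟩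
    obtain ⟨s', h1, h2, h3, h4, h5⟩ := hex t x (μ + μ' + 1) hx ht
    have h6 := hc _ 0 h5
    have hL : 0 < P * P' := Nat.mul_pos h.pnum.m_pos h'.pnum.m_pos
    rw [h.pairCount_eq hζ h2 (h4 (by omega)) (Dvd.intro _ rfl) hL (k := k) (by omega),
      h'.pairCount_eq (hN ▸ hζ) h3 (h4 (by omega)) (Dvd.intro_left _ rfl) hL (k := k) (by omega)] at h6
    have hmod : p ^ x * s' + 1 ≡ p ^ x * t + 1 [MOD p ^ (μ + μ' + 1)] := (h1.mul_left _).add_right 1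
    have hP1 : ∀ c, pSum K (P * P') p P Q r z (p ^ x * s' + 1) x c =
        pSum K (P * P') p P Q r z (p ^ x * t + 1) x c := fun c =>
      Finset.sum_congr rfl fun u _ => pTerm_congr (hmod.of_dvd (hμ ▸ pow_dvd_pow p (by omega))) u
    have hP2 : ∀ c, pSum K (P * P') p P' Q' r' z' (p ^ x * s' + 1) x c =
        pSum K (P * P') p P' Q' r' z' (p ^ x * t + 1) x c := fun c =>
      Finset.sum_congr rfl fun u _ => pTerm_congr (hmod.of_dvd (hμ' ▸ pow_dvd_pow p (by omega))) u
    simpa only [hP1, hP2, ← hwt] using h6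

theorem eq_of_forall_iff_dvd {a b : ℕ} (h : ∀ d, a ∣ d ↔ b ∣ d) : a = b :=
  Nat.dvd_antisymm ((h b).2 dvd_rfl) ((h a).1 dvd_rfl)

theorem le_pTerm_of {K : Type*} [Field K] {p P Q r z t x c E : ℕ} {u : K} (hu : u ^ P = 1)
    (ht : ∃ j, u ^ t = u ^ r ^ (p ^ c * j)) (hE : (per r u).lcm (p ^ c) = E)
    (hz : u ^ (z * (p ^ x / (Q / E).gcd (p ^ x))) = 1) :
    pTerm p P Q r z t x c u = E * (Q / E).gcd (p ^ x) := by
  rw [pTerm, hE, if_pos ⟨hu, ht, hz⟩]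

theorem pTerm_le_of {K : Type*} [Field K] {p P Q r z t x c B : ℕ} {u : K}
    (h : u ^ P = 1 → (∃ j, u ^ t = u ^ r ^ (p ^ c * j)) →
      u ^ (z * (p ^ x / (Q / (per r u).lcm (p ^ c)).gcd (p ^ x))) = 1 →
      (per r u).lcm (p ^ c) * (Q / (per r u).lcm (p ^ c)).gcd (p ^ x) ≤ B) :
    pTerm p P Q r z t x c u ≤ B := by
  rw [pTerm]
  split_ifs with h1
  · exact h h1.1 h1.2.1 h1.2.2
  · exact Nat.zero_le _

namespace PairInv

variable {K : Type*} [Field K] {p P Q r z P' Q' r' z' : ℕ}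

theorem not_pTerm_lt (h : PairInv K p P Q r z P' Q' r' z') {t x : ℕ} (hx : 1 ≤ x)
    (ht : p.Coprime t)
    (hle : ∀ c (u : K), p ^ c ∣ Q → p ^ c ∣ Q' →
      pTerm p P Q r z (p ^ x * t + 1) x c u ≤ pTerm p P' Q' r' z' (p ^ x * t + 1) x c u)
    {u : K} (hu : u ^ P' = 1)
    (hlt : pTerm p P Q r z (p ^ x * t + 1) x 0 u < pTerm p P' Q' r' z' (p ^ x * t + 1) x 0 u) :
    False := by
  obtain ⟨k, w, hk, hw, hdvd, hsum⟩ := h.sum_eq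
  refine (Finset.sum_lt_sum (s := Finset.range k) (fun c _ => ?_)
    ⟨0, Finset.mem_range.2 hk, ?_⟩).ne (hsum t x hx ht)
  · by_cases hc : w c = 0
    · simp [hc]
    · exact Nat.mul_le_mul_left _
        (Finset.sum_le_sum fun u _ => hle c u (hdvd c hc).1 (hdvd c hc).2)
  · refine Nat.mul_lt_mul_of_pos_left (Finset.sum_lt_sum
      (fun u _ => hle 0 u (by simp) (by simp)) ⟨u, ?_, hlt⟩) hw
    rw [Polynomial.mem_nthRootsFinset (Nat.mul_pos h.num.m_pos h.num'.m_pos), mul_comm, pow_mul, hu,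
      one_pow]

theorem exists_root (h : PairInv K p P Q r z P' Q' r' z') : ∃ ζ : K, IsPrimitiveRoot ζ P' := by
  obtain ⟨ζ, hζ⟩ := h.root
  exact ⟨_, hζ.pow (Nat.mul_pos h.num.m_pos h.num'.m_pos) (rfl)⟩

theorem pow_eq_pow_iff_modEq' {u : K} (hu : u ≠ 0) {a b : ℕ} :
    u ^ a = u ^ b ↔ a ≡ b [MOD orderOf u] := by
  lift u to Kˣ using IsUnit.mk0 u hu
  rw [orderOf_units, ← pow_eq_pow_iff_modEq]
  norm_cast

theorem ne_zero_of_pow_eq_one {u : K} {n : ℕ} (hn : 0 < n) (hu : u ^ n = 1) : u ≠ 0 := by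
  rintro rfl
  rw [zero_pow hn.ne'] at hu
  exact zero_ne_one hu

theorem pow_prime_pow_eq_one (h : PairInv K p P Q r z P' Q' r' z') {x t R : ℕ} (ht : p.Coprime t)
    (hR : R ≡ 1 [MOD p ^ (x + 1)]) {u : K} (hu : u ^ P = 1) (he : u ^ (p ^ x * t + 1) = u ^ R) :
    u ^ p ^ x = 1 := by
  have hp := h.prime
  obtain ⟨μ, hμ⟩ := h.P_pow
  have hu0 := ne_zero_of_pow_eq_one h.num.m_pos hu
  obtain ⟨k, -, hk⟩ := (Nat.dvd_prime_pow hp).1 (hμ ▸ orderOf_dvd_of_pow_eq_one hu)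
  rw [← orderOf_dvd_iff_pow_eq_one, hk]
  rw [pow_eq_pow_iff_modEq' hu0, hk] at he
  by_contra hcon
  have hxk : x + 1 ≤ k := by
    by_contra hlt
    exact hcon (pow_dvd_pow p (by omega))
  have h1 : p ^ x * t + 1 ≡ 0 + 1 [MOD p ^ (x + 1)] := (he.of_dvd (pow_dvd_pow p hxk)).trans hR
  have h2 := Nat.modEq_zero_iff_dvd.1 (Nat.ModEq.add_right_cancel' 1 h1)
  rw [pow_succ] at h2
  have h3 := Nat.dvd_of_mul_dvd_mul_left (pow_pos hp.pos x) h2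
  exact (Nat.Prime.coprime_iff_not_dvd hp).1 ht h3

theorem per_eq_one_of {u : K} {q r : ℕ} (hu : u ^ q = 1) (hr : r ≡ 1 [MOD q]) : per r u = 1 := by
  rw [← Nat.dvd_one, per_dvd_iff, pow_one, MetaNum.pow_eq_of_modEq hu hr, pow_one]

theorem false_of_lt_level (h : PairInv K p P Q r z P' Q' r' z') {x t : ℕ} (hx : 1 ≤ x)
    (ht : p.Coprime t) (hr : r ≡ 1 [MOD p ^ (x + 1)]) (hQ : Q ∣ Q') (hP : p ^ (x + 1) ∣ P')
    (hz : p ^ (x + 1) ∣ z') (hr' : r' = p ^ x * t + 1) : False := by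
  have hp := h.prime
  obtain ⟨ζ, hζ⟩ := h.exists_root
  obtain ⟨P₁, hP₁⟩ := hP
  have hζ' : IsPrimitiveRoot (ζ ^ P₁) (p ^ (x + 1)) :=
    hζ.pow h.num'.m_pos (by rw [hP₁]; ring)
  have hxx : p ^ x ∣ p ^ (x + 1) := pow_dvd_pow p (by omega)
  have hr1 : r' ≡ 1 [MOD p ^ x] := by
    rw [hr']
    simp
  refine h.not_pTerm_lt (t := t) hx ht (u := ζ ^ P₁) (fun c u hc hc' => ?_) ?_ ?_
  · refine pTerm_le_of fun hu ⟨j, hj⟩ _ => ?_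
    have hu1 : u ^ p ^ x = 1 := h.pow_prime_pow_eq_one ht (by simpa using hr.pow _) hu hj
    rw [per_eq_one_of hu1 (hr.of_dvd hxx), Nat.lcm_one_left]
    have h1 : u ^ p ^ (x + 1) = 1 := by rw [pow_succ, pow_mul, hu1, one_pow]
    obtain ⟨z₁, hz₁⟩ := hz
    rw [le_pTerm_of (E := p ^ c) (by rw [hP₁, pow_mul, h1, one_pow])
      ⟨0, by rw [pow_succ, pow_mul, hu1]; simp⟩ (by rw [per_eq_one_of hu1 hr1, Nat.lcm_one_left])
      (by rw [hz₁, mul_assoc, pow_mul, h1, one_pow])]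
    refine Nat.mul_le_mul_left _ (Nat.le_of_dvd (Nat.gcd_pos_of_pos_right _ (pow_pos hp.pos _)) ?_)
    exact Nat.gcd_dvd_gcd_of_dvd_left _ (Nat.div_dvd_div hc hQ)
  · rw [hP₁, pow_mul _ (p ^ (x + 1)), hζ'.pow_eq_one, one_pow]
  · refine lt_of_le_of_lt (b := 0) (pTerm_le_of fun hu ⟨j, hj⟩ _ => ?_) ?_
    · have hu1 := h.pow_prime_pow_eq_one ht (by simpa using hr.pow _) hu hj
      have := (hζ'.pow_eq_one_iff_dvd _).1 hu1
      rw [Nat.pow_dvd_pow_iff_le_right hp.one_lt] at this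
      omega
    · obtain ⟨z₁, hz₁⟩ := hz
      rw [le_pTerm_of (E := per r' (ζ ^ P₁)) (by
        rw [hP₁, pow_mul _ (p ^ (x + 1)), hζ'.pow_eq_one, one_pow]) ⟨1, by simp [hr']⟩ (by simp)
        (by rw [hz₁, mul_assoc, pow_mul _ (p ^ (x + 1)), hζ'.pow_eq_one, one_pow])]
      refine Nat.mul_pos (h.num'.per_pos ?_) (Nat.gcd_pos_of_pos_right _ (pow_pos hp.pos _))
      rw [hP₁, pow_mul _ (p ^ (x + 1)), hζ'.pow_eq_one, one_pow]

theorem per_of_primitive {ζ : K} (hζ : IsPrimitiveRoot ζ P) (hP : 0 < P) {r δ : ℕ}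
    (hδ : ∀ d, r ^ d ≡ 1 [MOD P] ↔ δ ∣ d) : per r ζ = δ := by
  refine eq_of_forall_iff_dvd fun d => ?_
  rw [per_dvd_iff, ← hδ]
  conv_lhs => rw [← pow_one ζ, ← pow_mul, one_mul]
  rw [pow_eq_pow_iff_modEq' (hζ.ne_zero hP.ne'), ← hζ.eq_orderOf]

theorem false_of_cyclic_eq (h : PairInv K p P Q r z P Q r' z') {x t k k' i δ : ℕ} (hx : 1 ≤ x)
    (ht : p.Coprime t) (hk : r' ≡ r ^ k [MOD P]) (hk' : r ≡ r' ^ k' [MOD P])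
    (hi : p ^ x * t + 1 ≡ r' ^ i [MOD P]) (hz : P.gcd z ∣ z')
    (hδ : ∀ d, r' ^ d ≡ 1 [MOD P] ↔ δ ∣ d)
    (hz1 : P ∣ z' * (p ^ x / (Q / δ).gcd (p ^ x)))
    (hz2 : ¬ P ∣ z * (p ^ x / (Q / δ).gcd (p ^ x))) : False := by
  have hp := h.prime
  have hP0 := h.num.m_pos
  obtain ⟨ζ, hζ⟩ := h.exists_root
  have hpow : ∀ {u : K}, u ^ P = 1 → ∀ j, u ^ r' ^ j = u ^ r ^ (k * j) := fun hu j => by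
    rw [pow_mul]; exact MetaNum.pow_eq_of_modEq hu (hk.pow j)
  have hpow' : ∀ {u : K}, u ^ P = 1 → ∀ j, u ^ r ^ j = u ^ r' ^ (k' * j) := fun hu j => by
    rw [pow_mul]; exact MetaNum.pow_eq_of_modEq hu (hk'.pow j)
  have hper : ∀ {u : K}, u ^ P = 1 → per r u = per r' u := fun {u} hu => by
    refine eq_of_forall_iff_dvd fun d => ⟨fun hd => ?_, fun hd => ?_⟩
    · rw [per_dvd_iff, hpow hu, ← per_dvd_iff]; exact hd.mul_left _
    · rw [per_dvd_iff, hpow' hu, ← per_dvd_iff]; exact hd.mul_left _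
  have hperζ := per_of_primitive hζ hP0 hδ
  refine h.not_pTerm_lt (t := t) hx ht (u := ζ) (fun c u hc hc' => ?_) hζ.pow_eq_one ?_
  · refine pTerm_le_of fun hu ⟨j, hj⟩ h3 => ?_
    rw [hper hu] at h3 ⊢
    refine (le_pTerm_of hu ⟨k' * j, ?_⟩ rfl ?_).ge
    · rw [hj, hpow' hu]; congr 2; ring
    · set e := p ^ x / (Q / (per r' u).lcm (p ^ c)).gcd (p ^ x)
      obtain ⟨z₁, hz₁⟩ := hz
      have h4 : u ^ (P.gcd z * e) = 1 := by
        rw [← Nat.gcd_mul_right, ← pow_eq_one_and_iff]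
        exact ⟨by rw [pow_mul, hu, one_pow], h3⟩
      rw [hz₁, mul_right_comm, pow_mul, h4, one_pow]
  · refine lt_of_le_of_lt (b := 0) (pTerm_le_of fun hu ⟨j, hj⟩ h3 => ?_) ?_
    · rw [hper hu, hperζ, pow_zero, Nat.lcm_one_right, hζ.pow_eq_one_iff_dvd] at h3
      exact absurd h3 hz2
    · rw [le_pTerm_of (E := δ) hζ.pow_eq_one ⟨i, by
        rw [pow_zero, one_mul]; exact MetaNum.pow_eq_of_modEq hζ.pow_eq_one hi⟩ (by simp [hperζ])
        ((hζ.pow_eq_one_iff_dvd _).2 hz1)]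
      refine Nat.mul_pos ?_ (Nat.gcd_pos_of_pos_right _ (pow_pos hp.pos _))
      rw [← hperζ]
      exact h.num'.per_pos hζ.pow_eq_one

end PairInv

theorem PairInv.false_of_half {K : Type*} [Field K] {P₂ Q r z r' z' t : ℕ}
    (h : PairInv K 2 (2 * P₂) Q r z (2 * P₂) Q r' z') (hP₂ : Even P₂) (ht : Odd t)
    (hr' : r' = 2 * t + 1) (hrr' : r ≡ r' + P₂ [MOD 2 * P₂]) (hsq : r ^ 2 ≡ 1 [MOD 2 * P₂])
    (hsq' : r' ^ 2 ≡ 1 [MOD 2 * P₂]) (hz' : P₂ ∣ z')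
    (hz1 : 2 * P₂ ∣ z' * (2 / (Q / 2).gcd 2)) : False := by
  have hP0 := h.num.m_pos
  have hcop : Nat.Coprime 2 t := Nat.coprime_two_left.2 ht
  obtain ⟨ζ, hζ⟩ := h.exists_root
  have key : ∀ {u : K} {c : ℕ}, u ^ (2 * P₂) = 1 →
      (∃ j, u ^ (2 ^ 1 * t + 1) = u ^ r ^ (2 ^ c * j)) → u ^ P₂ = 1 := by
    rintro u c hu ⟨j, hj⟩
    have hu0 := ne_zero_of_pow_eq_one hP0 hu
    rcases Nat.even_or_odd' (2 ^ c * j) with ⟨i, hi | hi⟩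
    · have h1 : u ^ 2 ^ 1 = 1 := by
        refine h.pow_prime_pow_eq_one hcop (x := 1) (R := 1) Nat.ModEq.rfl hu ?_
        rw [hj, hi, pow_mul]
        exact MetaNum.pow_eq_of_modEq hu (by simpa using hsq.pow i)
      obtain ⟨i, rfl⟩ := hP₂
      rw [← two_mul, pow_mul, ← pow_one 2, h1, one_pow]
    · have h1 : u ^ r' = u ^ (r' + P₂) := by
        have h2 : r ^ (2 * i + 1) ≡ r' + P₂ [MOD 2 * P₂] := by
          rw [pow_succ, pow_mul]; simpa using (hsq.pow i).mul hrr'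
        rw [← MetaNum.pow_eq_of_modEq hu h2, ← hi, ← hj, hr', pow_one]
      rw [pow_add] at h1
      exact (mul_eq_left₀ (pow_ne_zero _ hu0)).1 h1.symm
  have hδ : ∀ d, r' ^ d ≡ 1 [MOD 2 * P₂] ↔ 2 ∣ d := by
    intro d
    rcases Nat.even_or_odd' d with ⟨i, rfl | rfl⟩
    · simpa [pow_mul] using hsq'.pow i
    · refine iff_of_false (fun H => ?_) (by omega)
      have h1 : r' ^ (2 * i + 1) ≡ r' [MOD 2 * P₂] := by
        rw [pow_succ, pow_mul]; simpa using (hsq'.pow i).mul_right r'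
      obtain ⟨s, rfl⟩ := hP₂
      have h2 : r' ≡ 1 [MOD 4] := (h1.symm.trans H).of_dvd ⟨s, by ring⟩
      obtain ⟨q, rfl⟩ := ht
      rw [hr', Nat.ModEq] at h2
      omega
  have hperζ := per_of_primitive hζ hP0 hδ
  refine h.not_pTerm_lt (t := t) le_rfl hcop (u := ζ) (fun c u hc hc' => ?_) hζ.pow_eq_one ?_
  · refine pTerm_le_of fun hu hj h3 => ?_
    have hu2 := key hu hj
    have hpow : ∀ j, u ^ r ^ j = u ^ r' ^ j := fun j => by
      refine MetaNum.pow_eq_of_modEq hu2 (Nat.ModEq.pow j ?_)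
      have := hrr'.of_dvd (Dvd.intro_left 2 rfl : P₂ ∣ 2 * P₂)
      simpa using this
    have hper : per r u = per r' u :=
      eq_of_forall_iff_dvd fun d => by rw [per_dvd_iff, per_dvd_iff, hpow]
    rw [hper] at h3 ⊢
    obtain ⟨j, hj⟩ := hj
    obtain ⟨z₁, rfl⟩ := hz'
    exact (le_pTerm_of hu ⟨j, by rw [hj, hpow]⟩ rfl
      (by rw [mul_assoc, pow_mul, hu2, one_pow])).ge
  · refine lt_of_le_of_lt (b := 0) (pTerm_le_of fun hu hj h3 => ?_) ?_
    · have := Nat.le_of_dvd (by omega) ((hζ.pow_eq_one_iff_dvd _).1 (key hu hj))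
      omega
    · rw [le_pTerm_of (E := 2) hζ.pow_eq_one ⟨1, by simp [hr']⟩ (by simp [hperζ])
        ((hζ.pow_eq_one_iff_dvd _).2 (by simpa using hz1))]
      exact Nat.mul_pos two_pos (Nat.gcd_pos_of_pos_right _ (by norm_num))

open Subgroup in
theorem cover_of_mem_closure {G : Type*} [Group G] {a b : G} {m n r z : ℕ} (hm : 0 < m) (hn : 0 < n)
    (ha : a ^ m = 1) (hc : b * a * b⁻¹ = a ^ r) (hb : b ^ n = a ^ z) {g : G}
    (hg : g ∈ closure {a, b}) : ∃ i j : ℕ, g = a ^ i * b ^ j := by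
  have hA : ∀ i j : ℕ, ∃ i' j' : ℕ, a * (a ^ i * b ^ j) = a ^ i' * b ^ j' := fun i j =>
    ⟨i + 1, j, by rw [← mul_assoc, ← pow_succ']⟩
  have hB : ∀ i j : ℕ, ∃ i' j' : ℕ, b * (a ^ i * b ^ j) = a ^ i' * b ^ j' := fun i j => by
    refine ⟨r * i, j + 1, ?_⟩
    have h1 : b * a ^ i * b⁻¹ = a ^ (r * i) := by rw [← conj_pow, hc, ← pow_mul]
    rw [← h1, pow_succ']
    group
  have hpow : ∀ (x : G) (k : ℕ), (∀ i j : ℕ, ∃ i' j' : ℕ, x * (a ^ i * b ^ j) = a ^ i' * b ^ j') →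
      ∀ i j : ℕ, ∃ i' j' : ℕ, x ^ k * (a ^ i * b ^ j) = a ^ i' * b ^ j' := by
    intro x k hx
    induction k with
    | zero => intro i j; exact ⟨i, j, by simp⟩
    | succ k ih =>
      intro i j
      obtain ⟨i₁, j₁, h₁⟩ := hx i j
      obtain ⟨i₂, j₂, h₂⟩ := ih i₁ j₁
      exact ⟨i₂, j₂, by rw [pow_succ, mul_assoc, h₁, h₂]⟩
  have hbm : b ^ (n * m) = 1 := by rw [pow_mul, hb, ← pow_mul, mul_comm, pow_mul, ha, one_pow]
  have hinv : ∀ (x : G) (k : ℕ), 0 < k → x ^ k = 1 → x⁻¹ = x ^ (k - 1) := fun x k hk hx => by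
    rw [inv_eq_iff_mul_eq_one, ← pow_succ', Nat.sub_add_cancel hk, hx]
  refine closure_induction_left (p := fun g _ => ∃ i j : ℕ, g = a ^ i * b ^ j) ⟨0, 0, by simp⟩
    ?_ ?_ hg
  · rintro x hx y - ⟨i, j, rfl⟩
    rcases hx with rfl | rfl
    · exact hA i j
    · exact hB i j
  · rintro x hx y - ⟨i, j, rfl⟩
    rcases hx with rfl | rfl
    · rw [hinv _ m hm ha]; exact hpow _ _ hA i j
    · rw [hinv _ _ (Nat.mul_pos hn hm) hbm]; exact hpow _ _ hB i j

namespace MetaData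

variable {G H : Type*} [Group G] [Group H] {m n r z m' n' r' z' : ℕ}

/-- Metacyclic data on the subgroup generated by two elements. -/
def ofClosure {a b : G} (hm : 0 < m) (hn : 0 < n) (ha : orderOf a = m) (hc : b * a * b⁻¹ = a ^ r)
    (hb : b ^ n = a ^ z) (hd : ∀ j : ℕ, b ^ j ∈ Subgroup.zpowers a → n ∣ j) :
    MetaData (Subgroup.closure {a, b}) m n r z where
  a := ⟨a, Subgroup.subset_closure (by simp)⟩
  b := ⟨b, Subgroup.subset_closure (by simp)⟩
  orderOf_a := by rwa [Subgroup.orderOf_mk]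
  n_pos := hn
  conj := Subtype.ext hc
  b_pow := Subtype.ext hb
  cover := by
    rintro ⟨g, hg⟩
    obtain ⟨i, j, h⟩ := cover_of_mem_closure hm hn (by rw [← ha, pow_orderOf_eq_one]) hc hb hg
    exact ⟨i, j, Subtype.ext h⟩
  dvd := fun j hj => by
    refine hd j ?_
    obtain ⟨k, hk⟩ := hj
    exact ⟨k, congrArg Subtype.val hk⟩

/-- Metacyclic data with prescribed relations on a group of the right order. -/
def ofCard {a b : G} (hm : 0 < m) (hn : 0 < n) (ha : a ^ m = 1) (hc : b * a * b⁻¹ = a ^ r)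
    (hb : b ^ n = a ^ z) (hgen : ∀ g, g ∈ Subgroup.closure {a, b}) (hcard : Nat.card G = m * n) :
    MetaData G m n r z := by
  have cover : ∀ g : G, ∃ i j : ℕ, g = a ^ i * b ^ j := fun g =>
    cover_of_mem_closure hm hn ha hc hb (hgen g)
  have : Finite G := Nat.finite_of_card_ne_zero (by rw [hcard]; positivity)
  have := Fintype.ofFinite G
  have hmod : ∀ i, a ^ (i % m) = a ^ i := fun i => by
    conv_rhs => rw [← Nat.mod_add_div i m, pow_add, pow_mul, ha, one_pow, mul_one]
  have hmodb : ∀ j, b ^ j = a ^ (z * (j / n)) * b ^ (j % n) := fun j => by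
    conv_lhs => rw [← Nat.div_add_mod j n, pow_add, pow_mul, hb, ← pow_mul]
  have hinj : Function.Injective fun x : Fin m × Fin n => a ^ (x.1 : ℕ) * b ^ (x.2 : ℕ) := by
    refine ((Fintype.bijective_iff_surjective_and_card _).2 ⟨fun g => ?_, ?_⟩).1
    · obtain ⟨i, j, rfl⟩ := cover g
      refine ⟨⟨⟨(i + z * (j / n)) % m, Nat.mod_lt _ hm⟩, ⟨j % n, Nat.mod_lt _ hn⟩⟩, ?_⟩
      simp only
      rw [hmod, pow_add, mul_assoc, ← hmodb]
    · rw [← Nat.card_eq_fintype_card (α := G), hcard]; simp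
  have hinj' : ∀ {i j i' j' : ℕ}, i < m → j < n → i' < m → j' < n →
      a ^ i * b ^ j = a ^ i' * b ^ j' → i = i' ∧ j = j' := fun {i j i' j'} hi hj hi' hj' h => by
    have := @hinj ⟨⟨i, hi⟩, ⟨j, hj⟩⟩ ⟨⟨i', hi'⟩, ⟨j', hj'⟩⟩ h
    simpa using this
  exact
    { a := a
      b := b
      orderOf_a := by
        refine (Nat.dvd_antisymm (orderOf_dvd_of_pow_eq_one ha)
          (Nat.dvd_of_mod_eq_zero ?_))
        refine (hinj' (Nat.mod_lt _ hm) hn hm hn (i' := 0) (j := 0) (j' := 0) ?_).1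
        rw [hmod, pow_orderOf_eq_one, pow_zero, pow_zero]
      n_pos := hn
      conj := hc
      b_pow := hb
      cover := cover
      dvd := fun j hj => by
        obtain ⟨k, hk⟩ := ((isOfFinOrder_of_finite a).mem_zpowers_iff_mem_range_orderOf
          (y := b ^ (j % n))).1 (by
            have : b ^ (j % n) = (a ^ (z * (j / n)))⁻¹ * b ^ j := by
              rw [hmodb j, inv_mul_cancel_left]
            rw [this]
            exact mul_mem (inv_mem (Subgroup.npow_mem_zpowers _ _)) hj) |> fun h => by
            simpa using h
        refine Nat.dvd_of_mod_eq_zero ?_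
        refine (hinj' (i := 0) (i' := k % m) (j' := 0) hm (Nat.mod_lt _ hn) (Nat.mod_lt _ hm)
          hn ?_).2
        rw [hmod, pow_zero, one_mul, pow_zero, mul_one]
        exact hk.2.symm }

/-- Change of generators. -/
def change (D : MetaData G m n r z) (hm : 0 < m) {a b : G} (hm' : 0 < m') (hn' : 0 < n')
    (ha : a ^ m' = 1) (hc : b * a * b⁻¹ = a ^ r') (hb : b ^ n' = a ^ z')
    (hDa : D.a ∈ Subgroup.closure {a, b}) (hDb : D.b ∈ Subgroup.closure {a, b})
    (hcard : m' * n' = m * n) : MetaData G m' n' r' z' :=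
  ofCard hm' hn' ha hc hb (fun g => by
    obtain ⟨i, j, rfl⟩ := D.cover g
    exact mul_mem (pow_mem hDa _) (pow_mem hDb _)) (by rw [D.card_eq hm, hcard])

/-- The exponents only matter modulo `m`. -/
def congr (D : MetaData G m n r z) (hr : r ≡ r' [MOD m]) (hz : z ≡ z' [MOD m]) :
    MetaData G m n r' z' where
  a := D.a
  b := D.b
  orderOf_a := D.orderOf_a
  n_pos := D.n_pos
  conj := by rw [D.conj, D.a_pow_eq_iff]; exact hr
  b_pow := by rw [D.b_pow, D.a_pow_eq_iff]; exact hz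
  cover := D.cover
  dvd := D.dvd

/-- Transport along an isomorphism. -/
def map (D : MetaData G m n r z) (e : G ≃* H) : MetaData H m n r z where
  a := e D.a
  b := e D.b
  orderOf_a := by rw [MulEquiv.orderOf_eq, D.orderOf_a]
  n_pos := D.n_pos
  conj := by rw [← map_inv, ← map_mul, ← map_mul, D.conj, map_pow]
  b_pow := by rw [← map_pow, D.b_pow, map_pow]
  cover := fun g => by
    obtain ⟨i, j, h⟩ := D.cover (e.symm g)
    exact ⟨i, j, by rw [← map_pow, ← map_pow, ← map_mul, ← h, e.apply_symm_apply]⟩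
  dvd := fun j ⟨k, hk⟩ => D.dvd j ⟨k, e.injective (by
    simp only at hk ⊢
    rw [map_zpow, hk, map_pow])⟩

theorem eq_imp_eq (D : MetaData G m n r z) (D' : MetaData H m n r z) {i j k l : ℕ}
    (h : D.a ^ i * D.b ^ j = D.a ^ k * D.b ^ l) :
    D'.a ^ i * D'.b ^ j = D'.a ^ k * D'.b ^ l := by
  wlog hjl : j ≤ l generalizing i j k l
  · exact (this h.symm (by omega)).symm
  obtain ⟨s, rfl⟩ := Nat.exists_eq_add_of_le' hjl
  rw [pow_add, ← mul_assoc] at h ⊢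
  have h1 := mul_right_cancel h
  have h2 : D.b ^ s ∈ Subgroup.zpowers D.a := by
    rw [← inv_mul_eq_iff_eq_mul.2 h1]
    exact mul_mem (inv_mem (Subgroup.npow_mem_zpowers _ _)) (Subgroup.npow_mem_zpowers _ _)
  obtain ⟨q, rfl⟩ := D.dvd s h2
  rw [pow_mul, D.b_pow, ← pow_mul, ← pow_add, D.a_pow_eq_iff] at h1
  rw [pow_mul, D'.b_pow, ← pow_mul, ← pow_add, D'.a_pow_eq_iff.2 h1]

theorem mul_formula (D : MetaData G m n r z) (i j k l : ℕ) :
    D.a ^ i * D.b ^ j * (D.a ^ k * D.b ^ l) = D.a ^ (i + k * r ^ j) * D.b ^ (j + l) := by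
  rw [pow_add, ← D.conj_pow, pow_add]
  group

/-- The homomorphism matching two sets of generators with the same relations. -/
def hom (D : MetaData G m n r z) (D' : MetaData H m n r z) : G →* H :=
  MonoidHom.mk' (fun g => D'.a ^ (D.cover g).choose * D'.b ^ (D.cover g).choose_spec.choose)
    fun g h => by
      rw [mul_formula]
      refine D.eq_imp_eq D' ?_
      rw [← (D.cover (g * h)).choose_spec.choose_spec, ← mul_formula,
        ← (D.cover g).choose_spec.choose_spec, ← (D.cover h).choose_spec.choose_spec]

theorem hom_apply (D : MetaData G m n r z) (D' : MetaData H m n r z) (i j : ℕ) :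
    D.hom D' (D.a ^ i * D.b ^ j) = D'.a ^ i * D'.b ^ j :=
  D.eq_imp_eq D' (D.cover (D.a ^ i * D.b ^ j)).choose_spec.choose_spec.symm

/-- Groups with the same metacyclic data are isomorphic. -/
def mulEquiv (D : MetaData G m n r z) (D' : MetaData H m n r z) : G ≃* H :=
  MulEquiv.ofBijective (D.hom D') (Function.bijective_iff_has_inverse.2 ⟨D'.hom D, fun g => by
    obtain ⟨i, j, rfl⟩ := D.cover g
    rw [hom_apply, hom_apply], fun g => by
    obtain ⟨i, j, rfl⟩ := D'.cover g
    rw [hom_apply, hom_apply]⟩)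

end MetaData

theorem IsMetacyclic.exists_metaData {G : Type*} [Group G] [Finite G] (h : IsMetacyclic G) :
    ∃ m n r z : ℕ, 0 < m ∧ 0 < z ∧ 1 < r ∧ Nonempty (MetaData G m n r z) := by
  obtain ⟨A, B, hA, hcA, hcB, hcov⟩ := h
  obtain ⟨⟨a, ha⟩, hag⟩ := hcA.exists_generator
  obtain ⟨⟨b, hb⟩, hbg⟩ := hcB.exists_generator
  have hA' : ∀ x ∈ A, ∃ i : ℕ, x = a ^ i := fun x hx => by
    obtain ⟨k, hk⟩ := (isOfFinOrder_of_finite _).mem_powers_iff_mem_zpowers.2 (hag ⟨x, hx⟩)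
    exact ⟨k, by simpa using (congrArg Subtype.val hk).symm⟩
  have hB' : ∀ x ∈ B, ∃ i : ℕ, x = b ^ i := fun x hx => by
    obtain ⟨k, hk⟩ := (isOfFinOrder_of_finite _).mem_powers_iff_mem_zpowers.2 (hbg ⟨x, hx⟩)
    exact ⟨k, by simpa using (congrArg Subtype.val hk).symm⟩
  have hAz : Subgroup.zpowers a = A := by
    refine le_antisymm (by simpa using ha) fun x hx => ?_
    obtain ⟨i, rfl⟩ := hA' x hx
    exact Subgroup.npow_mem_zpowers _ _
  obtain ⟨r, hr⟩ := hA' _ (hA.conj_mem a ha b)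
  set n := orderOf (b : G ⧸ A) with hn
  have hmem : ∀ j : ℕ, b ^ j ∈ A ↔ n ∣ j := fun j => by
    rw [← QuotientGroup.eq_one_iff, QuotientGroup.mk_pow, orderOf_dvd_iff_pow_eq_one]
  obtain ⟨z, hz⟩ := hA' _ ((hmem n).2 dvd_rfl)
  have hpos := orderOf_pos a
  refine ⟨orderOf a, n, r + 2 * orderOf a, z + orderOf a, hpos, by omega, by omega,
    ⟨MetaData.congr (r := r) (z := z)
      { a := a, b := b, orderOf_a := rfl, n_pos := orderOf_pos _, conj := hr, b_pow := hz,
        cover := fun g => ?_, dvd := fun j hj => (hmem j).1 (hAz ▸ hj) } ?_ ?_⟩⟩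
  · obtain ⟨x, hx, y, hy, rfl⟩ := hcov g
    obtain ⟨i, rfl⟩ := hA' x hx
    obtain ⟨j, rfl⟩ := hB' y hy
    exact ⟨i, j, rfl⟩
  · simp [Nat.ModEq]
  · simp [Nat.ModEq]

/-- Metacyclic data on a Sylow subgroup. -/
theorem MetaData.exists_sylow {G : Type*} [Group G] [Finite G] {p P Q m n r z : ℕ} [Fact p.Prime]
    (D : MetaData G (P * m) (Q * n) r z) (hm0 : 0 < P * m) (hP : ∃ i, P = p ^ i) (hQ : ∃ i, Q = p ^ i)
    (hm : p.Coprime m) (hn : p.Coprime n) {k : ℕ} (hk : m * n * k ≡ 1 [MOD P * Q])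
    (S : Sylow p G) : Nonempty (MetaData S P Q (r ^ (m * n * k)) z) := by
  have hp : p.Prime := Fact.out
  obtain ⟨i, rfl⟩ := hP
  obtain ⟨j, rfl⟩ := hQ
  have hcard := D.card_eq hm0
  have hn0 : 0 < n := Nat.pos_of_mul_pos_left D.n_pos
  have hm1 : 0 < m := Nat.pos_of_mul_pos_left hm0
  have hk1 : (p ^ i).Coprime (m * n * k) := by
    have h1 := (hk.of_dvd (Dvd.intro (p ^ j) rfl)).gcd_eq
    rwa [Nat.gcd_one_left, Nat.gcd_comm] at h1
  have hk2 : (p ^ j).Coprime (m * n * k) := by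
    have h1 := (hk.of_dvd (Dvd.intro_left (p ^ i) rfl)).gcd_eq
    rwa [Nat.gcd_one_left, Nat.gcd_comm] at h1
  have hord : orderOf (D.a ^ (m * k)) = p ^ i := by
    rw [orderOf_pow, D.orderOf_a, mul_comm (p ^ i), Nat.gcd_mul_left]
    have : (p ^ i).gcd k = 1 := Nat.Coprime.coprime_dvd_right (Dvd.intro_left _ rfl) hk1
    rw [this, mul_one, Nat.mul_div_cancel_left _ hm1]
  have D₀ : MetaData (Subgroup.closure {D.a ^ (m * k), D.b ^ (m * n * k)}) (p ^ i) (p ^ j)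
      (r ^ (m * n * k)) z := by
    refine MetaData.ofClosure (pow_pos hp.pos _) (pow_pos hp.pos _) hord ?_ ?_ ?_
    · rw [D.conj_pow, pow_mul]
    · rw [← pow_mul, show m * n * k * p ^ j = (p ^ j * n) * (m * k) by ring, pow_mul, D.b_pow,
        ← pow_mul, ← pow_mul, mul_comm z]
    · intro l hl
      rw [← pow_mul] at hl
      have h1 : D.b ^ (m * n * k * l) ∈ Subgroup.zpowers D.a :=
        (Subgroup.zpowers_le.2 (Subgroup.npow_mem_zpowers _ _)) hl
      exact hk2.dvd_of_dvd_mul_left ((Dvd.intro _ rfl).trans (D.dvd _ h1))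
  have hc : Nat.card (Subgroup.closure {D.a ^ (m * k), D.b ^ (m * n * k)}) =
      p ^ (Nat.card G).factorization p := by
    rw [D₀.card_eq (pow_pos hp.pos _), hcard, show p ^ i * m * (p ^ j * n) = p ^ (i + j) * (m * n) by
      ring, Nat.factorization_mul (pow_pos hp.pos _).ne' (Nat.mul_pos hm1 hn0).ne',
      Finsupp.add_apply, hp.factorization_pow, Finsupp.single_eq_same,
      Nat.factorization_eq_zero_of_not_dvd, add_zero, pow_add]
    rw [← hp.coprime_iff_not_dvd]
    exact hm.mul_right hn
  exact ⟨D₀.map ((Sylow.ofCard _ hc).equiv S)⟩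

/-- The integer `s` is congruent to `1` exactly modulo `p ^ ρ`, in the range where the powers of `s`
are controlled by their exponents. -/
structure UnitLevel (p ρ : ℕ) (s : ℤ) : Prop where
  prime : p.Prime
  pos : 1 ≤ ρ
  two : p = 2 → 2 ≤ ρ
  eq : ∃ t : ℤ, s = 1 + p ^ ρ * t ∧ ¬ (p : ℤ) ∣ t

namespace UnitLevel

variable {p ρ : ℕ} {s s' : ℤ}

theorem of_one_add {t : ℕ} (hp : p.Prime) (h1 : 1 ≤ ρ) (h2 : p = 2 → 2 ≤ ρ) (ht : ¬ p ∣ t) :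
    UnitLevel p ρ ((1 + p ^ ρ * t : ℕ) : ℤ) :=
  ⟨hp, h1, h2, t, by push_cast; rfl, by exact_mod_cast ht⟩

theorem pow_dvd_pow_sub_one (h : UnitLevel p ρ s) (c n : ℕ) :
    (p : ℤ) ^ c ∣ s ^ n - 1 ↔ (p : ℤ) ^ c ∣ (p : ℤ) ^ ρ * n := by
  have hp := h.prime
  obtain ⟨t, rfl, ht⟩ := h.eq
  have hpZ : Prime (p : ℤ) := Nat.prime_iff_prime_int.1 hp
  have hdvd : ∀ q : ℤ, q ∣ (p : ℤ) ^ ρ → q ∣ (1 + p ^ ρ * t) - 1 := fun q hq => by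
    rw [add_sub_cancel_left]; exact hq.mul_right t
  have hpd : (p : ℤ) ∣ (1 + p ^ ρ * t) - 1 := hdvd _ (dvd_pow_self _ (by have := h.pos; omega))
  have hnd : ¬ (p : ℤ) ∣ 1 + p ^ ρ * t := fun hd => by
    have := (Int.dvd_sub hd hpd)
    rw [sub_sub_cancel] at this
    exact hpZ.not_dvd_one this
  have hem : emultiplicity (p : ℤ) ((1 + p ^ ρ * t) ^ n - 1) =
      emultiplicity (p : ℤ) ((1 + p ^ ρ * t) - 1) + emultiplicity (p : ℤ) (n : ℤ) := by
    rcases hp.eq_two_or_odd' with rfl | hodd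
    · have h4 : (4 : ℤ) ∣ (1 + (2 : ℕ) ^ ρ * t) - 1 :=
        hdvd _ (by simpa using pow_dvd_pow (2 : ℤ) (h.two rfl))
      simpa using Int.two_pow_sub_pow' (y := 1) n h4 hnd
    · have := Int.emultiplicity_pow_sub_pow hp hodd (y := 1) hpd hnd n
      rw [one_pow] at this
      rw [this, Int.natCast_emultiplicity]
  rw [pow_dvd_iff_le_emultiplicity, pow_dvd_iff_le_emultiplicity, hem, add_sub_cancel_left,
    emultiplicity_mul hpZ, emultiplicity_mul hpZ, emultiplicity_eq_zero.2 ht, add_zero]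

theorem pow_dvd_geom_sum (h : UnitLevel p ρ s) (c n : ℕ) :
    (p : ℤ) ^ c ∣ ∑ i ∈ Finset.range n, s ^ i ↔ (p : ℤ) ^ c ∣ n := by
  have hp0 : (p : ℤ) ^ ρ ≠ 0 := pow_ne_zero _ (by exact_mod_cast h.prime.ne_zero)
  obtain ⟨t, hs, ht⟩ := h.eq
  have h1 := h.pow_dvd_pow_sub_one (ρ + c) n
  have h2 : s - 1 = p ^ ρ * t := by rw [hs]; ring
  rw [← geom_sum_mul, h2, pow_add, mul_left_comm, mul_dvd_mul_iff_left hp0,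
    mul_dvd_mul_iff_left hp0] at h1
  rw [← h1]
  have hpZ : Prime (p : ℤ) := Nat.prime_iff_prime_int.1 h.prime
  refine ⟨fun hd => hd.mul_right t, fun hd => ?_⟩
  exact (((Prime.coprime_iff_not_dvd hpZ).2 ht).pow_left).dvd_of_dvd_mul_right hd

theorem pow (h : UnitLevel p ρ s) (i : ℕ) : UnitLevel p (ρ + i) (s ^ p ^ i) := by
  refine ⟨h.prime, h.pos.trans (Nat.le_add_right _ _), fun h2 => (h.two h2).trans
    (Nat.le_add_right _ _), ?_⟩
  have hp0 : (p : ℤ) ≠ 0 := by exact_mod_cast h.prime.ne_zero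
  obtain ⟨w, hw⟩ := (h.pow_dvd_pow_sub_one (ρ + i) (p ^ i)).2 (by push_cast; rw [pow_add])
  refine ⟨w, by rw [← hw]; ring, fun ⟨v, hv⟩ => ?_⟩
  have h1 := (h.pow_dvd_pow_sub_one (ρ + i + 1) (p ^ i)).1 ⟨v, by rw [hw, hv]; ring⟩
  push_cast at h1
  rw [← pow_add, pow_dvd_pow_iff hp0 (Int.isUnit_iff.not.2 ?_)] at h1
  · omega
  · have := h.prime.two_le
    omega

theorem exists_pow_modEq (h : UnitLevel p ρ s) (h' : UnitLevel p ρ s') (μ : ℕ) :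
    ∃ k : ℕ, p.Coprime k ∧ s ^ k ≡ s' [ZMOD p ^ μ] := by
  have hp := h.prime
  have hpZ : Prime (p : ℤ) := Nat.prime_iff_prime_int.1 hp
  have hsol : ∀ u v : ℤ, ¬ (p : ℤ) ∣ u → ∃ j : ℕ, (p : ℤ) ∣ u * j - v := fun u v hu => by
    have hc : IsCoprime u (p : ℤ) := ((Prime.coprime_iff_not_dvd hpZ).2 hu).symm
    obtain ⟨a, b, hab⟩ := hc
    refine ⟨((a * v) % p).toNat, ?_⟩
    rw [Int.toNat_of_nonneg (Int.emod_nonneg _ hpZ.ne_zero), Int.emod_def]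
    exact ⟨-(b * v) - u * (a * v / p), by linear_combination v * hab⟩
  suffices H : ∀ i : ℕ, ∃ k : ℕ, p.Coprime k ∧ s ^ k ≡ s' [ZMOD p ^ (ρ + 1 + i)] by
    obtain ⟨k, hk, hk'⟩ := H μ
    exact ⟨k, hk, hk'.of_dvd (pow_dvd_pow _ (by omega))⟩
  intro i
  induction i with
  | zero =>
    obtain ⟨t, hs, ht⟩ := h.eq
    obtain ⟨t', hs', ht'⟩ := h'.eq
    obtain ⟨k, hk⟩ := hsol t t' ht
    refine ⟨k, (Nat.Prime.coprime_iff_not_dvd hp).2 fun hd => ht' ?_, ?_⟩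
    · have : (p : ℤ) ∣ t * k := (Int.natCast_dvd_natCast.2 hd).mul_left _
      exact (Int.dvd_iff_dvd_of_dvd_sub hk).1 this
    · have h1 : s ^ k ≡ 1 + k * (p ^ ρ * t) [ZMOD p ^ (ρ + 1)] := by
        have : ∀ n : ℕ, s ^ n ≡ 1 + n * (p ^ ρ * t) [ZMOD p ^ (ρ + 1)] := fun n => by
          induction n with
          | zero => simp
          | succ n ih =>
            rw [pow_succ s]
            refine (ih.mul_right s).trans ?_
            rw [hs]
            refine Int.modEq_iff_dvd.2 ⟨-(n * p ^ (ρ - 1) * t * t), ?_⟩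
            obtain ⟨q, rfl⟩ := Nat.exists_eq_add_of_le' h.pos
            simp only [Nat.add_sub_cancel]
            push_cast
            ring
        exact this k
      refine h1.trans (Int.modEq_iff_dvd.2 ?_)
      obtain ⟨w, hw⟩ := hk
      refine ⟨-w, ?_⟩
      rw [hs']
      linear_combination (-(p : ℤ) ^ ρ) * hw
  | succ i ih =>
    obtain ⟨k, hk, hk'⟩ := ih
    obtain ⟨d, hd, hd'⟩ := (h.pow (i + 1)).eq
    obtain ⟨c, hc⟩ := hk'.dvd
    obtain ⟨j, hj⟩ := hsol d c hd'
    refine ⟨k + p ^ (i + 1) * j, ?_, ?_⟩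
    · rw [pow_succ', mul_assoc]
      exact (Nat.coprime_add_mul_left_right _ _ _).2 hk
    · obtain ⟨w, hw⟩ := hj
      set q : ℤ := p ^ (ρ + 1 + i) with hq
      have hq1 : (p : ℤ) ^ (ρ + (i + 1)) = q := by rw [hq]; ring
      rw [hq1] at hd
      have hqp : (p : ℤ) ^ (ρ + 1 + (i + 1)) = q * p := by rw [hq]; ring
      have hpq : (p : ℤ) ∣ q := dvd_pow_self _ (by omega)
      obtain ⟨q', hq'⟩ := hpq
      have hpow : ∀ n : ℕ, ∃ y : ℤ, (s ^ p ^ (i + 1)) ^ n = 1 + q * d * n + q * p * y := fun n => by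
        induction n with
        | zero => exact ⟨0, by simp⟩
        | succ n ih =>
          obtain ⟨y, hy⟩ := ih
          rw [pow_succ, hy, hd]
          refine ⟨y * (1 + q * d) + q' * d * d * n, ?_⟩
          push_cast
          linear_combination (q * d * n * d) * hq'
      obtain ⟨y, hy⟩ := hpow j
      obtain ⟨x, hx⟩ : ∃ x : ℤ, s ^ k = 1 + p * x := by
        have h1 : (p : ℤ) ∣ s ^ k - 1 := by
          have := (h.pow_dvd_pow_sub_one 1 k).2
            (by rw [pow_one]; exact (dvd_pow_self _ (by have := h.pos; omega)).mul_right _)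
          rwa [pow_one] at this
        obtain ⟨x, hx⟩ := h1
        exact ⟨x, by rw [← hx]; ring⟩
      rw [hqp, pow_add, pow_mul, hy]
      refine Int.modEq_iff_dvd.2 ⟨-w - x * d * j - s ^ k * y, ?_⟩
      linear_combination hc - q * hw - q * d * j * hx

end UnitLevel

/-- The pairs `(r, z)` and `(r', z')` arise from one another by replacing the generators of a
metacyclic `p`-group by powers. -/
structure Twist (p P r z r' z' : ℕ) : Prop where
  pow : ∃ k : ℕ, p.Coprime k ∧ r' ≡ r ^ k [MOD P]
  pow' : ∃ k : ℕ, r ≡ r' ^ k [MOD P]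
  gcd : P.gcd z = P.gcd z'

namespace Twist

variable {p P r z r' z' : ℕ}

theorem dvd_mul_iff (h : Twist p P r z r' z') {q : ℕ} (hq : q ∣ P) (e : ℕ) :
    q ∣ z * e ↔ q ∣ z' * e := by
  have key : ∀ w, q ∣ w * e ↔ q ∣ P.gcd w * e := fun w => by
    rw [← Nat.gcd_mul_right, Nat.dvd_gcd_iff, iff_and_self]
    exact fun _ => hq.mul_right e
  rw [key z, key z', h.gcd]

theorem pow_modEq_one_iff (h : Twist p P r z r' z') {q : ℕ} (hq : q ∣ P) (d : ℕ) :
    r ^ d ≡ 1 [MOD q] ↔ r' ^ d ≡ 1 [MOD q] := by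
  obtain ⟨k, -, hk⟩ := h.pow
  obtain ⟨k', hk'⟩ := h.pow'
  refine ⟨fun H => ?_, fun H => ?_⟩
  · refine ((hk.of_dvd hq).pow d).trans ?_
    rw [← pow_mul, mul_comm, pow_mul]
    simpa using H.pow k
  · refine ((hk'.of_dvd hq).pow d).trans ?_
    rw [← pow_mul, mul_comm, pow_mul]
    simpa using H.pow k'

theorem dvd_sub_iff (h : Twist p P r z r' z') (hr : 0 < r) (hr' : 0 < r') {q : ℕ} (hq : q ∣ P)
    (d : ℕ) : q ∣ r ^ d - 1 ↔ q ∣ r' ^ d - 1 := by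
  rw [← Nat.modEq_iff_dvd' (Nat.one_le_pow _ _ hr), ← Nat.modEq_iff_dvd' (Nat.one_le_pow _ _ hr')]
  exact Nat.ModEq.comm.trans ((h.pow_modEq_one_iff hq d).trans Nat.ModEq.comm)

theorem metaNum {Q : ℕ} (h : Twist p P r z r' z') (hM : MetaNum P Q r z) (hr : 0 < r)
    (hr' : 0 < r') : MetaNum P Q r' z' where
  m_pos := hM.m_pos
  n_pos := hM.n_pos
  r_pow := (h.pow_modEq_one_iff dvd_rfl Q).1 hM.r_pow
  z_mul := by
    have key : ∀ w s, 0 < s → (w * s ≡ w [MOD P] ↔ P ∣ w * (s - 1)) := fun w s hs => by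
      rw [Nat.ModEq.comm, Nat.modEq_iff_dvd' (Nat.le_mul_of_pos_right _ hs), Nat.mul_sub_one]
    rw [key _ _ hr']
    have h1 := (key _ _ hr).1 hM.z_mul
    rw [h.dvd_mul_iff dvd_rfl] at h1
    have h3 : P ∣ P.gcd z' * (r - 1) := by
      rw [← Nat.gcd_mul_right]
      exact Nat.dvd_gcd (Dvd.intro _ rfl) h1
    have h4 : P ∣ P.gcd z' * (r' - 1) := by
      obtain ⟨P₁, hP₁⟩ := Nat.gcd_dvd_left P z'
      have hg : 0 < P.gcd z' := Nat.gcd_pos_of_pos_left _ hM.m_pos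
      have h5 : P₁ ∣ r - 1 := by
        refine Nat.dvd_of_mul_dvd_mul_left hg ?_
        rwa [← hP₁]
      have h6 := (h.dvd_sub_iff hr hr' (hP₁ ▸ Dvd.intro_left _ rfl : P₁ ∣ P) 1).1 (by rwa [pow_one])
      rw [pow_one] at h6
      conv_lhs => rw [hP₁]
      exact Nat.mul_dvd_mul_left _ h6
    exact h4.trans (mul_dvd_mul_right (Nat.gcd_dvd_right _ _) _)

theorem vNum_eq {Q : ℕ} (h : Twist p P r z r' z') (hr : 0 < r) (hr' : 0 < r') (x : ℕ) :
    vNum p P Q r z x = vNum p P Q r' z' x := by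
  rw [vNum, vNum]
  congr 1
  refine eq_of_forall_dvd_iff fun q => ?_
  simp only [Nat.dvd_gcd_iff]
  refine and_congr_right fun hq => ?_
  rw [h.dvd_mul_iff hq]
  have := h.dvd_sub_iff hr hr' hq 1
  rw [pow_one, pow_one] at this
  rw [this]

theorem pTerm_eq {K : Type*} [Field K] {Q : ℕ} (h : Twist p P r z r' z') (t x c : ℕ) (u : K) :
    pTerm p P Q r z t x c u = pTerm p P Q r' z' t x c u := by
  rw [pTerm, pTerm]
  by_cases hu : u ^ P = 1
  swap
  · rw [if_neg (fun H => hu H.1), if_neg (fun H => hu H.1)]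
  obtain ⟨k, -, hk⟩ := h.pow
  obtain ⟨k', hk'⟩ := h.pow'
  have hpow : ∀ j, u ^ r' ^ j = u ^ r ^ (k * j) := fun j => by
    rw [pow_mul]; exact MetaNum.pow_eq_of_modEq hu (hk.pow j)
  have hpow' : ∀ j, u ^ r ^ j = u ^ r' ^ (k' * j) := fun j => by
    rw [pow_mul]; exact MetaNum.pow_eq_of_modEq hu (hk'.pow j)
  have hper : per r u = per r' u := by
    refine eq_of_forall_iff_dvd fun d => ⟨fun hd => ?_, fun hd => ?_⟩
    · rw [per_dvd_iff, hpow, ← per_dvd_iff]; exact hd.mul_left _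
    · rw [per_dvd_iff, hpow', ← per_dvd_iff]; exact hd.mul_left _
  rw [hper]
  have hz : ∀ e, u ^ (z * e) = 1 ↔ u ^ (z' * e) = 1 := fun e => by
    rw [← orderOf_dvd_iff_pow_eq_one, ← orderOf_dvd_iff_pow_eq_one,
      h.dvd_mul_iff (orderOf_dvd_of_pow_eq_one hu)]
  have hj : (∃ j, u ^ t = u ^ r ^ (p ^ c * j)) ↔ ∃ j, u ^ t = u ^ r' ^ (p ^ c * j) := by
    refine ⟨fun ⟨j, hj⟩ => ⟨k' * j, ?_⟩, fun ⟨j, hj⟩ => ⟨k * j, ?_⟩⟩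
    · rw [hj, hpow', mul_left_comm]
    · rw [hj, hpow, mul_left_comm]
  rw [hz, hj]

theorem pairInv {K : Type*} [Field K] {Q P₁ Q₁ r₁ z₁ : ℕ} (h : Twist p P r z r' z')
    (hI : PairInv K p P Q r z P₁ Q₁ r₁ z₁) (hr' : 0 < r') : PairInv K p P Q r' z' P₁ Q₁ r₁ z₁ where
  prime := hI.prime
  num := h.metaNum hI.num hI.r_pos hr'
  num' := hI.num'
  P_pow := hI.P_pow
  Q_pow := hI.Q_pow
  P'_pow := hI.P'_pow
  Q'_pow := hI.Q'_pow
  r_pos := hr'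
  r'_pos := hI.r'_pos
  root := hI.root
  card := hI.card
  gcd_eq d := by
    rw [← hI.gcd_eq d]
    congr 1
    refine eq_of_forall_dvd_iff fun q => ?_
    simp only [Nat.dvd_gcd_iff]
    exact and_congr_right fun hq => (h.dvd_sub_iff hI.r_pos hr' hq d).symm
  vNum_eq x hx := by rw [← hI.vNum_eq x hx, h.vNum_eq hI.r_pos hr']
  sum_eq := by
    obtain ⟨k, w, h1, h2, h3, h4⟩ := hI.sum_eq
    refine ⟨k, w, h1, h2, h3, fun t x hx ht => ?_⟩
    rw [← h4 t x hx ht]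
    simp only [pSum, h.pTerm_eq]

theorem exists_coprime_mul_modEq (h : Twist p P r z r' z') (hp : p.Prime) (hP : ∃ i, P = p ^ i)
    {k : ℕ} (hk : p.Coprime k) : ∃ l, p.Coprime l ∧ l * z' ≡ k * z [MOD P] := by
  obtain ⟨i, hi⟩ := hP
  have hP0 : 0 < P := hi ▸ pow_pos hp.pos i
  have hg : 0 < P.gcd z := Nat.gcd_pos_of_pos_left _ hP0
  obtain ⟨P₁, hP₁⟩ := Nat.gcd_dvd_left P z
  obtain ⟨w, hw⟩ := Nat.gcd_dvd_right P z
  obtain ⟨w', hw'⟩ := Nat.gcd_dvd_right P z'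
  rw [← h.gcd] at hw'
  have hco : P₁.Coprime w := by
    have := Nat.coprime_div_gcd_div_gcd hg
    rwa [Nat.div_eq_of_eq_mul_right hg hP₁, Nat.div_eq_of_eq_mul_right hg hw] at this
  have hco' : P₁.Coprime w' := by
    have hg' := hg
    rw [h.gcd] at hg'
    have := Nat.coprime_div_gcd_div_gcd hg'
    rw [← h.gcd] at this
    rwa [Nat.div_eq_of_eq_mul_right hg hP₁, Nat.div_eq_of_eq_mul_right hg hw'] at this
  suffices H : ∃ l, p.Coprime l ∧ l * w' ≡ k * w [MOD P₁] by
    obtain ⟨l, hl, hl'⟩ := H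
    refine ⟨l, hl, ?_⟩
    have := hl'.mul_left' (P.gcd z)
    rw [← hP₁] at this
    convert this using 1
    · rw [hw']; conv_lhs => rw [← hw']
      ring_nf
      rw [hw']
      ring
    · conv_lhs => rw [hw]
      ring
  rcases (Nat.dvd_prime_pow hp).1 (hi ▸ Dvd.intro_left _ hP₁.symm : P₁ ∣ p ^ i) with ⟨j, -, hj⟩
  rcases Nat.eq_zero_or_pos j with rfl | hj0
  · exact ⟨1, Nat.coprime_one_right _, by rw [hj, pow_zero]; exact Nat.modEq_one⟩
  · obtain ⟨v, hv⟩ : ∃ v, w' * v ≡ 1 [MOD P₁] := by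
      rcases Nat.exists_mul_mod_eq_one_of_coprime hco'.symm (by
        rw [hj]; exact Nat.one_lt_pow hj0.ne' hp.one_lt) with ⟨v, hv⟩
      exact ⟨v, by rw [Nat.ModEq, hv.2]; exact (Nat.mod_eq_of_lt (by
        rw [hj]; exact Nat.one_lt_pow hj0.ne' hp.one_lt)).symm⟩
    have hm : k * w * v * w' ≡ k * w [MOD P₁] := by
      have := hv.mul_left (k * w)
      rw [mul_one] at this
      convert this using 1
      ring
    refine ⟨k * w * v, ?_, hm⟩
    have hpP : p ∣ P₁ := hj ▸ dvd_pow_self p hj0.ne'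
    refine (hk.mul_right (hco.coprime_dvd_left hpP)).mul_right ?_
    have h1 := (hv.of_dvd hpP).gcd_eq
    rw [Nat.gcd_one_left, Nat.gcd_comm] at h1
    exact Nat.Coprime.coprime_dvd_right (Dvd.intro_left _ rfl) h1

theorem metaData {G : Type*} [Group G] {Q : ℕ} (h : Twist p P r z r' z') (hp : p.Prime)
    (hP : ∃ i, P = p ^ i) (hQ : ∃ i, Q = p ^ i) (D : MetaData G P Q r z) :
    Nonempty (MetaData G P Q r' z') := by
  have hP0 : 0 < P := by obtain ⟨i, rfl⟩ := hP; exact pow_pos hp.pos i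
  obtain ⟨k, hk, hk'⟩ := h.pow
  obtain ⟨l, hl, hl'⟩ := h.exists_coprime_mul_modEq hp hP hk
  have hbord : D.b ^ (Q * P) = 1 := by
    rw [pow_mul, D.b_pow, ← pow_mul, mul_comm, pow_mul, D.a_pow_m, one_pow]
  have hQP : ∃ i, Q * P = p ^ i := by
    obtain ⟨i, rfl⟩ := hP
    obtain ⟨j, rfl⟩ := hQ
    exact ⟨j + i, by rw [pow_add]⟩
  have hcl : ∀ (x : G) (N e : ℕ), x ^ N = 1 → (∃ i, N = p ^ i) → p.Coprime e →
      ∃ j : ℕ, (x ^ e) ^ j = x := by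
    rintro x _ e hx ⟨i, rfl⟩ he
    exact exists_pow_eq_self_of_coprime
      ((he.symm.pow_right i).coprime_dvd_right (orderOf_dvd_of_pow_eq_one hx))
  refine ⟨D.change hP0 (a := D.a ^ l) (b := D.b ^ k) hP0 D.n_pos ?_ ?_ ?_ ?_ ?_ rfl⟩
  · rw [← pow_mul, mul_comm, pow_mul, D.a_pow_m, one_pow]
  · rw [D.conj_pow, ← pow_mul, D.a_pow_eq_iff]
    exact hk'.symm.mul_left l
  · rw [← pow_mul, mul_comm, pow_mul, D.b_pow, ← pow_mul, ← pow_mul, D.a_pow_eq_iff, mul_comm z]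
    exact hl'.symm
  · obtain ⟨j, hj⟩ := hcl D.a P l D.a_pow_m hP hl
    have := Subgroup.pow_mem _ (Subgroup.subset_closure (Set.mem_insert (D.a ^ l) {D.b ^ k})) j
    rwa [hj] at this
  · obtain ⟨j, hj⟩ := hcl D.b _ k hbord hQP hk
    have := Subgroup.pow_mem _ (Subgroup.subset_closure
      (Set.mem_insert_of_mem (D.a ^ l) (Set.mem_singleton (D.b ^ k)))) j
    rwa [hj] at this

end Twist

theorem Twist.of_modEq {p P r z r' z' : ℕ} (hr : r ≡ r' [MOD P]) (hz : P.gcd z = P.gcd z') :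
    Twist p P r z r' z' :=
  ⟨⟨1, Nat.coprime_one_right _, by simpa using hr.symm⟩, ⟨1, by simpa using hr⟩, hz⟩

theorem UnitLevel.twist {p ρ μ r z r' z' : ℕ} (h : UnitLevel p ρ r) (h' : UnitLevel p ρ r')
    (hz : (p ^ μ).gcd z = (p ^ μ).gcd z') : Twist p (p ^ μ) r z r' z' := by
  obtain ⟨k, hk, hk'⟩ := h.exists_pow_modEq h' μ
  obtain ⟨l, -, hl⟩ := h'.exists_pow_modEq h μ
  refine ⟨⟨k, hk, ?_⟩, ⟨l, ?_⟩, hz⟩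
  · rw [← Int.natCast_modEq_iff]; exact_mod_cast hk'.symm
  · rw [← Int.natCast_modEq_iff]; exact_mod_cast hl.symm

theorem UnitLevel.neg_twist {p ρ μ r z r' z' : ℕ} (h2 : p = 2) (h : UnitLevel p ρ (-(r : ℤ)))
    (h' : UnitLevel p ρ (-(r' : ℤ)))
    (hz : (p ^ μ).gcd z = (p ^ μ).gcd z') : Twist p (p ^ μ) r z r' z' := by
  obtain ⟨k, hk, hk'⟩ := h.exists_pow_modEq h' μ
  obtain ⟨l, hl, hl'⟩ := h'.exists_pow_modEq h μ
  subst h2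
  rw [Nat.coprime_two_left] at hk hl
  rw [hk.neg_pow] at hk'
  rw [hl.neg_pow] at hl'
  refine ⟨⟨k, Nat.coprime_two_left.2 hk, ?_⟩, ⟨l, ?_⟩, hz⟩
  · rw [← Int.natCast_modEq_iff]; simpa using hk'.symm.neg
  · rw [← Int.natCast_modEq_iff]; simpa using hl'.symm.neg

theorem UnitLevel.one_add {p ρ : ℕ} (hp : p.Prime) (h1 : 1 ≤ ρ) (h2 : p = 2 → 2 ≤ ρ) :
    UnitLevel p ρ ((1 + p ^ ρ : ℕ) : ℤ) := by
  simpa using UnitLevel.of_one_add (t := 1) hp h1 h2 hp.not_dvd_one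

theorem UnitLevel.pow_modEq_one_iff {p ρ r : ℕ} (h : UnitLevel p ρ r) (μ d : ℕ) :
    r ^ d ≡ 1 [MOD p ^ μ] ↔ p ^ μ ∣ p ^ ρ * d := by
  have := h.pow_dvd_pow_sub_one μ d
  rw [← Int.modEq_iff_dvd] at this
  rw [Nat.ModEq.comm, ← Int.natCast_modEq_iff, ← Int.natCast_dvd_natCast]
  exact_mod_cast this

theorem UnitLevel.pow_dvd_geom_sum_nat {p ρ r : ℕ} (h : UnitLevel p ρ r) (c n : ℕ) :
    p ^ c ∣ ∑ i ∈ Finset.range n, r ^ i ↔ p ^ c ∣ n := by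
  have := h.pow_dvd_geom_sum c n
  exact_mod_cast this

theorem gcd_prime_pow {p : ℕ} (a b : ℕ) : (p ^ a).gcd (p ^ b) = p ^ min a b := by
  rcases le_total a b with h | h
  · rw [min_eq_left h, Nat.gcd_eq_left (pow_dvd_pow p h)]
  · rw [min_eq_right h, Nat.gcd_eq_right (pow_dvd_pow p h)]

/-- The exponents of a metacyclic `p`-group with `b * a * b⁻¹ = a ^ (1 + p ^ ρ)` and
`b ^ p ^ ν = a ^ p ^ σ`. -/
structure OrdForm (p μ ν ρ σ : ℕ) : Prop where
  prime : p.Prime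
  one_le : 1 ≤ ρ
  two_le : p = 2 → 2 ≤ ρ
  sig_le : σ ≤ μ
  le_add_nu : μ ≤ ρ + ν
  le_add_sig : μ ≤ ρ + σ

theorem OrdForm.unitLevel {p μ ν ρ σ : ℕ} (h : OrdForm p μ ν ρ σ) :
    UnitLevel p ρ ((1 + p ^ ρ : ℕ) : ℤ) := UnitLevel.one_add h.prime h.one_le h.two_le

theorem MetaNum.exists_ordForm {p μ ν r z : ℕ} (hp : p.Prime) (hr : 0 < r)
    (h : MetaNum (p ^ μ) (p ^ ν) r z)
    (ho : p ^ μ ∣ r - 1 ∨ p ∣ r - 1 ∧ (p = 2 → 4 ∣ r - 1)) :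
    ∃ ρ σ, OrdForm p μ ν ρ σ ∧ Twist p (p ^ μ) r z (1 + p ^ ρ) (p ^ σ) := by
  obtain ⟨σ, hσ, hgcd⟩ := (Nat.dvd_prime_pow hp).1 (Nat.gcd_dvd_left (p ^ μ) z)
  have hz : (p ^ μ).gcd z = (p ^ μ).gcd (p ^ σ) := by rw [gcd_prime_pow, min_eq_right hσ, hgcd]
  by_cases h1 : p ^ μ ∣ r - 1
  · refine ⟨μ + 2, σ, ⟨hp, by omega, by omega, hσ, by omega, by omega⟩, Twist.of_modEq ?_ hz⟩
    have h2 := ((Nat.modEq_iff_dvd' hr).2 h1).symm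
    refine h2.trans ((Nat.modEq_iff_dvd' (by omega)).2 ?_)
    rw [Nat.add_sub_cancel_left]
    exact pow_dvd_pow p (by omega)
  · have h2 := ho.resolve_left h1
    have hr1 : r - 1 ≠ 0 := fun h0 => h1 (h0 ▸ dvd_zero _)
    obtain ⟨ρ, t, ht, hρ⟩ := Nat.exists_eq_pow_mul_and_not_dvd hr1 p hp.ne_one
    have hr' : r = 1 + p ^ ρ * t := by omega
    have hp1 : 1 ≤ ρ := by
      rcases Nat.eq_zero_or_pos ρ with rfl | h3
      · exact absurd h2.1 (by rw [hρ]; simpa using ht)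
      · exact h3
    have hp2 : p = 2 → 2 ≤ ρ := fun h3 => by
      by_contra h4
      have h5 : ρ = 1 := by omega
      have h6 := h2.2 h3
      rw [hρ, h5, h3, pow_one, show 4 = 2 * 2 from rfl] at h6
      exact ht (h3 ▸ Nat.dvd_of_mul_dvd_mul_left two_pos h6)
    have hT : Twist p (p ^ μ) r z (1 + p ^ ρ) (p ^ σ) := by
      refine UnitLevel.twist (ρ := ρ) ?_ (UnitLevel.one_add hp hp1 hp2) hz
      rw [hr']
      exact UnitLevel.of_one_add hp hp1 hp2 ht
    have hM := hT.metaNum h hr (by omega)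
    refine ⟨ρ, σ, ⟨hp, hp1, hp2, hσ, ?_, ?_⟩, hT⟩
    · have h3 := ((UnitLevel.one_add hp hp1 hp2).pow_modEq_one_iff μ _).1 hM.r_pow
      rwa [← pow_add, Nat.pow_dvd_pow_iff_le_right hp.one_lt] at h3
    · have h3 := hM.z_mul.symm
      rw [mul_add, mul_one, Nat.modEq_iff_dvd' (Nat.le_add_right _ _), Nat.add_sub_cancel_left,
        ← pow_add, Nat.pow_dvd_pow_iff_le_right hp.one_lt] at h3
      omega

namespace MetaData

variable {G : Type*} [Group G] {m n r z : ℕ}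

theorem mul_b_pow (D : MetaData G m n r z) (x j : ℕ) :
    (D.a ^ x * D.b) ^ j = D.a ^ (x * ∑ i ∈ Finset.range j, r ^ i) * D.b ^ j := by
  induction j with
  | zero => simp
  | succ j ih =>
    have := D.mul_formula x 1 (x * ∑ i ∈ Finset.range j, r ^ i) j
    rw [pow_one, pow_one] at this
    rw [pow_succ', ih, this, geom_sum_succ, add_comm 1 j]
    congr 2
    ring

/-- Replacing `b` by `a ^ x * b`. -/
def shift (D : MetaData G m n r z) (hm : 0 < m) (x : ℕ) {z' : ℕ}
    (hz : x * ∑ i ∈ Finset.range n, r ^ i + z ≡ z' [MOD m]) : MetaData G m n r z' :=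
  D.change hm (a := D.a) (b := D.a ^ x * D.b) hm D.n_pos D.a_pow_m
    (by
      calc D.a ^ x * D.b * D.a * (D.a ^ x * D.b)⁻¹
          = D.a ^ x * (D.b * D.a * D.b⁻¹) * (D.a ^ x)⁻¹ := by group
        _ = D.a ^ r := by rw [D.conj, ((Commute.refl D.a).pow_pow x r).eq, mul_inv_cancel_right])
    (by rw [D.mul_b_pow, D.b_pow, ← pow_add, D.a_pow_eq_iff]; exact hz)
    (Subgroup.subset_closure (Set.mem_insert _ _))
    (by
      have h1 := Subgroup.subset_closure (Set.mem_insert D.a {D.a ^ x * D.b})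
      have h2 := Subgroup.subset_closure
        (Set.mem_insert_of_mem D.a (Set.mem_singleton (D.a ^ x * D.b)))
      have h3 := mul_mem (inv_mem (Subgroup.pow_mem _ h1 x)) h2
      rwa [inv_mul_cancel_left] at h3) rfl

/-- Exchanging the roles of `a` and `b`. -/
def swap {p μ ν σ y : ℕ} (hp : 0 < p) (D : MetaData G (p ^ μ) (p ^ ν) r (p ^ σ)) (hσ : σ ≤ μ)
    (hr : r ≡ 1 + p ^ σ * y [MOD p ^ μ]) :
    MetaData G (p ^ (ν + μ - σ)) (p ^ σ) (1 + p ^ ν * y * (p ^ (ν + μ - σ) - 1)) (p ^ ν) :=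
  D.change (pow_pos hp _) (a := D.b) (b := D.a) (pow_pos hp _) (pow_pos hp _)
    (by
      rw [show ν + μ - σ = ν + (μ - σ) by omega, pow_add, pow_mul, D.b_pow, ← pow_mul, ← pow_add,
        show σ + (μ - σ) = μ by omega, D.a_pow_m])
    (by
      have hM : D.b ^ p ^ (ν + μ - σ) = 1 := by
        rw [show ν + μ - σ = ν + (μ - σ) by omega, pow_add, pow_mul, D.b_pow, ← pow_mul,
          ← pow_add, show σ + (μ - σ) = μ by omega, D.a_pow_m]
      have hc : D.a ^ (p ^ σ * y) = D.b ^ (p ^ ν * y) := by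
        rw [pow_mul, ← D.b_pow, ← pow_mul]
      have h1 : D.b * D.a * D.b⁻¹ = D.a * D.a ^ (p ^ σ * y) := by
        rw [D.conj, ← pow_succ', add_comm, D.a_pow_eq_iff]
        exact hr
      have h2 : D.a * D.b * D.a⁻¹ * D.b ^ (p ^ ν * y) = D.b := by
        calc D.a * D.b * D.a⁻¹ * D.b ^ (p ^ ν * y)
            = D.a * D.b * (D.a⁻¹ * D.a ^ (p ^ σ * y)) := by rw [hc]; group
          _ = D.a * D.b * (D.a ^ (p ^ σ * y) * D.a⁻¹) := by
            rw [((Commute.refl D.a).inv_left.pow_right _).eq]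
          _ = D.a * (D.b * D.b ^ (p ^ ν * y)) * D.a⁻¹ := by rw [hc]; group
          _ = D.a * (D.b ^ (p ^ ν * y) * D.b) * D.a⁻¹ := by
            rw [((Commute.refl D.b).pow_right _).eq]
          _ = (D.a * D.a ^ (p ^ σ * y)) * D.b * D.a⁻¹ := by rw [hc]; group
          _ = D.b := by rw [← h1]; group
      have h3 : D.b ^ (p ^ ν * y) * D.b ^ (p ^ ν * y * (p ^ (ν + μ - σ) - 1)) = 1 := by
        rw [← pow_add, ← mul_one_add, add_comm, Nat.sub_add_cancel (Nat.one_le_pow _ _ hp),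
          mul_comm, pow_mul, hM, one_pow]
      calc D.a * D.b * D.a⁻¹ = D.a * D.b * D.a⁻¹ *
            (D.b ^ (p ^ ν * y) * D.b ^ (p ^ ν * y * (p ^ (ν + μ - σ) - 1))) := by rw [h3, mul_one]
        _ = D.b * D.b ^ (p ^ ν * y * (p ^ (ν + μ - σ) - 1)) := by rw [← mul_assoc, h2]
        _ = _ := by rw [pow_add, pow_one])
    D.b_pow.symm
    (Subgroup.subset_closure (Set.mem_insert_of_mem _ (Set.mem_singleton _)))
    (Subgroup.subset_closure (Set.mem_insert _ _))
    (by rw [← pow_add, ← pow_add]; congr 1; omega)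

end MetaData

namespace OrdForm

variable {G H : Type*} [Group G] [Group H] {p μ ν ρ σ μ' ν' ρ' σ' : ℕ}

theorem split (h : OrdForm p μ ν ρ σ) (D : MetaData G (p ^ μ) (p ^ ν) (1 + p ^ ρ) (p ^ σ))
    (hνσ : ν ≤ σ) : Nonempty (MetaData G (p ^ μ) (p ^ ν) (1 + p ^ ρ) 0) := by
  have hp := h.prime
  set U := ∑ i ∈ Finset.range (p ^ ν), (1 + p ^ ρ) ^ i with hU
  have hU0 : 0 < U := Finset.sum_pos (fun i _ => by positivity) ⟨0, by simp [hp.pos]⟩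
  obtain ⟨u, hu⟩ := (h.unitLevel.pow_dvd_geom_sum_nat ν (p ^ ν)).2 dvd_rfl
  rw [← hU] at hu
  have hpu : p.Coprime u := by
    rw [hp.coprime_iff_not_dvd]
    rintro ⟨v, rfl⟩
    have h1 := (h.unitLevel.pow_dvd_geom_sum_nat (ν + 1) (p ^ ν)).1
      (by rw [← hU, hu]; exact ⟨v, by ring⟩)
    rw [Nat.pow_dvd_pow_iff_le_right hp.one_lt] at h1
    omega
  obtain ⟨w, hw⟩ : ∃ w, p ^ μ ∣ u * w + 1 := by
    obtain ⟨w, -, hw⟩ := Nat.exists_mul_mod_eq_of_coprime (p ^ μ - 1) (hpu.pow_left μ).symm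
      (pow_pos hp.pos μ).ne'
    refine ⟨w, (Nat.modEq_zero_iff_dvd).1 ((Nat.ModEq.add_right 1 hw).trans ?_)⟩
    rw [Nat.sub_add_cancel (Nat.one_le_pow _ _ hp.pos), Nat.modEq_zero_iff_dvd]
  refine ⟨D.shift (pow_pos hp.pos _) (p ^ (σ - ν) * w) ?_⟩
  rw [Nat.modEq_zero_iff_dvd, ← hU, hu]
  have : p ^ (σ - ν) * w * (p ^ ν * u) + p ^ σ = p ^ σ * (u * w + 1) := by
    conv_lhs => rw [show σ = σ - ν + ν by omega]
    conv_rhs => rw [show σ = σ - ν + ν by omega]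
    rw [Nat.add_sub_cancel]
    ring
  rw [this]
  exact hw.mul_left _

end OrdForm

theorem one_add_pow_modEq {p a b M : ℕ} (h : min a M = min b M) :
    1 + p ^ a ≡ 1 + p ^ b [MOD p ^ M] := by
  refine Nat.ModEq.add_left 1 ?_
  rcases le_or_gt M a with h1 | h1
  · have h2 : M ≤ b := by omega
    exact ((Nat.modEq_zero_iff_dvd).2 (pow_dvd_pow p h1)).trans
      ((Nat.modEq_zero_iff_dvd).2 (pow_dvd_pow p h2)).symm
  · rw [show a = b by omega]

namespace OrdForm

variable {G H : Type*} [Group G] [Group H] {p μ ν ρ σ μ' ν' ρ' σ' : ℕ}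

theorem split_of_min_le (h : OrdForm p μ ν ρ σ)
    (D : MetaData G (p ^ μ) (p ^ ν) (1 + p ^ ρ) (p ^ σ)) (hρ : min ν σ ≤ ρ) :
    Nonempty (MetaData G (p ^ (μ + ν - min ν σ)) (p ^ min ν σ)
      (1 + p ^ (μ + ν - min ν σ - (μ - ρ))) 0) := by
  have hp := h.prime
  rcases le_or_gt ν σ with hνσ | hνσ
  · obtain ⟨D₁⟩ := h.split D hνσ
    rw [min_eq_left hνσ, Nat.add_sub_cancel]
    exact ⟨D₁.congr (one_add_pow_modEq (by omega)) rfl⟩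
  · rw [min_eq_right hνσ.le] at hρ ⊢
    have h1 := h.sig_le
    have h2 := h.le_add_nu
    have h3 := h.le_add_sig
    have h4 := h.two_le
    have h5 := h.one_le
    have D₁ := D.swap hp.pos h1 (y := p ^ (ρ - σ))
      (by rw [← pow_add, Nat.add_sub_cancel' hρ])
    have hO : OrdForm p (ν + μ - σ) σ (ν + ρ - σ) ν :=
      ⟨hp, by omega, fun h => by have := h4 h; omega, by omega, by omega, by omega⟩
    have hU : UnitLevel p (ν + ρ - σ)
        ((1 + p ^ ν * p ^ (ρ - σ) * (p ^ (ν + μ - σ) - 1) : ℕ) : ℤ) := by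
      rw [← pow_add, show ν + (ρ - σ) = ν + ρ - σ by omega]
      refine UnitLevel.of_one_add hp hO.one_le hO.two_le fun hd => hp.not_dvd_one ?_
      have h6 : p ∣ p ^ (ν + μ - σ) := dvd_pow_self p (by omega)
      have h7 := Nat.dvd_sub h6 hd
      rwa [Nat.sub_sub_self (Nat.one_le_pow _ _ hp.pos)] at h7
    obtain ⟨D₂⟩ := (UnitLevel.twist (μ := ν + μ - σ) hU hO.unitLevel rfl).metaData hp
      ⟨_, rfl⟩ ⟨_, rfl⟩ D₁
    obtain ⟨D₃⟩ := hO.split D₂ hνσ.le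
    rw [add_comm μ ν]
    exact ⟨D₃.congr (one_add_pow_modEq (by omega)) rfl⟩

theorem mulEquiv (h : OrdForm p μ ν ρ σ) (h' : OrdForm p μ' ν' ρ' σ')
    (D : MetaData G (p ^ μ) (p ^ ν) (1 + p ^ ρ) (p ^ σ))
    (D' : MetaData H (p ^ μ') (p ^ ν') (1 + p ^ ρ') (p ^ σ'))
    (hN : μ + ν = μ' + ν') (hκ : μ - ρ = μ' - ρ') (hf : min ν σ = min ν' σ')
    (he : min ρ (min ν σ) = min ρ' (min ν' σ')) : Nonempty (G ≃* H) := by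
  have h1 := h.sig_le
  have h1' := h'.sig_le
  rcases le_or_gt (min ν σ) ρ with hρ | hρ
  · obtain ⟨D₁⟩ := h.split_of_min_le D hρ
    obtain ⟨D₂⟩ := h'.split_of_min_le D' (by omega)
    rw [← hN, ← hκ, ← hf] at D₂
    exact ⟨D₁.mulEquiv D₂⟩
  · obtain rfl : ρ = ρ' := by omega
    obtain rfl : μ = μ' := by omega
    obtain rfl : ν = ν' := by omega
    rcases le_or_gt ν σ with hνσ | hνσ
    · obtain ⟨D₁⟩ := h.split D hνσ
      obtain ⟨D₂⟩ := h'.split D' (by omega)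
      exact ⟨D₁.mulEquiv D₂⟩
    · obtain rfl : σ = σ' := by omega
      exact ⟨D.mulEquiv D'⟩

end OrdForm

theorem UnitLevel.exists_nat {p ρ r : ℕ} (h : UnitLevel p ρ r) (hr : 0 < r) :
    ∃ t, p ^ ρ * t + 1 = r ∧ p.Coprime t := by
  obtain ⟨s, hs, hs'⟩ := h.eq
  have hp : (0 : ℤ) < p ^ ρ := by exact_mod_cast pow_pos h.prime.pos ρ
  have h0 : 0 ≤ s := by
    by_contra! h1
    have : (p : ℤ) ^ ρ * s < 0 := mul_neg_of_pos_of_neg hp h1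
    omega
  lift s to ℕ using h0
  exact ⟨s, by zify; rw [hs]; ring,
    (h.prime.coprime_iff_not_dvd).2 fun hd => hs' (by exact_mod_cast hd)⟩

theorem vNum_prime_pow {p : ℕ} (hp : p.Prime) (μ ν ρ σ x : ℕ) :
    vNum p (p ^ μ) (p ^ ν) (1 + p ^ ρ) (p ^ σ) x =
      p ^ (min ν x + min μ (min ρ (min x (σ + (x - min ν x))))) := by
  rw [vNum, Nat.add_sub_cancel_left, gcd_prime_pow, Nat.pow_div (min_le_right _ _) hp.pos,
    ← pow_add, gcd_prime_pow, gcd_prime_pow, gcd_prime_pow, ← pow_add]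

namespace OrdForm

variable {K : Type*} [Field K] {p μ ν ρ σ μ' ν' ρ' σ' : ℕ}

theorem pow_modEq_one_iff (h : OrdForm p μ ν ρ σ) (d : ℕ) :
    (1 + p ^ ρ) ^ d ≡ 1 [MOD p ^ μ] ↔ p ^ (μ - ρ) ∣ d := by
  rw [h.unitLevel.pow_modEq_one_iff]
  rcases le_total ρ μ with h1 | h1
  · rw [show p ^ μ = p ^ ρ * p ^ (μ - ρ) by rw [← pow_add, Nat.add_sub_cancel' h1]]
    exact Nat.mul_dvd_mul_iff_left (pow_pos h.prime.pos _)
  · rw [Nat.sub_eq_zero_of_le h1, pow_zero]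
    simp [(pow_dvd_pow p h1).mul_right d]

theorem exponent_eq_iff (h : OrdForm p μ ν ρ σ) (x : ℕ) :
    min ν x + min μ (min ρ (min x (σ + (x - min ν x)))) = 2 * x ↔ x ≤ min ρ (min ν σ) := by
  have h1 := h.sig_le
  rcases le_total x ν with h2 | h2
  · rw [min_eq_right h2, Nat.sub_self]
    omega
  · rw [min_eq_left h2]
    omega

theorem invariants_eq (h : OrdForm p μ ν ρ σ) (h' : OrdForm p μ' ν' ρ' σ')
    (hI : PairInv K p (p ^ μ) (p ^ ν) (1 + p ^ ρ) (p ^ σ) (p ^ μ') (p ^ ν') (1 + p ^ ρ')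
      (p ^ σ')) :
    μ + ν = μ' + ν' ∧ μ - ρ = μ' - ρ' ∧ min ρ (min ν σ) = min ρ' (min ν' σ') := by
  have hp := h.prime
  have hinj := Nat.pow_right_injective hp.two_le
  have hN : μ + ν = μ' + ν' := hinj (by simpa only [pow_add] using hI.card)
  have hg := hI.gcd_eq 1
  rw [pow_one, pow_one, Nat.add_sub_cancel_left, Nat.add_sub_cancel_left, gcd_prime_pow,
    gcd_prime_pow, ← pow_add, ← pow_add] at hg
  have hg' := hinj hg
  refine ⟨hN, by omega, eq_of_forall_le_iff fun x => ?_⟩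
  rcases Nat.eq_zero_or_pos x with rfl | hx
  · simp
  have hv := hI.vNum_eq x hx
  rw [vNum_prime_pow hp, vNum_prime_pow hp] at hv
  rw [← h.exponent_eq_iff, ← h'.exponent_eq_iff, hinj hv]

theorem le_of_pairInv (h : OrdForm p μ ν ρ σ) (h' : OrdForm p μ' ν' ρ' σ')
    (hI : PairInv K p (p ^ μ) (p ^ ν) (1 + p ^ ρ) (p ^ σ) (p ^ μ') (p ^ ν') (1 + p ^ ρ')
      (p ^ σ')) : min ν' σ' ≤ min ν σ := by
  by_contra! hf
  have hp := h.prime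
  obtain ⟨hN, hκ, he⟩ := h.invariants_eq h' hI
  have h1 := h.sig_le
  have h1' := h'.sig_le
  have h2 := h'.one_le
  rcases lt_or_ge (min ν σ) ρ with hρ | hρ
  · refine hI.false_of_lt_level (x := ρ') (t := 1) h2 (Nat.coprime_one_right _) ?_
      (pow_dvd_pow p (by omega)) (pow_dvd_pow p (by omega)) (pow_dvd_pow p (by omega)) (by ring)
    exact ((Nat.modEq_zero_iff_dvd).2 (pow_dvd_pow p (by omega))).add_left 1
  · obtain rfl : ρ = ρ' := by omega
    obtain rfl : μ = μ' := by omega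
    obtain rfl : ν = ν' := by omega
    have h3 := h.le_add_nu
    have hU := h.unitLevel.pow (ν - min ν σ')
    obtain ⟨t, ht, ht'⟩ := UnitLevel.exists_nat (r := (1 + p ^ ρ) ^ p ^ (ν - min ν σ'))
      (by exact_mod_cast hU) (by positivity)
    have hdiv : p ^ (ρ + (ν - min ν σ')) /
        (p ^ ν / p ^ (μ - ρ)).gcd (p ^ (ρ + (ν - min ν σ'))) = p ^ (μ - min ν σ') := by
      rw [Nat.pow_div (by omega) hp.pos, gcd_prime_pow, Nat.pow_div (by omega) hp.pos]
      congr 1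
      omega
    refine hI.false_of_cyclic_eq (x := ρ + (ν - min ν σ')) (k := 1) (k' := 1)
      (i := p ^ (ν - min ν σ')) (δ := p ^ (μ - ρ)) (by omega) ht' (by rw [pow_one])
      (by rw [pow_one]) (by rw [ht]) ?_ h.pow_modEq_one_iff ?_ ?_
    · rw [gcd_prime_pow]
      exact pow_dvd_pow p (by omega)
    · rw [hdiv, ← pow_add]
      exact pow_dvd_pow p (by omega)
    · rw [hdiv, ← pow_add, Nat.pow_dvd_pow_iff_le_right hp.one_lt]
      omega

theorem mulEquiv_of_pairInv {G H : Type*} [Group G] [Group H]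
    (h : OrdForm p μ ν ρ σ) (h' : OrdForm p μ' ν' ρ' σ')
    (hI : PairInv K p (p ^ μ) (p ^ ν) (1 + p ^ ρ) (p ^ σ) (p ^ μ') (p ^ ν') (1 + p ^ ρ')
      (p ^ σ'))
    (D : MetaData G (p ^ μ) (p ^ ν) (1 + p ^ ρ) (p ^ σ))
    (D' : MetaData H (p ^ μ') (p ^ ν') (1 + p ^ ρ') (p ^ σ')) : Nonempty (G ≃* H) := by
  obtain ⟨hN, hκ, he⟩ := h.invariants_eq h' hI
  exact h.mulEquiv h' D D' hN hκ
    (le_antisymm (h'.le_of_pairInv h hI.symm) (h.le_of_pairInv h' hI)) he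

end OrdForm

/-- The exponents of a metacyclic `2`-group with `b * a * b⁻¹ = a ^ (2 ^ ρ - 1)` and
`b ^ 2 ^ ν = a ^ 2 ^ σ`. -/
structure ExcForm (μ ν ρ σ : ℕ) : Prop where
  two_le : 2 ≤ ρ
  le : ρ ≤ μ
  one_le : 1 ≤ ν
  le_add : μ ≤ ρ + ν
  sig_le : σ ≤ μ
  le_sig : μ ≤ σ + 1

theorem unitLevel_neg {ρ : ℕ} (h : 2 ≤ ρ) : UnitLevel 2 ρ (-((2 ^ ρ - 1 : ℕ) : ℤ)) :=
  ⟨Nat.prime_two, by omega, fun _ => h, -1, by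
    rw [Nat.cast_sub (Nat.one_le_pow _ _ two_pos)]; push_cast; ring, by norm_num⟩

theorem UnitLevel.neg_pow_modEq_one_iff {ρ r : ℕ} (h : UnitLevel 2 ρ (-(r : ℤ))) (μ : ℕ) {d : ℕ}
    (hd : Even d) : r ^ d ≡ 1 [MOD 2 ^ μ] ↔ 2 ^ μ ∣ 2 ^ ρ * d := by
  have := h.pow_dvd_pow_sub_one μ d
  rw [hd.neg_pow, ← Int.modEq_iff_dvd] at this
  rw [Nat.ModEq.comm, ← Int.natCast_modEq_iff, ← Int.natCast_dvd_natCast]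
  exact_mod_cast this

theorem pow_not_modEq_one {μ r d : ℕ} (hμ : 2 ≤ μ) (hr : r % 4 = 3) (hd : Odd d) :
    ¬ r ^ d ≡ 1 [MOD 2 ^ μ] := fun h => by
  have h1 : r ^ d ≡ 1 [MOD 4] := h.of_dvd (pow_dvd_pow 2 hμ)
  obtain ⟨e, rfl⟩ := hd
  have h2 : r ^ (2 * e + 1) % 4 = 3 := by
    rw [pow_succ, pow_mul, Nat.mul_mod, Nat.pow_mod, Nat.pow_mod r 2, hr]
    simp
  rw [Nat.ModEq, h2] at h1
  norm_num at h1

theorem two_pow_sub_one_mod_four {ρ : ℕ} (h : 2 ≤ ρ) : (2 ^ ρ - 1) % 4 = 3 := by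
  obtain ⟨k, rfl⟩ := Nat.exists_eq_add_of_le h
  have : 0 < 2 ^ k := by positivity
  rw [pow_add]
  omega

theorem MetaNum.exists_excForm {μ ν r z : ℕ} (h : MetaNum (2 ^ μ) (2 ^ ν) r z) (hμ : 2 ≤ μ)
    (hr : r % 4 = 3) :
    ∃ ρ σ, ExcForm μ ν ρ σ ∧ Twist 2 (2 ^ μ) r z (2 ^ ρ - 1) (2 ^ σ) := by
  obtain ⟨σ, hσ, hgcd⟩ := (Nat.dvd_prime_pow Nat.prime_two).1 (Nat.gcd_dvd_left (2 ^ μ) z)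
  have hz : (2 ^ μ).gcd z = (2 ^ μ).gcd (2 ^ σ) := by rw [gcd_prime_pow, min_eq_right hσ, hgcd]
  obtain ⟨ρ, t, ht, hρ⟩ :=
    Nat.exists_eq_pow_mul_and_not_dvd (Nat.succ_ne_zero r) 2 (by norm_num)
  have hρ2 : 2 ≤ ρ := by
    by_contra! h1
    interval_cases ρ <;> omega
  have hU : UnitLevel 2 ρ (-(r : ℤ)) :=
    ⟨Nat.prime_two, by omega, fun _ => hρ2, -(t : ℤ), by
      have : (r : ℤ) + 1 = 2 ^ ρ * t := by exact_mod_cast hρ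
      push_cast
      linarith, by rw [dvd_neg]; exact_mod_cast ht⟩
  have hν : 1 ≤ ν := by
    by_contra! h1
    obtain rfl : ν = 0 := by omega
    exact pow_not_modEq_one hμ hr odd_one h.r_pow
  have hle : μ ≤ ρ + ν := by
    have h1 := (hU.neg_pow_modEq_one_iff μ
      (by rw [Nat.even_pow]; exact ⟨even_two, by omega⟩)).1 h.r_pow
    rwa [← pow_add, Nat.pow_dvd_pow_iff_le_right one_lt_two] at h1
  have hσ' : μ ≤ σ + 1 := by
    have h1 : 2 ^ μ ∣ z * (r - 1) := by
      rw [Nat.mul_sub_one, ← Nat.modEq_iff_dvd' (Nat.le_mul_of_pos_right _ (by omega))]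
      exact h.z_mul.symm
    obtain ⟨s, hs⟩ : ∃ s, r - 1 = 2 * (2 * s + 1) := ⟨r / 4, by omega⟩
    rw [hs, ← mul_assoc] at h1
    have h2 := (Nat.Coprime.pow_left μ (Nat.coprime_two_left.2 (odd_two_mul_add_one s))
      ).dvd_of_dvd_mul_right h1
    have h3 : 2 ^ (μ - 1) ∣ z := by
      rw [show μ = μ - 1 + 1 by omega, pow_succ] at h2
      exact Nat.dvd_of_mul_dvd_mul_right two_pos h2
    have h4 := Nat.dvd_gcd (pow_dvd_pow 2 (Nat.sub_le μ 1)) h3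
    rw [hgcd, Nat.pow_dvd_pow_iff_le_right one_lt_two] at h4
    omega
  rcases le_total μ ρ with h1 | h1
  · refine ⟨μ, σ, ⟨hμ, le_rfl, hν, by omega, hσ, hσ'⟩, Twist.of_modEq ?_ hz⟩
    refine Nat.ModEq.add_right_cancel' 1 ?_
    rw [Nat.sub_add_cancel (Nat.one_le_pow _ _ two_pos), ← Nat.succ_eq_add_one, hρ]
    exact ((Nat.modEq_zero_iff_dvd).2 ((pow_dvd_pow 2 h1).mul_right t)).trans
      ((Nat.modEq_zero_iff_dvd).2 dvd_rfl).symm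
  · exact ⟨ρ, σ, ⟨hρ2, h1, hν, hle, hσ, hσ'⟩, UnitLevel.neg_twist rfl hU (unitLevel_neg hρ2) hz⟩

namespace ExcForm

variable {K : Type*} [Field K] {G H : Type*} [Group G] [Group H] {μ ν ρ σ μ' ν' ρ' σ' : ℕ}

theorem pow_modEq_one_iff (h : ExcForm μ ν ρ σ) (d : ℕ) :
    (2 ^ ρ - 1) ^ d ≡ 1 [MOD 2 ^ μ] ↔ 2 ^ max 1 (μ - ρ) ∣ d := by
  rcases Nat.even_or_odd d with hd | hd
  · have h1 := h.le
    rw [(unitLevel_neg h.two_le).neg_pow_modEq_one_iff μ hd,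
      show 2 ^ μ = 2 ^ ρ * 2 ^ (μ - ρ) by rw [← pow_add, Nat.add_sub_cancel' h1],
      Nat.mul_dvd_mul_iff_left (by positivity)]
    rcases le_total 1 (μ - ρ) with h2 | h2
    · rw [max_eq_right h2]
    · rw [max_eq_left h2, pow_one]
      exact ⟨fun _ => hd.two_dvd, (pow_dvd_pow 2 h2).trans⟩
  · refine iff_of_false (pow_not_modEq_one (h.two_le.trans h.le)
      (two_pow_sub_one_mod_four h.two_le) hd) fun h1 => ?_
    have h2 : 2 ∣ d := (dvd_pow_self 2 (by omega)).trans h1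
    exact (Nat.not_even_iff_odd.2 hd) (even_iff_two_dvd.2 h2)

theorem exists_sub_one (h : ExcForm μ ν ρ σ) : ∃ s, 2 ^ ρ - 1 = 2 * (2 * s + 1) + 1 := by
  have := two_pow_sub_one_mod_four h.two_le
  exact ⟨(2 ^ ρ - 1) / 4, by omega⟩

theorem gcd_sub_one (h : ExcForm μ ν ρ σ) : (2 ^ μ).gcd ((2 ^ ρ - 1) ^ 1 - 1) = 2 := by
  obtain ⟨s, hs⟩ := h.exists_sub_one
  have h1 := h.two_le
  have h2 := h.le
  rw [pow_one, hs, Nat.add_sub_cancel, show μ = μ - 1 + 1 by omega, pow_succ, mul_comm (2 ^ _),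
    Nat.gcd_mul_left, Nat.Coprime.gcd_eq_one, mul_one]
  exact Nat.Coprime.pow_left _ (Nat.coprime_two_left.2 (odd_two_mul_add_one s))

theorem gcd_sq_sub_one (h : ExcForm μ ν ρ σ) :
    (2 ^ μ).gcd ((2 ^ ρ - 1) ^ 2 - 1) = 2 ^ min μ (ρ + 1) := by
  obtain ⟨i, hi, hg⟩ :=
    (Nat.dvd_prime_pow Nat.prime_two).1 (Nat.gcd_dvd_left (2 ^ μ) ((2 ^ ρ - 1) ^ 2 - 1))
  rw [hg]
  congr 1
  have key : ∀ c, c ≤ μ → (c ≤ i ↔ c ≤ ρ + 1) := fun c hc => by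
    have h1 := (unitLevel_neg h.two_le).neg_pow_modEq_one_iff c even_two
    rw [← pow_succ, Nat.pow_dvd_pow_iff_le_right one_lt_two, Nat.ModEq.comm,
      Nat.modEq_iff_dvd' (Nat.one_le_pow _ _
        (Nat.sub_pos_of_lt (Nat.one_lt_pow (by have := h.two_le; omega) one_lt_two)))] at h1
    rw [← h1, ← Nat.pow_dvd_pow_iff_le_right one_lt_two, ← hg, Nat.dvd_gcd_iff]
    exact and_iff_right (pow_dvd_pow 2 hc)
  have h1 := key (min μ (ρ + 1)) (min_le_left _ _)
  have h2 := key i hi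
  omega

theorem pow_dvd_geom_sum_iff (h : ExcForm μ ν ρ σ) (c : ℕ) :
    2 ^ c ∣ ∑ i ∈ Finset.range (2 ^ ν), (2 ^ ρ - 1) ^ i ↔ c + 1 ≤ ρ + ν := by
  obtain ⟨s, hs⟩ := h.exists_sub_one
  have h1 := (unitLevel_neg h.two_le).neg_pow_modEq_one_iff (c + 1) (d := 2 ^ ν)
    (by rw [Nat.even_pow]; exact ⟨even_two, by have := h.one_le; omega⟩)
  rw [← pow_add, Nat.pow_dvd_pow_iff_le_right one_lt_two, Nat.ModEq.comm,
    Nat.modEq_iff_dvd' (Nat.one_le_pow _ _ (by omega))] at h1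
  have h3 : (2 ^ ρ - 1) ^ 2 ^ ν - 1 =
      2 * ((2 * s + 1) * ∑ i ∈ Finset.range (2 ^ ν), (2 ^ ρ - 1) ^ i) := by
    have h4 := geom_sum_mul_add (2 * (2 * s + 1)) (2 ^ ν)
    rw [← hs] at h4
    rw [← h4, Nat.add_sub_cancel]
    ring
  rw [← h1, h3, pow_succ, mul_comm (2 ^ c), Nat.mul_dvd_mul_iff_left two_pos,
    Nat.Coprime.dvd_mul_left]
  exact Nat.Coprime.pow_left _ (Nat.coprime_two_left.2 (odd_two_mul_add_one s))

end ExcForm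

namespace ExcForm

variable {K : Type*} [Field K] {G H : Type*} [Group G] [Group H] {μ ν ρ σ μ' ν' ρ' σ' : ℕ}

theorem exponents_eq (h : ExcForm μ ν ρ σ) (h' : ExcForm μ' ν' ρ' σ')
    (hI : PairInv K 2 (2 ^ μ) (2 ^ ν) (2 ^ ρ - 1) (2 ^ σ) (2 ^ μ') (2 ^ ν') (2 ^ ρ' - 1)
      (2 ^ σ')) : μ = μ' ∧ ν = ν' ∧ min μ (ρ + 1) = min μ (ρ' + 1) := by
  have hinj := Nat.pow_right_injective (le_refl 2)
  have hN : μ + ν = μ' + ν' := hinj (by simpa only [pow_add] using hI.card)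
  have hg := hI.gcd_eq 1
  rw [h.gcd_sub_one, h'.gcd_sub_one, ← pow_succ, ← pow_succ] at hg
  have hν := hinj hg
  obtain rfl : ν = ν' := by omega
  obtain rfl : μ = μ' := by omega
  have hg2 := hI.gcd_eq 2
  rw [h.gcd_sq_sub_one, h'.gcd_sq_sub_one] at hg2
  exact ⟨rfl, rfl, hinj (Nat.eq_of_mul_eq_mul_left (by positivity) hg2)⟩

theorem false_of_pairInv (h : ExcForm μ ν ρ (μ - 1)) (hν : max 1 (μ - ρ) < ν)
    (hI : PairInv K 2 (2 ^ μ) (2 ^ ν) (2 ^ ρ - 1) (2 ^ (μ - 1)) (2 ^ μ) (2 ^ ν) (2 ^ ρ - 1)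
      (2 ^ μ)) : False := by
  obtain ⟨s, hs⟩ := h.exists_sub_one
  have hμ := h.two_le.trans h.le
  have hdiv : 2 ^ 1 / (2 ^ ν / 2 ^ max 1 (μ - ρ)).gcd (2 ^ 1) = 1 := by
    rw [Nat.pow_div hν.le two_pos, gcd_prime_pow, min_eq_right (by omega)]
    norm_num
  refine hI.false_of_cyclic_eq (x := 1) (t := 2 * s + 1) (k := 1) (k' := 1) (i := 1)
    (δ := 2 ^ max 1 (μ - ρ)) le_rfl (Nat.coprime_two_left.2 (odd_two_mul_add_one s))
    (by rw [pow_one]) (by rw [pow_one]) (by rw [pow_one, pow_one, hs])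
    ((Nat.gcd_dvd_left _ _)) h.pow_modEq_one_iff (by rw [hdiv, mul_one]) ?_
  rw [hdiv, mul_one, Nat.pow_dvd_pow_iff_le_right one_lt_two]
  omega

theorem split (h : ExcForm μ ν ρ (μ - 1)) (hν : μ - ρ = ν)
    (D : MetaData G (2 ^ μ) (2 ^ ν) (2 ^ ρ - 1) (2 ^ (μ - 1))) :
    Nonempty (MetaData G (2 ^ μ) (2 ^ ν) (2 ^ ρ - 1) (2 ^ μ)) := by
  have hμ := h.two_le.trans h.le
  have h1 := h.le
  obtain ⟨u, hu⟩ := (h.pow_dvd_geom_sum_iff (μ - 1)).2 (by omega)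
  have hu' : ¬ 2 ∣ u := by
    rintro ⟨v, rfl⟩
    have := (h.pow_dvd_geom_sum_iff μ).1 ⟨v, by
      rw [hu, ← mul_assoc, ← pow_succ, Nat.sub_add_cancel (by omega)]⟩
    omega
  refine ⟨D.shift (by positivity) 1 ?_⟩
  refine Nat.ModEq.trans ((Nat.modEq_zero_iff_dvd).2 ?_) ((Nat.modEq_zero_iff_dvd).2 dvd_rfl).symm
  obtain ⟨v, hv⟩ : ∃ v, u + 1 = 2 * v := ⟨(u + 1) / 2, by omega⟩
  rw [one_mul, hu, ← Nat.mul_succ, Nat.succ_eq_add_one, hv, ← mul_assoc, ← pow_succ,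
    Nat.sub_add_cancel (by omega)]
  exact dvd_mul_right _ _

theorem false_of_half (h : ExcForm μ ν ρ σ) (h' : ExcForm μ ν ρ' σ')
    (hρ : ρ + 1 = μ ∧ ρ' = μ ∨ ρ = μ ∧ ρ' + 1 = μ) (hσ : ν = 1 ∨ σ' = μ)
    (hI : PairInv K 2 (2 ^ μ) (2 ^ ν) (2 ^ ρ - 1) (2 ^ σ) (2 ^ μ) (2 ^ ν) (2 ^ ρ' - 1)
      (2 ^ σ')) : False := by
  obtain ⟨s, hs⟩ := h'.exists_sub_one
  have h2 := h.two_le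
  have h2' := h'.two_le
  obtain ⟨c, rfl⟩ : ∃ c, μ = c + 1 := ⟨μ - 1, by omega⟩
  have hsq := (h.pow_modEq_one_iff 2).2 (by rw [max_eq_left (by omega), pow_one])
  have hsq' := (h'.pow_modEq_one_iff 2).2 (by rw [max_eq_left (by omega), pow_one])
  have hc : 0 < 2 ^ c := by positivity
  have h3 := h'.le_sig
  rw [pow_succ, mul_comm (2 ^ c)] at hsq hsq' hI
  refine hI.false_of_half (t := 2 * s + 1) ?_ (odd_two_mul_add_one s) hs ?_ hsq hsq'
    (pow_dvd_pow 2 (by omega)) ?_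
  · rw [Nat.even_pow]
    exact ⟨even_two, by omega⟩
  · rcases hρ with ⟨h4, rfl⟩ | ⟨rfl, h4⟩
    · obtain rfl : ρ = c := by omega
      refine (Nat.modEq_iff_dvd' ?_).2 ?_
      · omega
      · rw [show 2 ^ (ρ + 1) - 1 + 2 ^ ρ - (2 ^ ρ - 1) = 2 * 2 ^ ρ by rw [pow_succ]; omega]
    · obtain rfl : ρ' = c := by omega
      rw [show 2 ^ (ρ' + 1) - 1 = 2 ^ ρ' - 1 + 2 ^ ρ' by rw [pow_succ]; omega]
  · rcases hσ with rfl | rfl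
    · rw [mul_comm 2 (2 ^ c)]
      norm_num
      exact Nat.mul_dvd_mul_right (pow_dvd_pow 2 (by omega)) _
    · rw [pow_succ, mul_comm 2 (2 ^ c)]
      exact dvd_mul_right _ _

theorem half (h : ExcForm μ ν μ (μ - 1)) (hμ : 3 ≤ μ) (hν : 2 ≤ ν)
    (D : MetaData G (2 ^ μ) (2 ^ ν) (2 ^ μ - 1) (2 ^ (μ - 1))) :
    Nonempty (MetaData G (2 ^ μ) (2 ^ ν) (2 ^ (μ - 1) - 1) (2 ^ (μ - 1))) := by
  set c := D.b ^ 2 ^ (ν - 1) with hc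
  have hcc : c * c = D.a ^ 2 ^ (μ - 1) := by
    rw [hc, ← pow_add, ← two_mul, ← pow_succ', Nat.sub_add_cancel (by omega), D.b_pow]
  have hca : c * D.a = D.a * c := by
    have h1 := D.conj_pow 1 (2 ^ (ν - 1))
    rw [one_mul, pow_one, ← hc, (D.a_pow_eq_iff (j := 1)).2, pow_one, mul_inv_eq_iff_eq_mul] at h1
    · exact h1
    · rw [h.pow_modEq_one_iff, Nat.sub_self, Nat.pow_dvd_pow_iff_le_right one_lt_two]
      omega
  have hcom : Commute D.a c := hca.symm
  have hcb : Commute D.b c := (Commute.refl D.b).pow_right _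
  have hinv : D.b * D.a * D.b⁻¹ = D.a⁻¹ := by
    rw [D.conj, eq_inv_iff_mul_eq_one, ← pow_succ, Nat.sub_add_cancel (Nat.one_le_pow _ _ two_pos),
      D.a_pow_m]
  have hpow : (D.a * c) ^ 2 ^ (μ - 1) = D.a ^ 2 ^ (μ - 1) := by
    rw [hcom.mul_pow]
    have h1 : c ^ 2 ^ (μ - 1) = 1 := by
      rw [show μ - 1 = 1 + (1 + (μ - 3)) by omega, pow_add, pow_mul, pow_one, pow_two, hcc,
        ← pow_mul, pow_add 2 1, ← mul_assoc, pow_one, ← pow_succ, Nat.sub_add_cancel (by omega),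
        pow_mul, D.a_pow_m, one_pow]
    rw [h1, mul_one]
  refine ⟨D.change (by positivity) (a := D.a * c) (b := D.b) (by positivity) D.n_pos ?_ ?_ ?_ ?_
    (Subgroup.subset_closure (Set.mem_insert_of_mem _ (Set.mem_singleton _))) rfl⟩
  · have h1 : 2 ^ μ = 2 ^ (μ - 1) * 2 := by rw [← pow_succ, Nat.sub_add_cancel (by omega)]
    rw [congrArg (fun k => (D.a * c) ^ k) h1, pow_mul, hpow, ← pow_mul, ← h1, D.a_pow_m]
  · have h1 : D.b * (D.a * c) * D.b⁻¹ = D.a⁻¹ * c := by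
      calc D.b * (D.a * c) * D.b⁻¹ = D.b * D.a * (c * D.b⁻¹) := by group
        _ = D.b * D.a * (D.b⁻¹ * c) := by rw [hcb.symm.inv_right.eq]
        _ = D.b * D.a * D.b⁻¹ * c := by group
        _ = _ := by rw [hinv]
    have h2 : D.a⁻¹ * c * (D.a * c) = (D.a * c) ^ 2 ^ (μ - 1) := by
      rw [hpow, ← hcc, ← mul_assoc, mul_assoc D.a⁻¹, hca, inv_mul_cancel_left]
    rw [h1]
    refine mul_right_cancel (b := D.a * c) ?_
    rw [h2, ← pow_succ, Nat.sub_add_cancel (Nat.one_le_pow _ _ two_pos)]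
  · rw [hpow, D.b_pow]
  · have h1 := Subgroup.subset_closure (Set.mem_insert (D.a * c) {D.b})
    have h2 := Subgroup.subset_closure
      (Set.mem_insert_of_mem (D.a * c) (Set.mem_singleton D.b))
    have h3 := mul_mem h1 (inv_mem (Subgroup.pow_mem _ h2 (2 ^ (ν - 1))))
    rwa [← hc, mul_inv_cancel_right] at h3

theorem mulEquiv_of_sig (h : ExcForm μ ν ρ (μ - 1))
    (hI : PairInv K 2 (2 ^ μ) (2 ^ ν) (2 ^ ρ - 1) (2 ^ (μ - 1)) (2 ^ μ) (2 ^ ν) (2 ^ ρ - 1)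
      (2 ^ μ))
    (hν : ν = 1 → ρ ≠ μ) (D : MetaData G (2 ^ μ) (2 ^ ν) (2 ^ ρ - 1) (2 ^ (μ - 1)))
    (D' : MetaData H (2 ^ μ) (2 ^ ν) (2 ^ ρ - 1) (2 ^ μ)) : Nonempty (G ≃* H) := by
  have h1 := h.le
  have h2 := h.one_le
  have h3 := h.le_add
  rcases lt_or_ge (max 1 (μ - ρ)) ν with h4 | h4
  · exact (h.false_of_pairInv h4 hI).elim
  · obtain ⟨D₁⟩ := h.split (by omega) D
    exact ⟨D₁.mulEquiv D'⟩

theorem mulEquiv_of_half (h : ExcForm μ ν ρ σ) (h' : ExcForm μ ν ρ' σ')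
    (hρ : ρ + 1 = μ ∧ ρ' = μ)
    (hI : PairInv K 2 (2 ^ μ) (2 ^ ν) (2 ^ ρ - 1) (2 ^ σ) (2 ^ μ) (2 ^ ν) (2 ^ ρ' - 1)
      (2 ^ σ'))
    (D : MetaData G (2 ^ μ) (2 ^ ν) (2 ^ ρ - 1) (2 ^ σ))
    (D' : MetaData H (2 ^ μ) (2 ^ ν) (2 ^ ρ' - 1) (2 ^ σ')) : Nonempty (G ≃* H) := by
  by_cases h1 : ν = 1 ∨ σ' = μ
  · exact (h.false_of_half h' (Or.inl hρ) h1 hI).elim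
  by_cases h2 : ν = 1 ∨ σ = μ
  · exact (h'.false_of_half h (Or.inr ⟨hρ.2, hρ.1⟩) h2 hI.symm).elim
  push Not at h1 h2
  have h3 := h.sig_le
  have h4 := h'.sig_le
  have h5 := h.le_sig
  have h6 := h'.le_sig
  have h7 := h.two_le
  have h8 := h.one_le
  obtain ⟨h9, rfl⟩ := hρ
  obtain rfl : σ = ρ' - 1 := by omega
  obtain rfl : σ' = ρ' - 1 := by omega
  obtain rfl : ρ = ρ' - 1 := by omega
  obtain ⟨D₁⟩ := h'.half (by omega) (by omega) D'
  exact ⟨D.mulEquiv D₁⟩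

theorem mulEquiv_of_pairInv (h : ExcForm μ ν ρ σ) (h' : ExcForm μ' ν' ρ' σ')
    (hI : PairInv K 2 (2 ^ μ) (2 ^ ν) (2 ^ ρ - 1) (2 ^ σ) (2 ^ μ') (2 ^ ν') (2 ^ ρ' - 1)
      (2 ^ σ'))
    (hσ : ν = 1 → ν' = 1 → ρ = μ → ρ' = μ' → μ = μ' → σ = σ')
    (D : MetaData G (2 ^ μ) (2 ^ ν) (2 ^ ρ - 1) (2 ^ σ))
    (D' : MetaData H (2 ^ μ') (2 ^ ν') (2 ^ ρ' - 1) (2 ^ σ')) : Nonempty (G ≃* H) := by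
  obtain ⟨rfl, rfl, hρ⟩ := h.exponents_eq h' hI
  have h1 := h.sig_le
  have h1' := h'.sig_le
  have h2 := h.le_sig
  have h2' := h'.le_sig
  have h3 := h.le
  have h3' := h'.le
  by_cases h4 : ρ = ρ'
  · subst h4
    by_cases h5 : σ = σ'
    · subst h5
      exact ⟨D.mulEquiv D'⟩
    have h6 : ν = 1 → ρ ≠ μ := fun h7 h8 => h5 (hσ h7 h7 h8 h8 rfl)
    by_cases h7 : σ = μ
    · subst h7
      obtain rfl : σ' = σ - 1 := by omega
      obtain ⟨e⟩ := h'.mulEquiv_of_sig hI.symm h6 D' D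
      exact ⟨e.symm⟩
    · obtain rfl : σ' = μ := by omega
      obtain rfl : σ = σ' - 1 := by omega
      exact h.mulEquiv_of_sig hI h6 D D'
  · by_cases h5 : ρ + 1 = μ
    · exact h.mulEquiv_of_half h' ⟨h5, by omega⟩ hI D D'
    · obtain ⟨e⟩ := h'.mulEquiv_of_half h ⟨by omega, by omega⟩ hI.symm D' D
      exact ⟨e.symm⟩

end ExcForm

namespace ExcForm

variable {μ ν ρ σ : ℕ}

theorem vNum_one (h : ExcForm μ ν ρ σ) : vNum 2 (2 ^ μ) (2 ^ ν) (2 ^ ρ - 1) (2 ^ σ) 1 = 4 := by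
  obtain ⟨s, hs⟩ := h.exists_sub_one
  have h1 := h.one_le
  have h2 := h.two_le.trans h.le
  have h3 := h.le_sig
  have h4 := h.gcd_sub_one
  rw [pow_one] at h4
  rw [vNum, gcd_prime_pow, min_eq_right h1, Nat.div_self (by norm_num), mul_one, gcd_prime_pow,
    min_eq_left (by omega), ← Nat.gcd_assoc, h4]
  norm_num

theorem vNum_two_le (h : ExcForm μ ν ρ σ) :
    vNum 2 (2 ^ μ) (2 ^ ν) (2 ^ ρ - 1) (2 ^ σ) 2 ≤ 8 := by
  have h4 := h.gcd_sub_one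
  rw [pow_one] at h4
  rw [vNum, ← Nat.gcd_assoc (2 ^ μ), h4]
  exact Nat.mul_le_mul (Nat.gcd_le_right _ (by norm_num) : _ ≤ 2 ^ 2)
    (Nat.gcd_le_left _ (by norm_num) : _ ≤ 2)

end ExcForm

theorem MetaData.exists_ordForm {G : Type*} [Group G] {ν : ℕ}
    (D : MetaData G (2 ^ 2) (2 ^ ν) (2 ^ 2 - 1) (2 ^ 1)) (hν : 2 ≤ ν) :
    OrdForm 2 (ν + 1) 1 ν ν ∧
      Nonempty (MetaData G (2 ^ (ν + 1)) (2 ^ 1) (1 + 2 ^ ν) (2 ^ ν)) := by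
  have hO : OrdForm 2 (ν + 1) 1 ν ν :=
    ⟨Nat.prime_two, by omega, fun _ => hν, by omega, le_rfl, by omega⟩
  have D₁ := D.swap two_pos (y := 1) (by norm_num) rfl
  rw [show ν + 2 - 1 = ν + 1 by omega, mul_one] at D₁
  refine ⟨hO, (UnitLevel.twist ?_ hO.unitLevel rfl).metaData Nat.prime_two ⟨_, rfl⟩ ⟨_, rfl⟩ D₁⟩
  refine UnitLevel.of_one_add Nat.prime_two hO.one_le hO.two_le ?_
  have : 0 < 2 ^ ν := by positivity
  rw [pow_succ]
  omega

theorem OrdForm.gcd_pow_prime_sub_one {p μ ν ρ σ : ℕ} (h : OrdForm p μ ν ρ σ) :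
    (p ^ μ).gcd ((1 + p ^ ρ) ^ p - 1) = p ^ min μ (ρ + 1) := by
  have hp := h.prime
  obtain ⟨i, hi, hg⟩ :=
    (Nat.dvd_prime_pow hp).1 (Nat.gcd_dvd_left (p ^ μ) ((1 + p ^ ρ) ^ p - 1))
  rw [hg]
  congr 1
  have key : ∀ c, c ≤ μ → (c ≤ i ↔ c ≤ ρ + 1) := fun c hc => by
    have h1 := h.unitLevel.pow_modEq_one_iff c p
    rw [← pow_succ, Nat.pow_dvd_pow_iff_le_right hp.one_lt, Nat.ModEq.comm,
      Nat.modEq_iff_dvd' (Nat.one_le_pow _ _ (by positivity))] at h1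
    rw [← h1, ← Nat.pow_dvd_pow_iff_le_right hp.one_lt, ← hg, Nat.dvd_gcd_iff]
    exact and_iff_right (pow_dvd_pow p hc)
  have h1 := key (min μ (ρ + 1)) (min_le_left _ _)
  have h2 := key i hi
  omega

theorem OrdForm.mulEquiv_of_excForm {K : Type*} [Field K] {G H : Type*} [Group G] [Group H]
    {μ ν ρ σ μ' ν' ρ' σ' : ℕ} (h : OrdForm 2 μ ν ρ σ) (h' : ExcForm μ' ν' ρ' σ')
    (hI : PairInv K 2 (2 ^ μ) (2 ^ ν) (1 + 2 ^ ρ) (2 ^ σ) (2 ^ μ') (2 ^ ν') (2 ^ ρ' - 1)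
      (2 ^ σ'))
    (D : MetaData G (2 ^ μ) (2 ^ ν) (1 + 2 ^ ρ) (2 ^ σ))
    (D' : MetaData H (2 ^ μ') (2 ^ ν') (2 ^ ρ' - 1) (2 ^ σ')) : Nonempty (G ≃* H) := by
  have hinj := Nat.pow_right_injective (le_refl 2)
  have hN : μ + ν = μ' + ν' := hinj (by simpa only [pow_add] using hI.card)
  have hg1 := hI.gcd_eq 1
  rw [h'.gcd_sub_one, pow_one, Nat.add_sub_cancel_left, gcd_prime_pow, ← pow_add,
    ← pow_succ] at hg1
  have hg1' := hinj hg1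
  have hg2 := hI.gcd_eq 2
  rw [h'.gcd_sq_sub_one, h.gcd_pow_prime_sub_one, ← pow_add, ← pow_add] at hg2
  have hg2' := hinj hg2
  have he1 := hI.vNum_eq 1 le_rfl
  have he2 := hI.vNum_eq 2 (by norm_num)
  rw [h'.vNum_one, vNum_prime_pow Nat.prime_two, show 4 = 2 ^ 2 by norm_num] at he1
  have he1' := (h.exponent_eq_iff 1).1 (hinj he1)
  have he2' : ¬ 2 ≤ min ρ (min ν σ) := fun h2 => by
    have h3 := h'.vNum_two_le
    rw [← he2, vNum_prime_pow Nat.prime_two, (h.exponent_eq_iff 2).2 h2] at h3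
    norm_num at h3
  have h1 := h.two_le rfl
  have h2 := h'.two_le
  have h3 := h'.le
  have h4 := h'.sig_le
  have h5 := h'.le_sig
  obtain rfl : μ' = 2 := by omega
  obtain rfl : ρ' = 2 := by omega
  obtain rfl : μ = ρ + 1 := by omega
  obtain rfl : ν' = ρ + ν - 1 := by omega
  have h6 : σ' = 1 ∨ σ' = 2 := by omega
  rcases h6 with rfl | rfl
  · obtain ⟨h7, ⟨D₁⟩⟩ := D'.exists_ordForm (by omega)
    exact h.mulEquiv h7 D D₁ (by omega) (by omega) (by omega) (by omega)
  · refine (hI.false_of_lt_level (x := 1) (t := 1) le_rfl (Nat.coprime_one_right _) ?_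
      (pow_dvd_pow 2 (by omega)) dvd_rfl dvd_rfl (by norm_num)).elim
    exact ((Nat.modEq_zero_iff_dvd).2 (pow_dvd_pow 2 h1)).add_left 1

section Involutions

variable {R G : Type*} [Ring R] [Algebra ℚ R] [Group G] (B : Module.Basis G ℚ R)

/-- The linear extension of the inversion of a group to an algebra with the group as a basis. -/
def invMap : R →ₗ[ℚ] R := (B.equiv B (Equiv.inv G)).toLinearMap

theorem invMap_basis (g : G) : invMap B (B g) = B g⁻¹ := by
  simp [invMap]

theorem invMap_invMap (x : R) : invMap B (invMap B x) = x := by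
  have : invMap B ∘ₗ invMap B = LinearMap.id := B.ext fun g => by simp [invMap_basis]
  exact LinearMap.congr_fun this x

/-- The elements on which the inversion acts as multiplication by `s`. -/
def invEigen (s : ℚ) : Submodule ℚ R := LinearMap.ker (invMap B - s • LinearMap.id)

theorem mem_invEigen {s : ℚ} {x : R} : x ∈ invEigen B s ↔ invMap B x = s • x := by
  simp [invEigen, sub_eq_zero]

theorem trace_invMap [Finite G] :
    LinearMap.trace ℚ R (invMap B) = ({g : G | g ^ 2 = 1}.ncard : ℚ) := by
  have := Fintype.ofFinite G
  rw [LinearMap.trace_eq_matrix_trace ℚ B, Matrix.trace]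
  have h : ∀ i, Matrix.diag (LinearMap.toMatrix B B (invMap B)) i = if i ^ 2 = 1 then 1 else 0 := by
    intro i
    rw [Matrix.diag_apply, LinearMap.toMatrix_apply, invMap_basis, Module.Basis.repr_self,
      Finsupp.single_apply, pow_two, ← inv_eq_iff_mul_eq_one]
  rw [Finset.sum_congr rfl fun i _ => h i, Finset.sum_boole, ← Set.ncard_coe_finset]
  simp

theorem finrank_invEigen [Finite G] {s : ℚ} (hs : s * s = 1) :
    (Module.finrank ℚ (invEigen B s) : ℚ) =
      (Nat.card G + s * ({g : G | g ^ 2 = 1}.ncard : ℚ)) / 2 := by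
  have := Fintype.ofFinite G
  have := Module.Finite.of_basis B
  have hp : LinearMap.IsProj (invEigen B s) ((2⁻¹ : ℚ) • (LinearMap.id + s • invMap B)) := by
    refine ⟨fun x => ?_, fun x hx => ?_⟩
    · rw [mem_invEigen]
      simp only [LinearMap.smul_apply, LinearMap.add_apply, LinearMap.id_apply, map_smul, map_add,
        invMap_invMap, smul_add, smul_smul]
      rw [add_comm, show s * (2⁻¹ * s) = 2⁻¹ by linear_combination 2⁻¹ * hs, mul_comm s]
    · rw [mem_invEigen] at hx
      simp only [LinearMap.smul_apply, LinearMap.add_apply, LinearMap.id_apply, hx]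
      rw [smul_smul, hs, one_smul, ← two_smul ℚ x, smul_smul]
      norm_num
  rw [← hp.trace, map_smul, map_add, map_smul, trace_invMap, LinearMap.trace_id,
    Module.finrank_eq_nat_card_basis B, smul_eq_mul, smul_eq_mul]
  ring

theorem regTrace_mul_invMap [Fintype G] (hB : ∀ g h, B g * B h = B (g * h)) (x : R) :
    regTrace ℚ R (x * invMap B x) = Nat.card G * ∑ g, B.repr x g ^ 2 := by
  conv_lhs => rw [← B.sum_repr x]
  simp only [map_sum, map_smul, invMap_basis, Finset.sum_mul, Finset.mul_sum, smul_mul_smul_comm,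
    hB, regTrace_basis B hB, smul_eq_mul, mul_inv_eq_one]
  refine Finset.sum_congr rfl fun g _ => ?_
  simp only [mul_ite, mul_zero, Finset.sum_ite_eq', Finset.mem_univ, if_true]
  ring

theorem ncard_sq_eq_one_le {S H : Type*} [Ring S] [Algebra ℚ S] [Group H] [Finite G] [Finite H]
    (hB : ∀ g h, B g * B h = B (g * h)) (C : Module.Basis H ℚ S)
    (hC : ∀ g h, C g * C h = C (g * h)) (e : R ≃ₐ[ℚ] S) :
    {g : G | g ^ 2 = 1}.ncard ≤ {h : H | h ^ 2 = 1}.ncard := by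
  have := Fintype.ofFinite G
  have := Fintype.ofFinite H
  have := Module.Finite.of_basis B
  have := Module.Finite.of_basis C
  have hcard : Nat.card G = Nat.card H := by
    rw [← Module.finrank_eq_nat_card_basis B, ← Module.finrank_eq_nat_card_basis C,
      e.toLinearEquiv.finrank_eq]
  have hdis : Disjoint ((invEigen B 1).map e.toLinearEquiv.toLinearMap) (invEigen C (-1)) := by
    rw [Submodule.disjoint_def]
    rintro _ ⟨x, hx, rfl⟩ hy
    have hx' : invMap B x = x := by simpa using (mem_invEigen B).1 hx
    have hy' : invMap C (e x) = - e x := by simpa using (mem_invEigen C).1 hy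
    have h1 := regTrace_mul_invMap B hB x
    have h2 := regTrace_mul_invMap C hC (e x)
    rw [hx', ← regTrace_algEquiv e, map_mul] at h1
    rw [hy', mul_neg, map_neg, h1, ← hcard, ← mul_neg] at h2
    have h3 := mul_left_cancel₀ (by exact_mod_cast Nat.card_pos.ne') h2
    have h4 : 0 ≤ ∑ h, C.repr (e x) h ^ 2 := Finset.sum_nonneg fun _ _ => sq_nonneg _
    have h5 : 0 ≤ ∑ g, B.repr x g ^ 2 := Finset.sum_nonneg fun _ _ => sq_nonneg _
    have h6 : ∑ g, B.repr x g ^ 2 = 0 := by linarith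
    rw [Finset.sum_eq_zero_iff_of_nonneg fun _ _ => sq_nonneg _] at h6
    have h7 : x = 0 := B.ext_elem fun g => by
      simpa using h6 g (Finset.mem_univ g)
    simp [h7]
  have h1 := Submodule.finrank_add_finrank_le_of_disjoint hdis
  rw [LinearEquiv.finrank_map_eq, Module.finrank_eq_nat_card_basis C] at h1
  have h2 := finrank_invEigen B (s := 1) (by norm_num)
  have h3 := finrank_invEigen C (s := -1) (by norm_num)
  have h4 : (Module.finrank ℚ (invEigen B 1) : ℚ) + Module.finrank ℚ (invEigen C (-1)) ≤
      Nat.card H := by exact_mod_cast h1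
  rw [h2, h3, hcard] at h4
  have h5 : ({g : G | g ^ 2 = 1}.ncard : ℚ) ≤ {h : H | h ^ 2 = 1}.ncard := by linarith
  exact_mod_cast h5

theorem ncard_sq_eq_one_eq {G H : Type*} [Group G] [Group H] [Finite G] [Finite H]
    (e : MonoidAlgebra ℚ G ≃ₐ[ℚ] MonoidAlgebra ℚ H) :
    {g : G | g ^ 2 = 1}.ncard = {h : H | h ^ 2 = 1}.ncard := by
  have hG : ∀ g h : G, MonoidAlgebra.basis G ℚ g * MonoidAlgebra.basis G ℚ h =
    MonoidAlgebra.basis G ℚ (g * h) := by simp [MonoidAlgebra.basis_apply]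
  have hH : ∀ g h : H, MonoidAlgebra.basis H ℚ g * MonoidAlgebra.basis H ℚ h =
    MonoidAlgebra.basis H ℚ (g * h) := by simp [MonoidAlgebra.basis_apply]
  exact le_antisymm (ncard_sq_eq_one_le _ hG _ hH e) (ncard_sq_eq_one_le _ hH _ hG e.symm)

end Involutions

theorem MetaData.two_lt_ncard {G : Type*} [Group G] [Finite G] {μ : ℕ} (hμ : 2 ≤ μ)
    (D : MetaData G (2 ^ μ) (2 ^ 1) (2 ^ μ - 1) (2 ^ μ)) : 2 < {g : G | g ^ 2 = 1}.ncard := by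
  have h1 : 2 ^ μ = 2 ^ (μ - 1) * 2 := by rw [← pow_succ, Nat.sub_add_cancel (by omega)]
  have hlt : 2 ^ (μ - 1) < 2 ^ μ := Nat.pow_lt_pow_right one_lt_two (by omega)
  have hb : ∀ i, D.b ≠ D.a ^ i := fun i hi => by
    have h2 : D.a ^ i * D.a * (D.a ^ i)⁻¹ = D.a ^ (2 ^ μ - 1) := hi ▸ D.conj
    rw [((Commute.refl D.a).pow_left i).eq, mul_inv_cancel_right] at h2
    have h3 := (D.a_pow_eq_iff (i := 1) (j := 2 ^ μ - 1)).1 ((pow_one _).trans h2)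
    exact pow_not_modEq_one hμ (two_pow_sub_one_mod_four hμ) odd_one (by rw [pow_one]; exact h3.symm)
  have ha : D.a ^ 2 ^ (μ - 1) ≠ 1 := fun h2 => by
    rw [← pow_zero D.a, D.a_pow_eq_iff, Nat.modEq_zero_iff_dvd] at h2
    exact absurd (Nat.le_of_dvd (by positivity) h2) (by omega)
  have hsub : ({1, D.a ^ 2 ^ (μ - 1), D.b} : Set G) ⊆ {g : G | g ^ 2 = 1} := by
    rintro g (rfl | rfl | rfl)
    · exact one_pow 2
    · change (D.a ^ 2 ^ (μ - 1)) ^ 2 = 1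
      rw [← pow_mul, ← h1, D.a_pow_m]
    · change D.b ^ 2 = 1
      simpa [D.a_pow_m] using D.b_pow
  have h3 : ({1, D.a ^ 2 ^ (μ - 1), D.b} : Set G).ncard = 3 :=
    Set.ncard_eq_three.2 ⟨_, _, _, ha.symm, fun h => hb 0 (by rw [pow_zero, h]),
      fun h => hb _ h.symm, rfl⟩
  have := Set.ncard_le_ncard hsub
  omega

theorem MetaData.ncard_le_two {G : Type*} [Group G] {μ : ℕ} (hμ : 2 ≤ μ)
    (D : MetaData G (2 ^ μ) (2 ^ 1) (2 ^ μ - 1) (2 ^ (μ - 1))) :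
    {g : G | g ^ 2 = 1}.ncard ≤ 2 := by
  have h1 : 2 ^ μ = 2 ^ (μ - 1) * 2 := by rw [← pow_succ, Nat.sub_add_cancel (by omega)]
  have hlt : 2 ^ (μ - 1) < 2 ^ μ := Nat.pow_lt_pow_right one_lt_two (by omega)
  have hpos : 0 < 2 ^ (μ - 1) := by positivity
  have hsub : {g : G | g ^ 2 = 1} ⊆ {1, D.a ^ 2 ^ (μ - 1)} := by
    intro g hg
    obtain ⟨i, j, hj, rfl⟩ : ∃ i j, j < 2 ∧ g = D.a ^ i * D.b ^ j := by
      obtain ⟨i, -, j, hj, rfl⟩ := D.exists_lt_cover (by positivity) g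
      exact ⟨i, j, hj, rfl⟩
    have hg' : (D.a ^ i * D.b ^ j) ^ 2 = 1 := hg
    interval_cases j
    · rw [pow_zero, mul_one] at hg' ⊢
      rw [← pow_mul, ← pow_zero D.a, D.a_pow_eq_iff, Nat.modEq_zero_iff_dvd, h1] at hg'
      obtain ⟨k, rfl⟩ := Nat.dvd_of_mul_dvd_mul_right two_pos hg'
      rcases Nat.even_or_odd' k with ⟨l, rfl | rfl⟩
      · left
        rw [← mul_assoc, ← h1, pow_mul, D.a_pow_m, one_pow]
      · right
        rw [mul_add, mul_one, ← mul_assoc, ← h1, pow_add, pow_mul, D.a_pow_m, one_pow, one_mul]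
        rfl
    · exfalso
      have h2 := D.mul_b_pow i 2
      replace hg' : (D.a ^ i * D.b) ^ 2 = 1 := by simpa using hg'
      have h3 : D.b ^ 2 = D.a ^ 2 ^ (μ - 1) := by simpa using D.b_pow
      rw [hg', h3, geom_sum_two, Nat.sub_add_cancel (by omega), mul_comm i, pow_mul, D.a_pow_m,
        one_pow, one_mul, ← pow_zero D.a, eq_comm, D.a_pow_eq_iff, Nat.modEq_zero_iff_dvd] at h2
      exact absurd (Nat.le_of_dvd (by positivity) h2) (by omega)
  exact (Set.ncard_le_ncard hsub).trans ((Set.ncard_insert_le _ _).trans (by rw [Set.ncard_singleton]))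

theorem ncard_sq_eq_one_subgroup_le {G : Type*} [Group G] [Finite G] (S : Subgroup G) :
    {s : S | s ^ 2 = 1}.ncard ≤ {g : G | g ^ 2 = 1}.ncard := by
  refine Set.ncard_le_ncard_of_injOn (fun s : S => (s : G)) (fun s hs => ?_)
    (fun s _ t _ h => Subtype.ext h)
  have : s ^ 2 = 1 := hs
  change (s : G) ^ 2 = 1
  exact_mod_cast congrArg (Subtype.val) this

theorem ncard_sq_eq_one_le_two {G : Type*} [Group G] [Finite G] {t : G} (ht : t ^ 2 = 1)
    (ht1 : t ≠ 1) (hc : t ∈ Subgroup.center G) (S : Sylow 2 G)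
    (hS : {s : S | s ^ 2 = 1}.ncard ≤ 2) : {g : G | g ^ 2 = 1}.ncard ≤ 2 := by
  have key : ∀ g : G, g ^ 2 = 1 → ∃ c : G, c⁻¹ * g * c ∈ S := fun g hg => by
    have hg' : IsPGroup 2 (Subgroup.zpowers g) := by
      rintro ⟨_, k, rfl⟩
      refine ⟨1, Subtype.ext ?_⟩
      change (g ^ k) ^ 2 ^ 1 = 1
      rw [pow_one, ← zpow_natCast, ← zpow_mul, mul_comm, zpow_mul, zpow_natCast, hg, one_zpow]
    obtain ⟨Q, hQ⟩ := hg'.exists_le_sylow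
    obtain ⟨c, rfl⟩ := MulAction.exists_smul_eq G S Q
    refine ⟨c, ?_⟩
    have := hQ (Subgroup.mem_zpowers g)
    rw [Sylow.coe_subgroup_smul, Subgroup.mem_pointwise_smul_iff_inv_smul_mem] at this
    have h : c⁻¹ * g * c ∈ (S : Subgroup G) := by simpa [MulAut.smul_def] using this
    exact h
  have htS : t ∈ S := by
    obtain ⟨c, hc'⟩ := key t ht
    rwa [mul_assoc, ← Subgroup.mem_center_iff.1 hc c, inv_mul_cancel_left] at hc'
  have hsub : {g : G | g ^ 2 = 1} ⊆ {1, t} := by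
    intro g hg
    by_contra hgt
    rw [Set.mem_insert_iff, Set.mem_singleton_iff, not_or] at hgt
    obtain ⟨c, hcS⟩ := key g hg
    have hg2 : (c⁻¹ * g * c) ^ 2 = 1 := by
      have : g ^ 2 = 1 := hg
      rw [pow_two] at this ⊢
      rw [show c⁻¹ * g * c * (c⁻¹ * g * c) = c⁻¹ * (g * g) * c by group, this]
      group
    have h1 : ({1, ⟨t, htS⟩, ⟨_, hcS⟩} : Set S).ncard = 3 := by
      refine Set.ncard_eq_three.2 ⟨_, _, _, ?_, ?_, ?_, rfl⟩
      · exact fun h => ht1 (congrArg Subtype.val h).symm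
      · intro h
        have h2 : 1 = c⁻¹ * g * c := congrArg Subtype.val h
        refine hgt.1 ?_
        rw [show g = c * (c⁻¹ * g * c) * c⁻¹ by group, ← h2]
        group
      · intro h
        have h2 : t = c⁻¹ * g * c := congrArg Subtype.val h
        refine hgt.2 ?_
        rw [show g = c * (c⁻¹ * g * c) * c⁻¹ by group, ← h2, Subgroup.mem_center_iff.1 hc c,
          mul_inv_cancel_right]
    have h2 : ({1, ⟨t, htS⟩, ⟨_, hcS⟩} : Set S) ⊆ {s : S | s ^ 2 = 1} := by
      rintro s (rfl | rfl | rfl)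
      · exact one_pow 2
      · exact Subtype.ext ht
      · exact Subtype.ext hg2
    have := Set.ncard_le_ncard h2
    omega
  exact (Set.ncard_le_ncard hsub).trans ((Set.ncard_insert_le _ _).trans (by rw [Set.ncard_singleton]))

theorem MetaNum.exists_form {p P Q r z : ℕ} (hp : p.Prime) (hP : ∃ i, P = p ^ i)
    (hQ : ∃ i, Q = p ^ i) (hr : 0 < r) (h : MetaNum P Q r z) :
    ∃ μ ν ρ σ, P = p ^ μ ∧ Q = p ^ ν ∧
      (OrdForm p μ ν ρ σ ∧ Twist p (p ^ μ) r z (1 + p ^ ρ) (p ^ σ) ∨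
        p = 2 ∧ ExcForm μ ν ρ σ ∧ Twist 2 (2 ^ μ) r z (2 ^ ρ - 1) (2 ^ σ)) := by
  obtain ⟨μ, rfl⟩ := hP
  obtain ⟨ν, rfl⟩ := hQ
  have hord : (p ^ μ ∣ r - 1 ∨ p ∣ r - 1 ∧ (p = 2 → 4 ∣ r - 1)) →
      ∃ μ' ν' ρ σ, p ^ μ = p ^ μ' ∧ p ^ ν = p ^ ν' ∧
        (OrdForm p μ' ν' ρ σ ∧ Twist p (p ^ μ') r z (1 + p ^ ρ) (p ^ σ) ∨
          p = 2 ∧ ExcForm μ' ν' ρ σ ∧ Twist 2 (2 ^ μ') r z (2 ^ ρ - 1) (2 ^ σ)) := fun ho => by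
    obtain ⟨ρ, σ, h1, h2⟩ := h.exists_ordForm hp hr ho
    exact ⟨μ, ν, ρ, σ, rfl, rfl, Or.inl ⟨h1, h2⟩⟩
  rcases Nat.eq_zero_or_pos μ with rfl | hμ
  · exact hord (Or.inl (one_dvd _))
  have hr1 : p ∣ r - 1 := by
    have := Fact.mk hp
    have h1 := h.r_pow.of_dvd (dvd_pow_self p hμ.ne')
    rw [← ZMod.natCast_eq_natCast_iff, Nat.cast_pow, ZMod.pow_card_pow,
      ZMod.natCast_eq_natCast_iff] at h1
    exact (Nat.modEq_iff_dvd' hr).1 h1.symm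
  by_cases h2 : p = 2
  · subst h2
    by_cases h4 : 4 ∣ r - 1
    · exact hord (Or.inr ⟨hr1, fun _ => h4⟩)
    rcases Nat.lt_or_ge μ 2 with h5 | h5
    · obtain rfl : μ = 1 := by omega
      exact hord (Or.inl (by simpa using hr1))
    · obtain ⟨ρ, σ, h6, h7⟩ := h.exists_excForm h5 (by omega)
      exact ⟨μ, ν, ρ, σ, rfl, rfl, Or.inr ⟨rfl, h6, h7⟩⟩
  · exact hord (Or.inr ⟨hr1, fun h => absurd h h2⟩)

/-- Metacyclic `p`-groups with matching numerical data are isomorphic. -/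
theorem PairInv.mulEquiv {K : Type*} [Field K] {S T : Type*} [Group S] [Group T] [Finite S]
    [Finite T] {p P Q r z P' Q' r' z' : ℕ} (hI : PairInv K p P Q r z P' Q' r' z')
    (D : MetaData S P Q r z) (D' : MetaData T P' Q' r' z')
    (hinv : 2 ∣ P → 2 ∣ P' → p = 2 →
      ({s : S | s ^ 2 = 1}.ncard ≤ 2 ↔ {s : T | s ^ 2 = 1}.ncard ≤ 2)) :
    Nonempty (S ≃* T) := by
  have hp := hI.prime
  obtain ⟨μ, ν, ρ, σ, rfl, rfl, hF⟩ := hI.num.exists_form hp hI.P_pow hI.Q_pow hI.r_pos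
  obtain ⟨μ', ν', ρ', σ', rfl, rfl, hF'⟩ := hI.num'.exists_form hp hI.P'_pow hI.Q'_pow hI.r'_pos
  have hpos : ∀ {μ ν ρ σ : ℕ}, ExcForm μ ν ρ σ → 0 < 2 ^ ρ - 1 := fun h => by
    obtain ⟨s, hs⟩ := h.exists_sub_one
    omega
  rcases hF with ⟨hO, hT⟩ | ⟨rfl, hE, hT⟩ <;> rcases hF' with ⟨hO', hT'⟩ | ⟨h2, hE', hT'⟩
  · obtain ⟨D₁⟩ := hT.metaData hp ⟨_, rfl⟩ ⟨_, rfl⟩ D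
    obtain ⟨D₂⟩ := hT'.metaData hp ⟨_, rfl⟩ ⟨_, rfl⟩ D'
    exact hO.mulEquiv_of_pairInv hO'
      (hT'.pairInv (hT.pairInv hI (by positivity)).symm (by positivity)).symm D₁ D₂
  · subst h2
    obtain ⟨D₁⟩ := hT.metaData hp ⟨_, rfl⟩ ⟨_, rfl⟩ D
    obtain ⟨D₂⟩ := hT'.metaData hp ⟨_, rfl⟩ ⟨_, rfl⟩ D'
    exact hO.mulEquiv_of_excForm hE'
      (hT'.pairInv (hT.pairInv hI (by positivity)).symm (hpos hE')).symm D₁ D₂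
  · obtain ⟨D₁⟩ := hT.metaData hp ⟨_, rfl⟩ ⟨_, rfl⟩ D
    obtain ⟨D₂⟩ := hT'.metaData hp ⟨_, rfl⟩ ⟨_, rfl⟩ D'
    obtain ⟨e⟩ := hO'.mulEquiv_of_excForm hE
      (hT'.pairInv (hT.pairInv hI (hpos hE)).symm (by positivity)) D₂ D₁
    exact ⟨e.symm⟩
  · obtain ⟨D₁⟩ := hT.metaData hp ⟨_, rfl⟩ ⟨_, rfl⟩ D
    obtain ⟨D₂⟩ := hT'.metaData hp ⟨_, rfl⟩ ⟨_, rfl⟩ D'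
    have hμ := hE.two_le.trans hE.le
    have hμ' := hE'.two_le.trans hE'.le
    have h1 := hE.sig_le
    have h1' := hE'.sig_le
    have h2 := hE.le_sig
    have h2' := hE'.le_sig
    refine hE.mulEquiv_of_pairInv hE'
      (hT'.pairInv (hT.pairInv hI (hpos hE)).symm (hpos hE')).symm ?_ D₁ D₂
    rintro rfl rfl rfl rfl rfl
    have h3 := hinv (dvd_pow_self 2 (by omega)) (dvd_pow_self 2 (by omega)) rfl
    by_contra h4
    by_cases h5 : σ = ρ
    · subst h5
      obtain rfl : σ' = σ - 1 := by omega
      exact absurd (h3.2 (D₂.ncard_le_two hμ)) (D₁.two_lt_ncard hμ).not_ge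
    · obtain rfl : σ' = ρ := by omega
      obtain rfl : σ = σ' - 1 := by omega
      exact absurd (h3.1 (D₁.ncard_le_two hμ)) (D₂.two_lt_ncard hμ).not_ge

theorem card_eq_of_algEquiv {G H : Type*} [Group G] [Group H] [Finite G] [Finite H]
    (φ : MonoidAlgebra ℚ G ≃ₐ[ℚ] MonoidAlgebra ℚ H) : Nat.card G = Nat.card H := by
  rw [← Module.finrank_eq_nat_card_basis (MonoidAlgebra.basis G ℚ),
    ← Module.finrank_eq_nat_card_basis (MonoidAlgebra.basis H ℚ)]
  exact φ.toLinearEquiv.finrank_eq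

theorem eq_and_eq_of_prime_pow_mul_eq {p A B u v : ℕ} (hp : p.Prime) (hA : ∃ i, A = p ^ i)
    (hB : ∃ i, B = p ^ i) (hu : p.Coprime u) (hv : p.Coprime v) (h : A * u = B * v) :
    A = B ∧ u = v := by
  obtain ⟨a, rfl⟩ := hA
  obtain ⟨b, rfl⟩ := hB
  have h1 : p ^ a = p ^ b := Nat.dvd_antisymm
    ((hv.pow_left a).dvd_of_dvd_mul_right (h ▸ Nat.dvd_mul_right _ _))
    ((hu.pow_left b).dvd_of_dvd_mul_right (h ▸ Nat.dvd_mul_right _ _))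
  exact ⟨h1, Nat.eq_of_mul_eq_mul_left (pow_pos hp.pos b) (h1 ▸ h)⟩

/-- A field containing all roots of unity needed to compare two metacyclic groups of order `N`. -/
theorem exists_pairCount_eq {G H : Type*} [Group G] [Group H] [Finite G] [Finite H]
    (φ : MonoidAlgebra ℚ G ≃ₐ[ℚ] MonoidAlgebra ℚ H) {m n r z m' n' r' z' : ℕ}
    (D : MetaData G m n r z) (D' : MetaData H m' n' r' z') (hm : 0 < m) (hm' : 0 < m')
    (hN : m * n = m' * n') :
    ∃ (K : Type) (_ : Field K) (_ : CharZero K),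
      (∀ d, d ∣ m * n * (m * n) → ∃ ξ : K, IsPrimitiveRoot ξ d) ∧
      ∀ t d, t.Coprime (m * n) → pairCount K m n r z t d = pairCount K m' n' r' z' t d := by
  have hpos : 0 < m * n := Nat.mul_pos hm D.n_pos
  have := NeZero.of_pos (Nat.mul_pos hpos hpos)
  set M := m * n * (m * n) with hM
  have : NeZero (M : ℚ) := NeZero.charZero
  have : IsCyclotomicExtension {M} ℚ (CyclotomicField M ℚ) := CyclotomicField.isCyclotomicExtension M ℚ
  have hμ := IsCyclotomicExtension.zeta_spec M ℚ (CyclotomicField M ℚ)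
  refine ⟨CyclotomicField M ℚ, inferInstance, inferInstance, fun d hd => ?_, fun t d ht => ?_⟩
  · obtain ⟨e, he⟩ := hd
    exact ⟨_, hμ.pow (NeZero.pos M) (he.trans (mul_comm d e))⟩
  · have hζ := hμ.pow (NeZero.pos M) hM
    have hirr := Polynomial.cyclotomic.irreducible_rat (NeZero.pos M)
    have ht' := hμ.pow_of_coprime t (ht.mul_right ht)
    refine pairCount_eq_of_algEquiv φ D D' hm hm' hN hζ
      (τ := (IsCyclotomicExtension.fromZetaAut ht' hirr : _ →ₐ[ℚ] _)) (t := t) ?_ d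
    have h1 := IsCyclotomicExtension.fromZetaAut_spec ht' hirr
    rw [map_pow, AlgEquiv.coe_toAlgHom, h1, ← pow_mul, ← pow_mul, mul_comm t]

theorem MetaData.ncard_sylow_le_two_iff {G : Type*} [Group G] [Finite G] {m n r z : ℕ}
    (D : MetaData G m n r z) (hm0 : 0 < m) (hm : 2 ∣ m) (S : Sylow 2 G) :
    {s : S | s ^ 2 = 1}.ncard ≤ 2 ↔ {g : G | g ^ 2 = 1}.ncard ≤ 2 := by
  refine ⟨fun hS => ?_, (ncard_sq_eq_one_subgroup_le (S : Subgroup G)).trans⟩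
  obtain ⟨w, rfl⟩ := hm
  have ht : (D.a ^ w) ^ 2 = 1 := by
    rw [← pow_mul, ← pow_zero D.a, D.a_pow_eq_iff, mul_comm]
    exact (Nat.modEq_zero_iff_dvd.2 dvd_rfl)
  have ht1 : D.a ^ w ≠ 1 := fun h => by
    rw [← pow_zero D.a, D.a_pow_eq_iff, Nat.modEq_zero_iff_dvd] at h
    exact absurd (Nat.le_of_dvd (by omega) h) (by omega)
  have hr : r % 2 = 1 := by
    have h1 := (D.metaNum hm0).r_pow.of_dvd (Dvd.intro _ rfl)
    by_contra h2
    have h3 : r ≡ 0 [MOD 2] := by change r % 2 = 0; omega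
    have h4 := (h3.pow n).symm.trans h1
    rw [zero_pow D.n_pos.ne'] at h4
    exact absurd h4 (by decide)
  have hb : D.b * D.a ^ w * D.b⁻¹ = D.a ^ w := by
    have h1 := D.conj_pow w 1
    have h2 : ∀ x : G, x ^ 2 = 1 → x ^ r = x := fun x hx => by
      rw [← Nat.div_add_mod r 2, hr, pow_add, pow_mul, hx, one_pow, one_mul, pow_one]
    rw [pow_one, pow_one, pow_mul, h2 _ ht] at h1
    exact h1
  refine ncard_sq_eq_one_le_two ht ht1 (Subgroup.mem_center_iff.2 fun g => ?_) S hS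
  obtain ⟨i, j, rfl⟩ := D.cover g
  have h1 : Commute D.b (D.a ^ w) := mul_inv_eq_iff_eq_mul.1 hb
  exact ((Commute.refl D.a).pow_pow i w).mul_left (h1.pow_left j)

theorem pow_modEq_one_iff_orderOf {P r d : ℕ} : r ^ d ≡ 1 [MOD P] ↔ orderOf (r : ZMod P) ∣ d := by
  rw [orderOf_dvd_iff_pow_eq_one, ← ZMod.natCast_eq_natCast_iff, Nat.cast_pow, Nat.cast_one]

/-- The exponent inverting the prime-to-`p` part does not change `r` when `r` has `p`-power order. -/
theorem MetaNum.pow_modEq_of_pow_modEq_one {p P Q m n r z j k : ℕ}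
    (h : MetaNum (P * m) (Q * n) r z) (hn : p.Coprime n) (hj : r ^ p ^ j ≡ 1 [MOD P])
    (hk : m * n * k ≡ 1 [MOD P * Q]) : r ^ Q ≡ 1 [MOD P] ∧ r ^ (m * n * k) ≡ r [MOD P] := by
  have h1 := pow_modEq_one_iff_orderOf.1 (h.r_pow.of_dvd (Nat.dvd_mul_right P m))
  have h2 : orderOf (r : ZMod P) ∣ Q := Nat.Coprime.dvd_of_dvd_mul_right
    (Nat.Coprime.coprime_dvd_left (pow_modEq_one_iff_orderOf.1 hj) (hn.pow_left j)) h1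
  refine ⟨pow_modEq_one_iff_orderOf.2 h2, ?_⟩
  rw [← ZMod.natCast_eq_natCast_iff, Nat.cast_pow, ← pow_mod_orderOf,
    (hk.of_dvd (h2.mul_left P) : m * n * k % _ = _), pow_mod_orderOf, pow_one]

/-- When `r` does not have `p`-power order modulo `P`, its action on the cyclic normal `p`-subgroup
has no fixed points. -/
theorem MetaNum.not_dvd_of_not_modEq_one {p P Q m n r z : ℕ} (hp : p.Prime)
    (hP : ∃ i, P = p ^ i) (hr : 0 < r) (h : MetaNum (P * m) (Q * n) r z)
    (hj : ∀ j, ¬ r ^ p ^ j ≡ 1 [MOD P]) :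
    p ∣ P ∧ p ≠ 2 ∧ P.gcd (r - 1) = 1 ∧ P ∣ z := by
  obtain ⟨i, rfl⟩ := hP
  have hi : i ≠ 0 := fun hi => hj 0 (by subst hi; rw [pow_zero]; exact Nat.modEq_one)
  have hd : ¬ p ∣ r - 1 := fun hd => by
    have h1 : (p : ℤ) ∣ (r : ℤ) - 1 := by
      have := Int.natCast_dvd_natCast.2 hd
      rwa [Nat.cast_sub hr, Nat.cast_one] at this
    refine hj i ((Nat.modEq_iff_dvd.2 ?_).symm)
    have h2 := (pow_dvd_pow (p : ℤ) i.le_succ).trans (dvd_sub_pow_of_dvd_sub h1 i)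
    rw [one_pow] at h2
    exact_mod_cast h2
  have hco : (p ^ i).Coprime (r - 1) := (hp.coprime_iff_not_dvd.2 hd).pow_left i
  refine ⟨dvd_pow_self p hi, ?_, hco, ?_⟩
  · rintro rfl
    have h1 := h.r_pow.of_dvd ((dvd_pow_self 2 hi).mul_right m)
    have h2 : r % 2 = 0 := by omega
    have h3 : r ≡ 0 [MOD 2] := h2
    have h4 := (h3.pow (Q * n)).symm.trans h1
    rw [zero_pow h.n_pos.ne'] at h4
    exact absurd h4 (by decide)
  · refine hco.dvd_of_dvd_mul_right ?_
    have h1 := (Nat.modEq_iff_dvd' (Nat.le_mul_of_pos_right z hr)).1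
      (h.z_mul.of_dvd (Nat.dvd_mul_right _ m)).symm
    rwa [Nat.mul_sub_one]

theorem MetaNum.dvd_pow_sub_one {p P Q m n r z : ℕ} (hp : p.Prime) (hP : p ∣ P)
    (hQ : ∃ i, Q = p ^ i) (hr : 0 < r) (h : MetaNum (P * m) (Q * n) r z) (k : ℕ) :
    p ∣ r ^ (m * n * k) - 1 := by
  have := Fact.mk hp
  obtain ⟨j, rfl⟩ := hQ
  have h1 := h.r_pow.of_dvd (hP.mul_right m)
  rw [← ZMod.natCast_eq_natCast_iff, Nat.cast_pow, pow_mul, ZMod.pow_card_pow, ← Nat.cast_pow,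
    ZMod.natCast_eq_natCast_iff] at h1
  rw [mul_comm m n, mul_assoc, pow_mul]
  refine (Nat.modEq_iff_dvd' (Nat.one_le_pow _ _ (Nat.pow_pos hr))).1 ?_
  simpa using (h1.pow (m * k)).symm

/-- Metacyclic `p`-groups of odd order whose cyclic normal subgroup splits off are determined by the
size of the fixed points of the action. -/
theorem MetaData.mulEquiv_of_gcd_eq {S T : Type*} [Group S] [Group T] {p P Q r z r' z' : ℕ}
    (hp : p.Prime) (hp2 : p ≠ 2) (hP : ∃ i, P = p ^ i) (hQ : ∃ i, Q = p ^ i)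
    (hr : 0 < r) (hr' : 0 < r') (hd : p ∣ r - 1) (hd' : p ∣ r' - 1) (hz : P ∣ z) (hz' : P ∣ z')
    (hgcd : P.gcd (r - 1) = P.gcd (r' - 1)) (D : MetaData S P Q r z) (D' : MetaData T P Q r' z') :
    Nonempty (S ≃* T) := by
  obtain ⟨μ, rfl⟩ := hP
  obtain ⟨ν, rfl⟩ := hQ
  have hpos : 0 < p ^ μ := pow_pos hp.pos μ
  obtain ⟨ρ, σ, hO, hT⟩ := (D.metaNum hpos).exists_ordForm hp hr (Or.inr ⟨hd, fun h => (hp2 h).elim⟩)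
  obtain ⟨ρ', σ', hO', hT'⟩ :=
    (D'.metaNum hpos).exists_ordForm hp hr' (Or.inr ⟨hd', fun h => (hp2 h).elim⟩)
  obtain ⟨D₁⟩ := hT.metaData hp ⟨_, rfl⟩ ⟨_, rfl⟩ D
  obtain ⟨D₂⟩ := hT'.metaData hp ⟨_, rfl⟩ ⟨_, rfl⟩ D'
  have hgc : ∀ {r z ρ σ : ℕ}, 0 < r → Twist p (p ^ μ) r z (1 + p ^ ρ) (p ^ σ) →
      (p ^ μ).gcd (r - 1) = p ^ min μ ρ := fun {r z ρ σ} hr hT => by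
    rw [← gcd_prime_pow]
    have key : ∀ q, q ∣ p ^ μ → (q ∣ r - 1 ↔ q ∣ p ^ ρ) := fun q hq => by
      simpa using hT.dvd_sub_iff hr (by positivity) hq 1
    exact Nat.dvd_antisymm
      (Nat.dvd_gcd (Nat.gcd_dvd_left _ _) ((key _ (Nat.gcd_dvd_left _ _)).1 (Nat.gcd_dvd_right _ _)))
      (Nat.dvd_gcd (Nat.gcd_dvd_left _ _) ((key _ (Nat.gcd_dvd_left _ _)).2 (Nat.gcd_dvd_right _ _)))
  have hρ : min μ ρ = min μ ρ' :=
    Nat.pow_right_injective hp.two_le ((hgc hr hT).symm.trans (hgcd.trans (hgc hr' hT')))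
  have hσ : ∀ {r z ρ σ : ℕ}, p ^ μ ∣ z → Twist p (p ^ μ) r z (1 + p ^ ρ) (p ^ σ) →
      p ^ σ ≡ 0 [MOD p ^ μ] := fun hz hT => by
    rw [Nat.modEq_zero_iff_dvd, ← Nat.gcd_eq_left_iff_dvd, ← hT.gcd, Nat.gcd_eq_left hz]
  have hmod : 1 + p ^ ρ ≡ 1 + p ^ ρ' [MOD p ^ μ] := by
    refine Nat.ModEq.add_left 1 ?_
    rcases Nat.lt_or_ge ρ μ with h | h
    · obtain rfl : ρ' = ρ := by omega
      rfl
    · exact (Nat.modEq_zero_iff_dvd.2 (pow_dvd_pow p h)).trans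
        (Nat.modEq_zero_iff_dvd.2 (pow_dvd_pow p (by omega))).symm
  exact ⟨(D₁.congr hmod ((hσ hz hT).trans (hσ hz' hT').symm)).mulEquiv D₂⟩

theorem MetaData.sylow_mulEquiv {G H : Type*} [Group G] [Group H] [Finite G] [Finite H]
    (φ : MonoidAlgebra ℚ G ≃ₐ[ℚ] MonoidAlgebra ℚ H) {p P Q m n r z P' Q' m' n' r' z' : ℕ}
    [Fact p.Prime] (D : MetaData G (P * m) (Q * n) r z) (D' : MetaData H (P' * m') (Q' * n') r' z')
    (hm0 : 0 < P * m) (hm0' : 0 < P' * m') (hr : 0 < r) (hr' : 0 < r')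
    (hP : ∃ i, P = p ^ i) (hQ : ∃ i, Q = p ^ i) (hm : p.Coprime m) (hn : p.Coprime n)
    (hP' : ∃ i, P' = p ^ i) (hQ' : ∃ i, Q' = p ^ i) (hm' : p.Coprime m') (hn' : p.Coprime n')
    (S : Sylow p G) (T : Sylow p H) : Nonempty (S ≃* T) := by
  have hp : p.Prime := Fact.out
  have hN : P * m * (Q * n) = P' * m' * (Q' * n') := by
    rw [← D.card_eq hm0, ← D'.card_eq hm0', card_eq_of_algEquiv φ]
  have hPow : ∀ {A B : ℕ}, (∃ i, A = p ^ i) → (∃ i, B = p ^ i) → ∃ i, A * B = p ^ i := by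
    rintro _ _ ⟨a, rfl⟩ ⟨b, rfl⟩
    exact ⟨a + b, (pow_add p a b).symm⟩
  obtain ⟨hPQ, hmn⟩ : P * Q = P' * Q' ∧ m * n = m' * n' :=
    eq_and_eq_of_prime_pow_mul_eq hp (hPow hP hQ) (hPow hP' hQ') (hm.mul_right hn)
      (hm'.mul_right hn') (by linarith)
  have hnum := D.metaNum hm0
  have hnum' := D'.metaNum hm0'
  obtain ⟨K, _, _, hroot, hc⟩ := exists_pairCount_eq φ D D' hm0 hm0' hN
  obtain ⟨ζ, hζ⟩ := hroot _ (Dvd.intro _ rfl)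
  have hgcd : ∀ d, Q * P.gcd (r ^ d - 1) = Q' * P'.gcd (r' ^ d - 1) := fun d => by
    obtain ⟨k, hk⟩ := hPow hQ hP
    obtain ⟨k', hk'⟩ := hPow hQ' hP'
    have hkk : p ^ k' = p ^ k := by rw [← hk, ← hk', mul_comm, ← hPQ, mul_comm]
    exact (MetaNum.gcd_eq (k := k) hp hnum hnum' hr hr' hk.dvd (hkk ▸ hk'.dvd) hm hn hm' hn' hζ hN d
      (hc 1 d (Nat.coprime_one_left _))).1
  obtain ⟨k, hk⟩ : ∃ k, m * n * k ≡ 1 [MOD P * Q] := by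
    obtain ⟨i, hi⟩ := hPow hP hQ
    obtain ⟨k, hk, hk'⟩ := Nat.chineseRemainder ((hm.mul_right hn).pow_left i).symm 0 1
    obtain ⟨e, rfl⟩ := Nat.modEq_zero_iff_dvd.1 hk
    exact ⟨e, hi ▸ hk'⟩
  obtain ⟨D₁⟩ := D.exists_sylow hm0 hP hQ hm hn hk S
  obtain ⟨D₂⟩ := D'.exists_sylow hm0' hP' hQ' hm' hn' (hPQ ▸ hmn ▸ hk) T
  have hPpos := Nat.pos_of_mul_pos_right hm0
  have hPpos' := Nat.pos_of_mul_pos_right hm0'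
  have hQpos : 0 < Q := D₁.n_pos
  have hQpos' : 0 < Q' := D₂.n_pos
  have hiff : ∀ {r P : ℕ} (d : ℕ), 0 < r → (r ^ d ≡ 1 [MOD P] ↔ P.gcd (r ^ d - 1) = P) :=
    fun d hr => by
      rw [Nat.gcd_eq_left_iff_dvd, ← Nat.modEq_iff_dvd' (Nat.one_le_pow _ _ hr), Nat.ModEq.comm]
  have hcrit : ∀ d, r ^ d ≡ 1 [MOD P] ↔ r' ^ d ≡ 1 [MOD P'] := fun d => by
    have h1 := hgcd d
    rw [hiff d hr, hiff d hr']
    constructor <;> intro h2 <;> rw [h2] at h1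
    · exact Nat.eq_of_mul_eq_mul_left hQpos' (by rw [← h1, mul_comm, hPQ, mul_comm])
    · exact Nat.eq_of_mul_eq_mul_left hQpos (by rw [h1, mul_comm, ← hPQ, mul_comm])
  by_cases hj : ∃ j, r ^ p ^ j ≡ 1 [MOD P]
  · obtain ⟨j, hj⟩ := hj
    obtain ⟨h1, h2⟩ := hnum.pow_modEq_of_pow_modEq_one hn hj hk
    obtain ⟨h1', h2'⟩ := hnum'.pow_modEq_of_pow_modEq_one hn' ((hcrit _).1 hj) (hPQ ▸ hmn ▸ hk)
    have hS : SplitNum p P Q m n r z := ⟨hp, hnum,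
      ⟨hPpos, hQpos, h1, hnum.z_mul.of_dvd (Nat.dvd_mul_right _ _)⟩, hP, hQ, hm, hn⟩
    have hS' : SplitNum p P' Q' m' n' r' z' := ⟨hp, hnum',
      ⟨hPpos', hQpos', h1', hnum'.z_mul.of_dvd (Nat.dvd_mul_right _ _)⟩, hP', hQ', hm', hn'⟩
    obtain ⟨ξ, hξ⟩ := hroot (P * P') (mul_dvd_mul ((Dvd.intro _ rfl).mul_right _)
      (hN ▸ (Dvd.intro _ rfl).mul_right _))
    refine (hS.pairInv hS' hr hr' hPQ hmn hξ hζ hc).mulEquiv (D₁.congr h2 rfl) (D₂.congr h2' rfl) ?_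
    rintro h2P h2P' rfl
    refine (D.ncard_sylow_le_two_iff hm0 (h2P.mul_right m) S).trans ?_
    rw [ncard_sq_eq_one_eq φ]
    exact (D'.ncard_sylow_le_two_iff hm0' (h2P'.mul_right m') T).symm
  · push Not at hj
    obtain ⟨h1, h2, h3, h4⟩ := hnum.not_dvd_of_not_modEq_one hp hP hr hj
    obtain ⟨h1', -, h3', h4'⟩ :=
      hnum'.not_dvd_of_not_modEq_one hp hP' hr' fun j h => hj j ((hcrit _).2 h)
    have hQQ : Q = Q' := by
      have := hgcd 1
      rwa [pow_one, pow_one, h3, h3', mul_one, mul_one] at this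
    subst hQQ
    obtain rfl : P = P' := Nat.eq_of_mul_eq_mul_right hQpos hPQ
    refine MetaData.mulEquiv_of_gcd_eq hp h2 hP hQ (Nat.pow_pos hr) (Nat.pow_pos hr')
      (hnum.dvd_pow_sub_one hp h1 hQ hr k) (hnum'.dvd_pow_sub_one hp h1' hQ hr' k) h4 h4'
      (Nat.eq_of_mul_eq_mul_left hQpos ?_) D₁ D₂
    rw [← hmn]
    exact hgcd _

/-- If `ℚG ≅ ℚH` for finite metacyclic `G, H`, then for every prime `p` dividing `|G|`,
the Sylow `p`-subgroups of `G` and `H` are isomorphic. -/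
theorem sylow_iso_of_qalgebra_iso {G H : Type*} [Group G] [Group H] [Finite G] [Finite H]
    (hG : IsMetacyclic G) (hH : IsMetacyclic H)
    (h : Nonempty (MonoidAlgebra ℚ G ≃ₐ[ℚ] MonoidAlgebra ℚ H)) :
    ∀ p : ℕ, p.Prime → p ∣ Nat.card G →
      ∀ (P : Sylow p G) (Q : Sylow p H),
        Nonempty (↥(P : Subgroup G) ≃* ↥(Q : Subgroup H)) := by
  intro p hp _ S T
  obtain ⟨φ⟩ := h
  have := Fact.mk hp
  have hsplit : ∀ m : ℕ, 0 < m → ∃ i u, p.Coprime u ∧ m = p ^ i * u := fun m hm => by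
    obtain ⟨i, u, hu, h⟩ := Nat.exists_eq_pow_mul_and_not_dvd hm.ne' p hp.ne_one
    exact ⟨i, u, hp.coprime_iff_not_dvd.2 hu, h⟩
  obtain ⟨m, n, r, z, hm, -, hr, ⟨D⟩⟩ := hG.exists_metaData
  obtain ⟨m', n', r', z', hm', -, hr', ⟨D'⟩⟩ := hH.exists_metaData
  obtain ⟨i, u, hu, rfl⟩ := hsplit m hm
  obtain ⟨j, v, hv, rfl⟩ := hsplit n D.n_pos
  obtain ⟨i', u', hu', rfl⟩ := hsplit m' hm'
  obtain ⟨j', v', hv', rfl⟩ := hsplit n' D'.n_pos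
  exact D.sylow_mulEquiv φ D' hm hm' (by omega) (by omega) ⟨i, rfl⟩ ⟨j, rfl⟩ hu hv ⟨i', rfl⟩
    ⟨j', rfl⟩ hu' hv' S T

end ArXiv230800432
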